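/- For any β > 0 there exist γ > 0 and an integer n₀ such that the following holds. Let n > n₀ be an even integer and let H be a 3-graph on n vertices with δ₁(H) ≥ (7/16 − γ)·C(n,2). If H is not β-extremal, then H contains a loose Hamilton cycle. -/

import Mathlib

/-- The degree of a vertex in a 3-graph: the number of edges containing it. -/
def hdeg {α : Type*} [DecidableEq α] (H : Finset (Finset α)) (v : α) : ℕ :=
  (H.filter (fun e => v ∈ e)).card

/-- The number of edges of `H` contained in the vertex set `B`. -/
def eIn {α : Type*} [DecidableEq α] (H : Finset (Finset α)) (B : Finset α) : ℕ :=
  (H.filter (fun e => e ⊆ B)).card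

/-- A 3-graph on `n` vertices is `β`-extremal if some vertex set `B` of size `⌊3n/4⌋`
spans at most `β n³` edges. -/
def BetaExtremal (β : ℝ) (n : ℕ) (H : Finset (Finset (Fin n))) : Prop :=
  ∃ B : Finset (Fin n), B.card = 3 * n / 4 ∧ (eIn H B : ℝ) ≤ β * (n : ℝ) ^ 3

/-- A 3-graph on vertex set `Fin n` contains a loose Hamilton cycle. -/
def HasLooseHamCycle (n : ℕ) (H : Finset (Finset (Fin n))) : Prop :=
  ∃ f : ZMod n → Fin n, Function.Bijective f ∧
    ∀ i : ℕ, i < n / 2 →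
      ({f ((2 * i : ℕ) : ZMod n), f ((2 * i + 1 : ℕ) : ZMod n),
        f ((2 * i + 2 : ℕ) : ZMod n)} : Finset (Fin n)) ∈ H

/-! ### Counting solutions of predicates -/

open Classical in
/-- The number of elements of a finite type satisfying a predicate, as a real number. -/
noncomputable def cnt {α : Type*} [Fintype α] (P : α → Prop) : ℝ :=
  ∑ x, if P x then 1 else 0

section Counting

variable {α β : Type*} [Fintype α] [Fintype β]

open Classical in
theorem cnt_eq_card (P : α → Prop) : cnt P = ((Finset.univ.filter P).card : ℝ) := by
  simp [cnt]

theorem cnt_eq_card' (P : α → Prop) [DecidablePred P] :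
    cnt P = ((Finset.univ.filter P).card : ℝ) := by
  classical
  rw [cnt_eq_card]; congr!

theorem cnt_nonneg (P : α → Prop) : 0 ≤ cnt P := by
  classical
  exact Finset.sum_nonneg fun x _ => by split_ifs <;> norm_num

theorem cnt_mono {P Q : α → Prop} (h : ∀ x, P x → Q x) : cnt P ≤ cnt Q := by
  classical
  refine Finset.sum_le_sum fun x _ => ?_
  by_cases hP : P x
  · simp [hP, h x hP]
  · by_cases hQ : Q x <;> simp [hP, hQ]

theorem cnt_congr {P Q : α → Prop} (h : ∀ x, P x ↔ Q x) : cnt P = cnt Q :=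
  le_antisymm (cnt_mono fun x => (h x).1) (cnt_mono fun x => (h x).2)

theorem cnt_true : cnt (fun _ : α => True) = Fintype.card α := by
  classical
  simp [cnt]

theorem cnt_or_le (P Q : α → Prop) : cnt (fun x => P x ∨ Q x) ≤ cnt P + cnt Q := by
  classical
  unfold cnt
  rw [← Finset.sum_add_distrib]
  refine Finset.sum_le_sum fun x _ => ?_
  by_cases hP : P x <;> by_cases hQ : Q x <;> simp [hP, hQ]

theorem cnt_le_add {P Q R : α → Prop} (h : ∀ x, P x → Q x ∨ R x) : cnt P ≤ cnt Q + cnt R :=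
  (cnt_mono h).trans (cnt_or_le Q R)

theorem cnt_add_cnt_not (P : α → Prop) : cnt P + cnt (fun x => ¬ P x) = Fintype.card α := by
  classical
  unfold cnt
  rw [← Finset.sum_add_distrib, ← cnt_true]
  refine Finset.sum_congr rfl fun x _ => ?_
  by_cases hP : P x <;> simp [hP]

theorem cnt_exists_le {ι : Type*} (s : Finset ι) (P : ι → α → Prop) :
    cnt (fun x => ∃ i ∈ s, P i x) ≤ ∑ i ∈ s, cnt (P i) := by
  classical
  induction s using Finset.induction_on with
  | empty => simp [cnt]
  | insert a s ha ih =>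
    rw [Finset.sum_insert ha]
    refine le_trans (cnt_le_add (Q := P a) (R := fun x => ∃ i ∈ s, P i x) ?_) (by linarith)
    rintro x ⟨i, hi, hx⟩
    rcases Finset.mem_insert.1 hi with rfl | hi
    · exact Or.inl hx
    · exact Or.inr ⟨i, hi, hx⟩

theorem cnt_prod (P : α × β → Prop) : cnt P = ∑ a, cnt (fun b => P (a, b)) := by
  classical
  simp only [cnt]
  rw [Fintype.sum_prod_type]

theorem cnt_prod' (P : α × β → Prop) : cnt P = ∑ b, cnt (fun a => P (a, b)) := by
  classical
  simp only [cnt]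
  rw [Fintype.sum_prod_type, Finset.sum_comm]

theorem cnt_equiv (e : α ≃ β) (P : β → Prop) : cnt (fun a => P (e a)) = cnt P := by
  classical
  simp only [cnt]
  exact Equiv.sum_comp e (fun b => if P b then (1 : ℝ) else 0)

theorem cnt_le_of_injective (f : α → β) (hf : Function.Injective f) {P : α → Prop} {Q : β → Prop}
    (h : ∀ x, P x → Q (f x)) : cnt P ≤ cnt Q := by
  classical
  rw [cnt_eq_card, cnt_eq_card]
  exact_mod_cast Finset.card_le_card_of_injOn f (by intro x; simpa using h x) hf.injOn

theorem cnt_and_prod_ge {P : α → Prop} {Q : α → β → Prop} {c d : ℝ}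
    (hd : 0 ≤ d) (hP : c * Fintype.card α ≤ cnt P)
    (hQ : ∀ a, P a → d * Fintype.card β ≤ cnt (Q a)) :
    c * d * Fintype.card (α × β) ≤ cnt (fun x : α × β => P x.1 ∧ Q x.1 x.2) := by
  classical
  rw [cnt_prod, Fintype.card_prod]
  have h1 : cnt P * (d * Fintype.card β) ≤ ∑ a, cnt (fun b => P a ∧ Q a b) := by
    rw [cnt, Finset.sum_mul]
    refine Finset.sum_le_sum fun a _ => ?_
    by_cases ha : P a
    · simpa [ha] using hQ a ha
    · simp only [ha, if_false, zero_mul]; exact cnt_nonneg _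
  refine le_trans ?_ h1
  push_cast
  have : 0 ≤ d * (Fintype.card β : ℝ) := by positivity
  nlinarith [mul_le_mul_of_nonneg_right hP this]

theorem cnt_and_ge (P Q : α → Prop) :
    cnt P + cnt Q - Fintype.card α ≤ cnt (fun x => P x ∧ Q x) := by
  have h := cnt_add_cnt_not P
  have h2 : cnt Q ≤ cnt (fun x => P x ∧ Q x) + cnt (fun x => ¬ P x) :=
    cnt_le_add fun x hx => by by_cases hp : P x <;> simp [hp, hx]
  linarith

theorem cnt_pi_all {t : ℕ} (P : α → Prop) :
    cnt (fun f : Fin t → α => ∀ j, P (f j)) = cnt P ^ t := by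
  classical
  rw [cnt_eq_card' P, cnt_eq_card']
  have : (Finset.univ.filter fun f : Fin t → α => ∀ j, P (f j)) =
      Fintype.piFinset (fun _ : Fin t => Finset.univ.filter P) := by
    ext f; simp [Fintype.mem_piFinset]
  rw [this]; simp [Fintype.card_piFinset]

/-- Blowing up one coordinate of a dense relation. -/
theorem cnt_blowup_one (R : α → β → Prop) (t : ℕ) {c : ℝ} (hc : 0 ≤ c)
    (h : c * Fintype.card (α × β) ≤ cnt (fun x : α × β => R x.1 x.2)) :
    c ^ t * Fintype.card ((Fin t → α) × β) ≤
      cnt (fun x : (Fin t → α) × β => ∀ j, R (x.1 j) x.2) := by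
  classical
  rw [cnt_prod'] at h ⊢
  have e : ∀ b, cnt (fun f : Fin t → α => ∀ j, R (f j) b) = cnt (fun a => R a b) ^ t :=
    fun b => cnt_pi_all (fun a => R a b)
  simp only [e]
  rcases t with _ | t
  · simp
  rcases isEmpty_or_nonempty β with hβ | hβ
  · simp
  have hb : (0 : ℝ) < Fintype.card β := by exact_mod_cast Fintype.card_pos
  have key := pow_sum_div_card_le_sum_pow (s := Finset.univ)
    (f := fun b => cnt (fun a => R a b)) (fun b _ => cnt_nonneg _) t
  refine le_trans ?_ key
  rw [Finset.card_univ, le_div_iff₀ (by positivity)]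
  calc c ^ (t + 1) * (Fintype.card ((Fin (t + 1) → α) × β) : ℝ) * (Fintype.card β : ℝ) ^ t
      = (c * Fintype.card (α × β)) ^ (t + 1) := by
        simp only [Fintype.card_prod, Fintype.card_fun, Fintype.card_fin]; push_cast; ring
    _ ≤ _ := pow_le_pow_left₀ (by positivity) h _

/-- Blowing up all coordinates of a dense relation. -/
theorem cnt_blowup {V : Type} [Fintype V] (t m : ℕ) : ∀ {W : Type} [Fintype W]
    (R : (Fin m → V) → W → Prop) {c : ℝ}, 0 ≤ c →
    c * Fintype.card ((Fin m → V) × W) ≤ cnt (fun x : (Fin m → V) × W => R x.1 x.2) →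
    c ^ (t ^ m) * Fintype.card ((Fin m → Fin t → V) × W) ≤
      cnt (fun x : (Fin m → Fin t → V) × W =>
        ∀ σ : Fin m → Fin t, R (fun i => x.1 i (σ i)) x.2) := by
  induction m with
  | zero =>
    intro W _ R c hc h
    have e : cnt (fun x : (Fin 0 → Fin t → V) × W =>
        ∀ σ : Fin 0 → Fin t, R (fun i => x.1 i (σ i)) x.2) =
        cnt (fun x : (Fin 0 → V) × W => R x.1 x.2) := by
      rw [cnt_prod, cnt_prod]
      simp [Unique.forall_iff]
      congr! 3
    rw [e]
    refine le_trans (le_of_eq ?_) h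
    simp
  | succ m ih =>
    intro W _ R c hc h
    let R' : V → (Fin m → V) → W → Prop := fun v f w => R (Fin.cons v f : Fin (m + 1) → V) w
    have h1 : c * Fintype.card (V × ((Fin m → V) × W)) ≤
        cnt (fun x : V × ((Fin m → V) × W) => R' x.1 x.2.1 x.2.2) := by
      have e := cnt_equiv ((Equiv.prodAssoc V (Fin m → V) W).symm.trans
        ((Fin.consEquiv (fun _ : Fin (m + 1) => V)).prodCongr (Equiv.refl W)))
        (fun x : (Fin (m + 1) → V) × W => R x.1 x.2)
      rw [← e] at h
      refine le_trans (le_of_eq ?_) h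
      simp only [Fintype.card_prod, Fintype.card_fun, Fintype.card_fin]; push_cast; ring
    have h2 := cnt_blowup_one (fun (v : V) (y : (Fin m → V) × W) => R' v y.1 y.2) t hc h1
    have h3 : c ^ t * Fintype.card ((Fin m → V) × ((Fin t → V) × W)) ≤
        cnt (fun x : (Fin m → V) × ((Fin t → V) × W) =>
          ∀ j, R' (x.2.1 j) x.1 x.2.2) := by
      let e3 : (Fin m → V) × ((Fin t → V) × W) ≃ (Fin t → V) × ((Fin m → V) × W) :=
        ⟨fun x => (x.2.1, x.1, x.2.2), fun x => (x.2.1, x.1, x.2.2), fun _ => rfl, fun _ => rfl⟩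
      have e := cnt_equiv e3
        (fun x : (Fin t → V) × ((Fin m → V) × W) => ∀ j, R' (x.1 j) x.2.1 x.2.2)
      rw [← e] at h2
      refine le_trans (le_of_eq ?_) h2
      simp only [Fintype.card_prod, Fintype.card_fun, Fintype.card_fin]; push_cast; ring
    have h4 := ih (fun (f : Fin m → V) (y : (Fin t → V) × W) =>
      ∀ j : Fin t, R' (y.1 j) f y.2) (pow_nonneg hc t) h3
    have e := cnt_equiv ((Equiv.prodAssoc (Fin m → Fin t → V) (Fin t → V) W).symm.trans
        (((Equiv.prodComm _ _).trans (Fin.consEquiv (fun _ : Fin (m + 1) => Fin t → V))).prodCongr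
          (Equiv.refl W)))
        (fun x : (Fin (m + 1) → Fin t → V) × W =>
          ∀ σ : Fin (m + 1) → Fin t, R (fun i => x.1 i (σ i)) x.2)
    rw [← e]
    refine le_trans (le_trans (le_of_eq ?_) h4) (cnt_mono ?_)
    · simp only [Fintype.card_prod, Fintype.card_fun, Fintype.card_fin]
      push_cast; rw [← pow_mul]; ring
    · rintro ⟨f, g, w⟩ hx σ
      have := hx (fun i => σ i.succ) (σ 0)
      convert this using 1
      · ext i
        refine Fin.cases ?_ (fun i => ?_) i <;> simp [Fin.consEquiv]
      · rfl

end Counting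

section Coordinates

variable {ι V : Type*} [Fintype ι] [DecidableEq ι] [Fintype V]

theorem cnt_coord_eq_fun (i : ι) (g : ({j // j ≠ i} → V) → V) :
    cnt (fun f : ι → V => f i = g (fun j => f j)) * Fintype.card V = Fintype.card (ι → V) := by
  classical
  have e := cnt_equiv (Equiv.funSplitAt i V) (fun x => x.1 = g x.2)
  have : cnt (fun f : ι → V => f i = g (fun j => f j)) =
      cnt (fun x : V × ({j // j ≠ i} → V) => x.1 = g x.2) := by
    rw [← e]; rfl
  rw [this, cnt_prod', Fintype.card_congr (Equiv.funSplitAt i V), Fintype.card_prod]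
  simp [cnt]
  ring

theorem cnt_coord_eq (i : ι) (v : V) :
    cnt (fun f : ι → V => f i = v) * Fintype.card V = Fintype.card (ι → V) :=
  cnt_coord_eq_fun i (fun _ => v)

theorem cnt_coord_eq_coord {i j : ι} (hij : i ≠ j) :
    cnt (fun f : ι → V => f i = f j) * Fintype.card V = Fintype.card (ι → V) :=
  cnt_coord_eq_fun i (fun f => f ⟨j, hij.symm⟩)

theorem cnt_coord_two {i j : ι} (hij : i ≠ j) (v w : V) :
    cnt (fun f : ι → V => f i = v ∧ f j = w) * (Fintype.card V : ℝ) ^ 2 =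
      Fintype.card (ι → V) := by
  classical
  have e := cnt_equiv (Equiv.funSplitAt i V) (fun x => x.1 = v ∧ x.2 ⟨j, hij.symm⟩ = w)
  have h1 : cnt (fun f : ι → V => f i = v ∧ f j = w) =
      cnt (fun x : V × ({j // j ≠ i} → V) => x.1 = v ∧ x.2 ⟨j, hij.symm⟩ = w) := by
    rw [← e]; rfl
  have h2 : cnt (fun x : V × ({j // j ≠ i} → V) => x.1 = v ∧ x.2 ⟨j, hij.symm⟩ = w) =
      cnt (fun f : {j // j ≠ i} → V => f ⟨j, hij.symm⟩ = w) := by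
    rw [cnt_prod']; simp only [cnt]
    refine Finset.sum_congr rfl fun f _ => ?_
    by_cases h : f ⟨j, hij.symm⟩ = w <;> simp [h]
  rw [h1, h2, Fintype.card_congr (Equiv.funSplitAt i V), Fintype.card_prod]
  push_cast
  rw [← cnt_coord_eq (⟨j, hij.symm⟩ : {j // j ≠ i}) w]
  ring

theorem cnt_not_injective_le :
    cnt (fun f : ι → V => ¬ Function.Injective f) * Fintype.card V ≤
      (Fintype.card ι : ℝ) ^ 2 * Fintype.card (ι → V) := by
  classical
  have h1 : cnt (fun f : ι → V => ¬ Function.Injective f) ≤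
      ∑ p ∈ (Finset.univ : Finset (ι × ι)).filter (fun p => p.1 ≠ p.2),
        cnt (fun f : ι → V => f p.1 = f p.2) := by
    refine le_trans (cnt_mono fun f hf => ?_) (cnt_exists_le _ _)
    rw [Function.Injective] at hf
    push Not at hf
    obtain ⟨a, b, h, hab⟩ := hf
    exact ⟨(a, b), by simp [hab], h⟩
  calc _ ≤ (∑ p ∈ (Finset.univ : Finset (ι × ι)).filter (fun p => p.1 ≠ p.2),
        cnt (fun f : ι → V => f p.1 = f p.2)) * Fintype.card V :=
        mul_le_mul_of_nonneg_right h1 (by positivity)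
    _ = ∑ p ∈ (Finset.univ : Finset (ι × ι)).filter (fun p => p.1 ≠ p.2),
        (Fintype.card (ι → V) : ℝ) := by
        rw [Finset.sum_mul]
        exact Finset.sum_congr rfl fun p hp => cnt_coord_eq_coord (Finset.mem_filter.1 hp).2
    _ ≤ _ := by
        rw [Finset.sum_const, nsmul_eq_mul]
        refine mul_le_mul_of_nonneg_right ?_ (by positivity)
        have := Finset.card_filter_le (Finset.univ : Finset (ι × ι)) (fun p => p.1 ≠ p.2)
        rw [Finset.card_univ, Fintype.card_prod] at this
        rw [sq]; exact_mod_cast this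

theorem cnt_mem_range_le (v : V) :
    cnt (fun f : ι → V => ∃ i, f i = v) * Fintype.card V ≤
      Fintype.card ι * Fintype.card (ι → V) := by
  classical
  have h1 : cnt (fun f : ι → V => ∃ i, f i = v) ≤
      ∑ i : ι, cnt (fun f : ι → V => f i = v) :=
    le_trans (cnt_mono fun f ⟨i, hi⟩ => ⟨i, Finset.mem_univ _, hi⟩) (cnt_exists_le _ _)
  calc _ ≤ (∑ i : ι, cnt (fun f : ι → V => f i = v)) * Fintype.card V :=
        mul_le_mul_of_nonneg_right h1 (by positivity)
    _ = _ := by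
        rw [Finset.sum_mul]; simp only [cnt_coord_eq]; simp

theorem cnt_two_mem_range_le {v w : V} (hvw : v ≠ w) :
    cnt (fun f : ι → V => (∃ i, f i = v) ∧ ∃ j, f j = w) * (Fintype.card V : ℝ) ^ 2 ≤
      (Fintype.card ι : ℝ) ^ 2 * Fintype.card (ι → V) := by
  classical
  have h1 : cnt (fun f : ι → V => (∃ i, f i = v) ∧ ∃ j, f j = w) ≤
      ∑ p ∈ (Finset.univ : Finset (ι × ι)).filter (fun p => p.1 ≠ p.2),
        cnt (fun f : ι → V => f p.1 = v ∧ f p.2 = w) := by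
    refine le_trans (cnt_mono ?_) (cnt_exists_le _ _)
    rintro f ⟨⟨i, hi⟩, j, hj⟩
    refine ⟨(i, j), ?_, hi, hj⟩
    simp only [Finset.mem_filter, Finset.mem_univ, true_and]
    rintro rfl
    exact hvw (hi.symm.trans hj)
  calc _ ≤ (∑ p ∈ (Finset.univ : Finset (ι × ι)).filter (fun p => p.1 ≠ p.2),
        cnt (fun f : ι → V => f p.1 = v ∧ f p.2 = w)) * (Fintype.card V : ℝ) ^ 2 :=
        mul_le_mul_of_nonneg_right h1 (by positivity)
    _ = ∑ p ∈ (Finset.univ : Finset (ι × ι)).filter (fun p => p.1 ≠ p.2),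
        (Fintype.card (ι → V) : ℝ) := by
        rw [Finset.sum_mul]
        exact Finset.sum_congr rfl fun p hp => cnt_coord_two (Finset.mem_filter.1 hp).2 v w
    _ ≤ _ := by
        rw [Finset.sum_const, nsmul_eq_mul]
        refine mul_le_mul_of_nonneg_right ?_ (by positivity)
        have := Finset.card_filter_le (Finset.univ : Finset (ι × ι)) (fun p => p.1 ≠ p.2)
        rw [Finset.card_univ, Fintype.card_prod] at this
        rw [sq]; exact_mod_cast this

end Coordinates

attribute [irreducible] cnt

/-! ### Loose paths -/

section LoosePaths

variable {V : Type} [DecidableEq V]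

/-- The triple `a, b, c` spans an edge. -/
def Tri (H : Finset (Finset V)) (a b c : V) : Prop := ({a, b, c} : Finset V) ∈ H

variable {H : Finset (Finset V)}

theorem Tri.swap {a b c : V} (h : Tri H a b c) : Tri H b a c := by
  unfold Tri at *; rwa [Finset.insert_comm] at h

theorem Tri.swap_right {a b c : V} (h : Tri H a b c) : Tri H a c b := by
  unfold Tri at *; rwa [Finset.pair_comm] at h

theorem Tri.rotate {a b c : V} (h : Tri H a b c) : Tri H b c a := h.swap.swap_right

theorem Tri.ne (h3 : ∀ e ∈ H, e.card = 3) {a b c : V} (h : Tri H a b c) :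
    a ≠ b ∧ a ≠ c ∧ b ≠ c := by
  have := h3 _ h
  refine ⟨?_, ?_, ?_⟩ <;> rintro rfl <;> revert this <;> simp <;>
    exact ne_of_lt (lt_of_le_of_lt Finset.card_le_two (by norm_num))

/-- `HP H s t A`: there is a loose path from `s` to `t` whose vertices other than the first
occurrence of `s` are exactly the elements of `A`. -/
inductive HP (H : Finset (Finset V)) : V → V → Finset V → Prop
  | nil (s : V) : HP H s s ∅
  | cons {s a b t : V} {A : Finset V} (h : Tri H s a b) (hp : HP H b t A) (ha : a ∉ A)
      (hb : b ∉ A) (hab : a ≠ b) : HP H s t (insert a (insert b A))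

theorem HP.congr {s t : V} {A B : Finset V} (h : HP H s t A) (e : A = B) : HP H s t B := e ▸ h

theorem HP.even {s t : V} {A : Finset V} (h : HP H s t A) : Even A.card := by
  induction h with
  | nil s => simp
  | cons h hp ha hb hab ih =>
    rw [Finset.card_insert_of_notMem (by simp [hab, ha]), Finset.card_insert_of_notMem hb]
    exact ih.add (by decide : Even 2)

theorem HP.trans {s t u : V} {A B : Finset V} (h : HP H s t A) (h' : HP H t u B)
    (hd : Disjoint A B) : HP H s u (A ∪ B) := by
  induction h with
  | nil s => simpa using h'
  | @cons s a b t A h hp ha hb hab ih =>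
    simp only [Finset.disjoint_insert_left] at hd
    have := HP.cons h (ih h' hd.2.2) (a := a) (by simp [ha, hd.1]) (by simp [hb, hd.2.1]) hab
    simpa [Finset.insert_union] using this

theorem HP.single {s a b : V} (h : Tri H s a b) (hab : a ≠ b) : HP H s b {a, b} := by
  simpa using HP.cons h (HP.nil b) (by simp) (by simp) hab

/-- A loose path as a sequence of vertices. -/
theorem HP.exists_seq {s t : V} {A : Finset V} (h : HP H s t A) :
    ∃ (k : ℕ) (g : ℕ → V), g 0 = s ∧ g (2 * k) = t ∧ A = (Finset.Icc 1 (2 * k)).image g ∧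
      A.card = 2 * k ∧ ∀ i < k, Tri H (g (2 * i)) (g (2 * i + 1)) (g (2 * i + 2)) := by
  induction h with
  | nil s => exact ⟨0, fun _ => s, by simp⟩
  | @cons s a b t A h hp ha hb hab ih =>
    obtain ⟨k, g, h0, hk, hA, hc, hE⟩ := ih
    refine ⟨k + 1, fun j => if j = 0 then s else if j = 1 then a else g (j - 2), by simp, ?_, ?_,
      ?_, ?_⟩
    · have : 2 * (k + 1) - 2 = 2 * k := by omega
      simp [this, hk]
    · ext x
      simp only [hA, Finset.mem_insert, Finset.mem_image, Finset.mem_Icc]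
      constructor
      · rintro (rfl | rfl | ⟨j, hj, rfl⟩)
        · exact ⟨1, by omega, by simp⟩
        · exact ⟨2, by omega, by simp [h0]⟩
        · exact ⟨j + 2, by omega, by simp⟩
      · rintro ⟨j, hj, rfl⟩
        rcases Nat.lt_or_ge j 2 with h2 | h2
        · have : j = 1 := by omega
          simp [this]
        · rcases Nat.eq_or_lt_of_le h2 with h2 | h2
          · simp [← h2, h0]
          · refine Or.inr (Or.inr ⟨j - 2, by omega, ?_⟩)
            rw [if_neg (by omega), if_neg (by omega)]
    · rw [Finset.card_insert_of_notMem (by simp [hab, ha]), Finset.card_insert_of_notMem hb, hc]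
      omega
    · intro i hi
      rcases i with _ | i
      · simpa [h0] using h
      · have := hE i (by omega)
        have e1 : 2 * (i + 1) - 2 = 2 * i := by omega
        have e2 : 2 * (i + 1) + 1 - 2 = 2 * i + 1 := by omega
        have e3 : 2 * (i + 1) + 2 - 2 = 2 * i + 2 := by omega
        simp only [e1, e2, e3]
        simpa using this

/-- Four consecutive vertices joining the ends of two paths. -/
theorem HP.of_conn (h3 : ∀ e ∈ H, e.card = 3) {a b x y z : V} (h1 : Tri H a x y)
    (h2 : Tri H y z b) (hxz : x ≠ z) (hxb : x ≠ b) : HP H a b {x, y, z, b} := by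
  have n1 := h1.ne h3
  have n2 := h2.ne h3
  refine HP.cons h1 (HP.single h2 n2.2.2) ?_ ?_ n1.2.2
  · simp [hxz, hxb]
  · simp [n2.1, n2.2.1]

end LoosePaths

theorem HP.hasLooseHamCycle {n : ℕ} {H : Finset (Finset (Fin n))} {s : Fin n}
    (h : HP H s s Finset.univ) : HasLooseHamCycle n H := by
  obtain ⟨k, g, h0, hk, hA, hc, hE⟩ := h.exists_seq
  rw [Finset.card_univ, Fintype.card_fin] at hc
  have hn : 0 < n := s.pos
  have : NeZero n := ⟨hn.ne'⟩
  have hval : ∀ j : ℕ, j ≤ n → g ((j : ZMod n).val) = g j := by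
    intro j hj
    rw [ZMod.val_natCast]
    rcases Nat.eq_or_lt_of_le hj with e | hj
    · rw [e, Nat.mod_self, h0, ← hk, ← hc]
    · rw [Nat.mod_eq_of_lt hj]
  have hsurj : Function.Surjective (fun x : ZMod n => g x.val) := by
    intro v
    have : v ∈ (Finset.Icc 1 (2 * k)).image g := hA ▸ Finset.mem_univ v
    obtain ⟨j, hj, rfl⟩ := Finset.mem_image.1 this
    exact ⟨(j : ZMod n), hval j (by rw [Finset.mem_Icc] at hj; omega)⟩
  refine ⟨fun x => g x.val, ?_, fun i hi => ?_⟩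
  · rw [Fintype.bijective_iff_surjective_and_card]
    exact ⟨hsurj, by simp [ZMod.card]⟩
  · have := hE i (by omega)
    unfold Tri at this
    simp only [hval (2 * i) (by omega), hval (2 * i + 1) (by omega), hval (2 * i + 2) (by omega)]
    exact this

/-! ### Links, connecting triples and clones -/

theorem cnt_prod_and {α β : Type*} [Fintype α] [Fintype β] (P : α → Prop) (Q : β → Prop) :
    cnt (fun p : α × β => P p.1 ∧ Q p.2) = cnt P * cnt Q := by
  classical
  rw [cnt_prod]
  simp only [cnt, Finset.sum_mul_sum]
  refine Finset.sum_congr rfl fun a _ => Finset.sum_congr rfl fun b _ => ?_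
  by_cases ha : P a <;> by_cases hb : Q b <;> simp [ha, hb]

theorem cnt_prod_le {α β : Type*} [Fintype α] [Fintype β] (Q : α × β → Prop) {d : ℝ}
    (h : ∀ a, cnt (fun b => Q (a, b)) ≤ d) : cnt Q ≤ Fintype.card α * d := by
  rw [cnt_prod]
  refine le_trans (Finset.sum_le_sum fun a _ => h a) ?_
  simp

theorem cnt_prod_le' {α β : Type*} [Fintype α] [Fintype β] (Q : α × β → Prop) {d : ℝ}
    (h : ∀ b, cnt (fun a => Q (a, b)) ≤ d) : cnt Q ≤ Fintype.card β * d := by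
  rw [cnt_prod']
  refine le_trans (Finset.sum_le_sum fun a _ => h a) ?_
  simp

theorem cnt_prod_ge {α β : Type*} [Fintype α] [Fintype β] (Q : α → β → Prop) {d : ℝ}
    (h : ∀ a, d ≤ cnt (Q a)) : Fintype.card α * d ≤ cnt (fun p : α × β => Q p.1 p.2) := by
  rw [cnt_prod]
  refine le_trans (by simp) (Finset.sum_le_sum fun a _ => h a)

theorem cnt_and_le_of_imp {α : Type*} [Fintype α] (p : Prop) (Q : α → Prop) {d : ℝ} (hd : 0 ≤ d)
    (h : p → cnt Q ≤ d) : cnt (fun x => p ∧ Q x) ≤ d := by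
  classical
  by_cases hp : p
  · simpa [hp] using h hp
  · simpa [hp, cnt] using hd

section Links

variable {V : Type} [DecidableEq V] [Fintype V] {H : Finset (Finset V)}

/-- `w` has degree at least `n / 500` in the link of `v`. -/
def Sup (H : Finset (Finset V)) (v w : V) : Prop :=
  1 / 500 * (Fintype.card V : ℝ) ≤ cnt (fun x => Tri H v w x)

/-- `τ` joins `a` and `b` by two edges. -/
def Conn (H : Finset (Finset V)) (a b : V) (τ : Fin 3 → V) : Prop :=
  Tri H a (τ 0) (τ 1) ∧ Tri H (τ 1) (τ 2) b

/-- `τ 0` and `a` both form an edge with the pair `τ 1, τ 2`. -/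
def Clone (H : Finset (Finset V)) (a : V) (τ : Fin 3 → V) : Prop :=
  Tri H (τ 1) (τ 2) a ∧ Tri H (τ 1) (τ 2) (τ 0)

theorem cnt_sup_ge
    (hd : ∀ v : V, 43 / 100 * (Fintype.card V : ℝ) ^ 2 ≤
      cnt (fun p : V × V => Tri H v p.1 p.2))
    (v : V) : 65 / 100 * (Fintype.card V : ℝ) ≤ cnt (Sup H v) := by
  have hN : (0 : ℝ) ≤ Fintype.card V := by positivity
  have h1 : cnt (fun p : V × V => Tri H v p.1 p.2) ≤
      cnt (fun p : V × V => Sup H v p.1 ∧ Sup H v p.2) +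
        (cnt (fun p : V × V => ¬ Sup H v p.1 ∧ Tri H v p.1 p.2) +
          cnt (fun p : V × V => ¬ Sup H v p.2 ∧ Tri H v p.1 p.2)) := by
    refine (cnt_le_add (R := fun p : V × V => (¬ Sup H v p.1 ∧ Tri H v p.1 p.2) ∨
      (¬ Sup H v p.2 ∧ Tri H v p.1 p.2)) fun p hp => ?_).trans
        (add_le_add le_rfl (cnt_or_le _ _))
    by_cases h1 : Sup H v p.1 <;> by_cases h2 : Sup H v p.2 <;> simp [h1, h2, hp]
  rw [cnt_prod_and] at h1
  have h2 : cnt (fun p : V × V => ¬ Sup H v p.1 ∧ Tri H v p.1 p.2) ≤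
      Fintype.card V * (1 / 500 * (Fintype.card V : ℝ)) :=
    cnt_prod_le _ fun a => cnt_and_le_of_imp (¬ Sup H v a) (fun b => Tri H v a b)
      (d := 1 / 500 * (Fintype.card V : ℝ)) (by positivity) fun h => (not_le.1 h).le
  have h3 : cnt (fun p : V × V => ¬ Sup H v p.2 ∧ Tri H v p.1 p.2) ≤
      Fintype.card V * (1 / 500 * (Fintype.card V : ℝ)) := by
    refine cnt_prod_le' _ fun b => cnt_and_le_of_imp (¬ Sup H v b) (fun a => Tri H v a b)
      (d := 1 / 500 * (Fintype.card V : ℝ)) (by positivity) fun h => ?_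
    refine le_trans (cnt_mono fun x hx => ?_) (not_le.1 h).le
    exact Tri.swap_right hx
  have := hd v
  have h0 := cnt_nonneg (Sup H v)
  by_contra hlt
  push Not at hlt
  have h5 := mul_le_mul hlt.le hlt.le h0 (by positivity)
  have h6 : (0 : ℝ) < Fintype.card V := by
    rcases hN.lt_or_eq with h | h
    · exact h
    · rw [← h] at hlt; linarith
  have h7 := mul_pos h6 h6
  ring_nf at *
  linarith

theorem cnt_conn_ge
    (hd : ∀ v : V, 43 / 100 * (Fintype.card V : ℝ) ^ 2 ≤
      cnt (fun p : V × V => Tri H v p.1 p.2))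
    (a b : V) :
    1 / 10 ^ 6 * (Fintype.card V : ℝ) ^ 3 ≤ cnt (Conn H a b) := by
  have hN : (0 : ℝ) ≤ Fintype.card V := by positivity
  have h1 : 3 / 10 * (Fintype.card V : ℝ) ≤ cnt (fun y => Sup H a y ∧ Sup H b y) := by
    have := cnt_and_ge (Sup H a) (Sup H b)
    have := cnt_sup_ge hd a
    have := cnt_sup_ge hd b
    linarith
  have h2 : ∀ y, (Sup H a y ∧ Sup H b y) → (1 / 500) ^ 2 * (Fintype.card (V × V) : ℝ) ≤
      cnt (fun p : V × V => Tri H a y p.1 ∧ Tri H b y p.2) := by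
    rintro y ⟨ha, hb⟩
    rw [cnt_prod_and, Fintype.card_prod]
    push_cast
    calc _ = (1 / 500 * (Fintype.card V : ℝ)) * (1 / 500 * (Fintype.card V : ℝ)) := by ring
      _ ≤ _ := mul_le_mul ha hb (by positivity) (cnt_nonneg _)
  have h3 := cnt_and_prod_ge (by positivity) h1 h2
  have h4 : cnt (fun x : V × (V × V) => (Sup H a x.1 ∧ Sup H b x.1) ∧
      Tri H a x.1 x.2.1 ∧ Tri H b x.1 x.2.2) ≤ cnt (Conn H a b) := by
    refine cnt_le_of_injective (fun x => ![x.2.1, x.1, x.2.2]) ?_ ?_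
    · rintro ⟨x, y, z⟩ ⟨x', y', z'⟩ h
      have e0 := congrFun h 0
      have e1 := congrFun h 1
      have e2 := congrFun h 2
      simp at e0 e1 e2
      simp [e0, e1, e2]
    · rintro ⟨y, x, z⟩ ⟨-, h1, h2⟩
      exact ⟨h1.swap_right, h2.rotate⟩
  refine le_trans ?_ (h3.trans h4)
  rw [Fintype.card_prod, Fintype.card_prod]
  push_cast
  have h5 := pow_nonneg hN 3
  ring_nf at h5 ⊢
  linarith

theorem cnt_clone_ge
    (hd : ∀ v : V, 43 / 100 * (Fintype.card V : ℝ) ^ 2 ≤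
      cnt (fun p : V × V => Tri H v p.1 p.2))
    (a : V) :
    1 / 10 ^ 4 * (Fintype.card V : ℝ) ^ 3 ≤ cnt (Clone H a) := by
  have hN : (0 : ℝ) ≤ Fintype.card V := by positivity
  have h1 : 8 / 100 * (Fintype.card (V × V) : ℝ) ≤
      cnt (fun p : V × V => Sup H p.1 p.2 ∧ Tri H a p.1 p.2) := by
    have h1 := cnt_and_ge (fun p : V × V => Sup H p.1 p.2) (fun p => Tri H a p.1 p.2)
    have h2 := hd a
    have h3 : (Fintype.card V : ℝ) * (65 / 100 * (Fintype.card V : ℝ)) ≤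
        cnt (fun p : V × V => Sup H p.1 p.2) :=
      cnt_prod_ge (Sup H) (cnt_sup_ge hd)
    rw [Fintype.card_prod] at h1 ⊢
    push_cast at h1 ⊢
    ring_nf at h1 h2 h3 ⊢
    linarith
  have h2 : ∀ p : V × V, Sup H p.1 p.2 ∧ Tri H a p.1 p.2 →
      1 / 500 * (Fintype.card V : ℝ) ≤ cnt (fun x => Tri H p.1 p.2 x) := by
    rintro p ⟨hp, -⟩
    unfold Sup at hp
    exact hp
  have h3 := cnt_and_prod_ge (by positivity) h1 h2
  have h4 : cnt (fun x : (V × V) × V => (Sup H x.1.1 x.1.2 ∧ Tri H a x.1.1 x.1.2) ∧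
      Tri H x.1.1 x.1.2 x.2) ≤ cnt (Clone H a) := by
    refine cnt_le_of_injective (fun x => ![x.2, x.1.1, x.1.2]) ?_ ?_
    · rintro ⟨⟨x, y⟩, z⟩ ⟨⟨x', y'⟩, z'⟩ h
      have e0 := congrFun h 0
      have e1 := congrFun h 1
      have e2 := congrFun h 2
      simp at e0 e1 e2
      simp [e0, e1, e2]
    · rintro ⟨⟨u, w⟩, x⟩ ⟨⟨-, h1⟩, h2⟩
      exact ⟨h1.rotate, h2⟩
  refine le_trans ?_ (h3.trans h4)
  rw [Fintype.card_prod, Fintype.card_prod]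
  push_cast
  have h5 := pow_nonneg hN 3
  ring_nf at h5 ⊢
  linarith

end Links

/-! ### Absorbers -/

section ListPaths

variable {V : Type} [DecidableEq V] {H : Finset (Finset V)}

/-- The list `l` traces a loose path from `s` to `t`. -/
def LPList (H : Finset (Finset V)) : V → List V → V → Prop
  | s, [], t => s = t
  | _, [_], _ => False
  | s, a :: b :: l, t => Tri H s a b ∧ LPList H b l t

theorem LPList.hp : ∀ {l : List V} {s t : V}, LPList H s l t → l.Nodup → HP H s t l.toFinset
  | [], s, t, h, _ => by
    obtain rfl : s = t := h
    exact HP.nil s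
  | [_], _, _, h, _ => h.elim
  | a :: b :: l, s, t, h, hl => by
    simp only [List.nodup_cons, List.mem_cons, not_or] at hl
    rw [List.toFinset_cons, List.toFinset_cons]
    exact HP.cons h.1 (LPList.hp h.2 hl.2.2) (by simpa using hl.1.2) (by simpa using hl.2.1)
      hl.1.1

end ListPaths

/-- Flattening the vertices of a blow-up of `AbsBase`. -/
def absFlat {V : Type} (x : (Fin 4 → Fin 3 → V) × (Fin 14 → V)) : Fin 26 → V :=
  ![x.1 0 0, x.1 0 1, x.1 0 2, x.1 1 0, x.1 1 1, x.1 1 2, x.1 2 0, x.1 2 1, x.1 2 2,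
    x.1 3 0, x.1 3 1, x.1 3 2, x.2 0, x.2 1, x.2 2, x.2 3, x.2 4, x.2 5, x.2 6, x.2 7, x.2 8,
    x.2 9, x.2 10, x.2 11, x.2 12, x.2 13]

theorem absFlat_injective {V : Type} : Function.Injective (absFlat (V := V)) := by
  rintro ⟨f, w⟩ ⟨f', w'⟩ h
  refine Prod.ext ?_ ?_
  · funext i j
    fin_cases i <;> fin_cases j
    exacts [congrFun h 0, congrFun h 1, congrFun h 2, congrFun h 3, congrFun h 4, congrFun h 5,
      congrFun h 6, congrFun h 7, congrFun h 8, congrFun h 9, congrFun h 10, congrFun h 11]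
  · funext i
    fin_cases i
    exacts [congrFun h 12, congrFun h 13, congrFun h 14, congrFun h 15, congrFun h 16,
      congrFun h 17, congrFun h 18, congrFun h 19, congrFun h 20, congrFun h 21, congrFun h 22,
      congrFun h 23, congrFun h 24, congrFun h 25]

section Absorbers

variable {V : Type} [DecidableEq V] {H : Finset (Finset V)}

/-- The vertices, in order, of the path through an absorber that avoids the absorbed pair. -/
def absList : List (Fin 28) :=
  [16, 3, 17, 18, 19, 9, 4, 6, 5, 10, 20, 21, 22, 12, 1, 13, 23, 24, 25, 14, 7, 15]

/-- The vertices, in order, of the path through an absorber that contains the absorbed pair. -/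
def absListLong : List (Fin 28) :=
  [4, 16, 1, 3, 17, 18, 19, 9, 7, 5, 6, 10, 20, 21, 22, 12, 26, 13, 23, 24, 25, 14, 27, 15]

/-- The positions of the vertices of an absorber other than its start. -/
def absIx : Finset (Fin 26) :=
  {16, 3, 17, 18, 19, 9, 4, 6, 5, 10, 20, 21, 22, 12, 1, 13, 23, 24, 25, 14, 7, 15}

/-- `τ` can absorb the pair `a, b`. -/
def IsAbs (H : Finset (Finset V)) (τ : Fin 26 → V) (a b : V) : Prop :=
  HP H (τ 0) (τ 15) (absIx.image τ) ∧ HP H (τ 0) (τ 15) (absIx.image τ ∪ {a, b})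

/-- The relation whose blow-ups contain absorbers. -/
def AbsBase (H : Finset (Finset V)) (a b : V) (f : Fin 4 → V) (w : Fin 14 → V) : Prop :=
  (Tri H (w 0) (w 1) a ∧ Tri H (w 0) (w 1) (f 0)) ∧
  (Tri H (w 2) (w 3) b ∧ Tri H (w 2) (w 3) (f 2)) ∧
  (Tri H (f 0) (w 4) (f 1) ∧ Tri H (f 1) (f 3) (f 2)) ∧
  (Tri H (f 1) (w 5) (w 6) ∧ Tri H (w 6) (w 7) (f 3)) ∧
  (Tri H (f 3) (w 8) (w 9) ∧ Tri H (w 9) (w 10) (w 0)) ∧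
  (Tri H (w 1) (w 11) (w 12) ∧ Tri H (w 12) (w 13) (w 2))

theorem isAbs_absFlat {a b : V} {x : (Fin 4 → Fin 3 → V) × (Fin 14 → V)}
    (hinj : Function.Injective (absFlat x)) (hab : a ≠ b)
    (ha : ∀ i, absFlat x i ≠ a) (hb : ∀ i, absFlat x i ≠ b)
    (h : ∀ σ : Fin 4 → Fin 3, AbsBase H a b (fun i => x.1 i (σ i)) x.2) :
    IsAbs H (absFlat x) a b := by
  set τ : Fin 28 → V := Fin.append (absFlat x) ![a, b] with hτ
  have hτi : Function.Injective τ := by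
    rw [hτ, Fin.append_injective_iff]
    refine ⟨hinj, ?_, ?_⟩
    · intro i j hij
      fin_cases i <;> fin_cases j <;> simp_all
    · intro i j
      fin_cases j
      · exact ha i
      · exact hb i
  have h0 := h (fun _ => 0)
  have nd : ∀ l : List (Fin 28), l.Nodup → (l.map τ).Nodup := fun l hl => hl.map hτi
  have e1 : HP H (τ 0) (τ 15) (absList.map τ).toFinset := by
    refine LPList.hp ?_ (nd _ (by decide))
    refine ⟨h0.2.2.1.1, h0.2.2.2.1.1, h0.2.2.2.1.2,
      (h ![0, 1, 0, 0]).2.2.1.2.swap,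
      (h ![0, 2, 0, 1]).2.2.1.2.rotate.rotate, (h ![0, 0, 0, 1]).2.2.2.2.1.1,
      h0.2.2.2.2.1.2, (h ![1, 0, 0, 0]).1.2.swap_right, h0.2.2.2.2.2.1, h0.2.2.2.2.2.2,
      (h ![0, 0, 1, 0]).2.1.2.swap_right, rfl⟩
  have e2 : HP H (τ 0) (τ 15) (absListLong.map τ).toFinset := by
    refine LPList.hp ?_ (nd _ (by decide))
    refine ⟨(h ![0, 1, 0, 0]).2.2.1.1.swap_right, (h ![1, 0, 0, 0]).2.2.1.1.swap, h0.2.2.2.1.1,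
      h0.2.2.2.1.2, (h ![0, 2, 1, 0]).2.2.1.2.rotate,
      (h ![0, 2, 0, 1]).2.2.1.2.swap_right, (h ![0, 0, 0, 1]).2.2.2.2.1.1,
      h0.2.2.2.2.1.2, h0.1.1.swap_right, h0.2.2.2.2.2.1, h0.2.2.2.2.2.2,
      h0.2.1.1.swap_right, rfl⟩
  have i1 : absList.toFinset = absIx.image (Fin.castAdd 2) := by decide
  have i2 : absListLong.toFinset = absIx.image (Fin.castAdd 2) ∪ {26, 27} := by decide
  have hc : τ ∘ Fin.castAdd 2 = absFlat x := by
    funext i; simp [hτ]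
  have t0 : τ 26 = a := rfl
  have t1 : τ 27 = b := rfl
  have l1 : (absList.map τ).toFinset = absIx.image (absFlat x) := by
    rw [← hc, ← Finset.image_image, ← i1]
    ext v; simp
  have l2 : (absListLong.map τ).toFinset = absIx.image (absFlat x) ∪ {a, b} := by
    rw [← hc, ← Finset.image_image, ← t0, ← t1]
    have : ({τ 26, τ 27} : Finset V) = ({26, 27} : Finset (Fin 28)).image τ := by simp
    rw [this, ← Finset.image_union, ← i2]
    ext v; simp
  exact ⟨l1 ▸ e1, l2 ▸ e2⟩

variable [Fintype V]

theorem cnt_absBase_ge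
    (hd : ∀ v : V, 43 / 100 * (Fintype.card V : ℝ) ^ 2 ≤
      cnt (fun p : V × V => Tri H v p.1 p.2))
    (a b : V) :
    1 / 10 ^ 32 * (Fintype.card ((Fin 4 → V) × (Fin 14 → V)) : ℝ) ≤
      cnt (fun x : (Fin 4 → V) × (Fin 14 → V) => AbsBase H a b x.1 x.2) := by
  have hT : (Fintype.card (Fin 3 → V) : ℝ) = (Fintype.card V : ℝ) ^ 3 := by simp
  have hconn : ∀ a b, 1 / 10 ^ 6 * (Fintype.card (Fin 3 → V) : ℝ) ≤ cnt (Conn H a b) := by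
    intro a b; rw [hT]; exact cnt_conn_ge hd a b
  have hclone : ∀ a, 1 / 10 ^ 4 * (Fintype.card (Fin 3 → V) : ℝ) ≤ cnt (Clone H a) := by
    intro a; rw [hT]; exact cnt_clone_ge hd a
  have h2 := cnt_and_prod_ge (Q := fun _ => Clone H b) (by positivity) (hclone a)
    fun _ _ => hclone b
  have h3 := cnt_and_prod_ge (Q := fun x => Conn H (x.1 0) (x.2 0)) (by positivity) h2
    fun x _ => hconn (x.1 0) (x.2 0)
  have h4 := cnt_and_prod_ge (Q := fun x => Conn H (x.2 1) (x.2 2)) (by positivity) h3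
    fun x _ => hconn (x.2 1) (x.2 2)
  have h5 := cnt_and_prod_ge (Q := fun x => Conn H (x.1.2 2) (x.1.1.1 1)) (by positivity) h4
    fun x _ => hconn (x.1.2 2) (x.1.1.1 1)
  have h6 := cnt_and_prod_ge (Q := fun x => Conn H (x.1.1.1.1 2) (x.1.1.1.2 1))
    (by positivity) h5 fun x _ => hconn (x.1.1.1.1 2) (x.1.1.1.2 1)
  refine le_trans (le_trans (le_of_eq ?_) h6) (cnt_le_of_injective
    (fun x => (![x.1.1.1.1.1 0, x.1.1.1.2 1, x.1.1.1.1.2 0, x.1.1.1.2 2],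
      ![x.1.1.1.1.1 1, x.1.1.1.1.1 2, x.1.1.1.1.2 1, x.1.1.1.1.2 2, x.1.1.1.2 0,
        x.1.1.2 0, x.1.1.2 1, x.1.1.2 2, x.1.2 0, x.1.2 1, x.1.2 2, x.2 0, x.2 1, x.2 2])) ?_ ?_)
  · simp only [Fintype.card_prod, Fintype.card_fun, Fintype.card_fin]
    push_cast
    ring
  · rintro ⟨⟨⟨⟨⟨g1, g2⟩, g3⟩, g4⟩, g5⟩, g6⟩ ⟨⟨⟨⟨⟨k1, k2⟩, k3⟩, k4⟩, k5⟩, k6⟩ h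
    have hf := fun i => congrFun (congrArg Prod.fst h) i
    have hw := fun i => congrFun (congrArg Prod.snd h) i
    have aux : ∀ g k : Fin 3 → V, g 0 = k 0 → g 1 = k 1 → g 2 = k 2 → g = k := by
      intro g k e0 e1 e2
      funext i
      fin_cases i
      exacts [e0, e1, e2]
    rw [aux g1 k1 (hf 0) (hw 0) (hw 1), aux g2 k2 (hf 2) (hw 2) (hw 3),
      aux g3 k3 (hw 4) (hf 1) (hf 3), aux g4 k4 (hw 5) (hw 6) (hw 7),
      aux g5 k5 (hw 8) (hw 9) (hw 10), aux g6 k6 (hw 11) (hw 12) (hw 13)]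
  · rintro ⟨⟨⟨⟨⟨g1, g2⟩, g3⟩, g4⟩, g5⟩, g6⟩ ⟨⟨⟨⟨⟨h1, h2⟩, h3⟩, h4⟩, h5⟩, h6⟩
    exact ⟨h1, h2, h3, h4, h5, h6⟩

/-- Every pair of vertices is absorbed by a positive fraction of all 26-tuples. -/
theorem cnt_isAbs_ge
    (hd : ∀ v : V, 43 / 100 * (Fintype.card V : ℝ) ^ 2 ≤
      cnt (fun p : V × V => Tri H v p.1 p.2))
    (hN : 1456 * (10 ^ 32) ^ 81 ≤ (Fintype.card V : ℝ)) {a b : V} (hab : a ≠ b) :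
    (1 / 10 ^ 32) ^ 81 / 2 * (Fintype.card (Fin 26 → V) : ℝ) ≤
      cnt (fun τ : Fin 26 → V => Function.Injective τ ∧ (∀ i, τ i ≠ a) ∧ (∀ i, τ i ≠ b) ∧
        IsAbs H τ a b) := by
  have h1 := cnt_blowup 3 4 (AbsBase H a b) (by positivity) (cnt_absBase_ge hd a b)
  have hcard : Fintype.card ((Fin 4 → Fin 3 → V) × (Fin 14 → V)) = Fintype.card (Fin 26 → V) := by
    simp only [Fintype.card_prod, Fintype.card_fun, Fintype.card_fin]; ring
  rw [hcard] at h1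
  set M : ℝ := ((Fintype.card (Fin 26 → V) : ℕ) : ℝ) with hM
  set N : ℝ := ((Fintype.card V : ℕ) : ℝ) with hNdef
  have hN0 : 0 < N := lt_of_lt_of_le (by positivity) hN
  have h2 : cnt (fun x : (Fin 4 → Fin 3 → V) × (Fin 14 → V) => ∀ σ : Fin 4 → Fin 3,
      AbsBase H a b (fun i => x.1 i (σ i)) x.2) ≤
      cnt (fun τ : Fin 26 → V => Function.Injective τ ∧ (∀ i, τ i ≠ a) ∧ (∀ i, τ i ≠ b) ∧
        IsAbs H τ a b) + (cnt (fun τ : Fin 26 → V => ¬ Function.Injective τ) +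
        (cnt (fun τ : Fin 26 → V => ∃ i, τ i = a) + cnt (fun τ : Fin 26 → V => ∃ i, τ i = b))) := by
    refine le_trans (cnt_le_of_injective absFlat absFlat_injective (Q := fun τ =>
      (Function.Injective τ ∧ (∀ i, τ i ≠ a) ∧ (∀ i, τ i ≠ b) ∧ IsAbs H τ a b) ∨
      (¬ Function.Injective τ ∨ ((∃ i, τ i = a) ∨ ∃ i, τ i = b))) fun x hx => ?_)
      ((cnt_or_le _ _).trans (add_le_add le_rfl ((cnt_or_le _ _).trans (add_le_add le_rfl
        (cnt_or_le _ _)))))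
    by_cases hi : Function.Injective (absFlat x)
    · by_cases ha : ∃ i, absFlat x i = a
      · exact Or.inr (Or.inr (Or.inl ha))
      by_cases hb : ∃ i, absFlat x i = b
      · exact Or.inr (Or.inr (Or.inr hb))
      push Not at ha hb
      exact Or.inl ⟨hi, ha, hb, isAbs_absFlat hi hab ha hb hx⟩
    · exact Or.inr (Or.inl hi)
  have b1 := cnt_not_injective_le (ι := Fin 26) (V := V)
  have b2 := cnt_mem_range_le (ι := Fin 26) a
  have b3 := cnt_mem_range_le (ι := Fin 26) b
  simp only [Fintype.card_fin, ← hM, ← hNdef] at b1 b2 b3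
  set X := cnt (fun τ : Fin 26 → V => ¬ Function.Injective τ)
  set Y := cnt (fun τ : Fin 26 → V => ∃ i, τ i = a)
  set Z := cnt (fun τ : Fin 26 → V => ∃ i, τ i = b)
  have h3 : (X + (Y + Z)) * N ≤ (1 / 10 ^ 32) ^ 81 / 2 * M * N := by
    have hM0 : 0 ≤ M := by positivity
    calc (X + (Y + Z)) * N ≤ 728 * M := by push_cast at b1 b2 b3; linarith
      _ = (1 / 10 ^ 32) ^ 81 / 2 * M * (1456 * (10 ^ 32) ^ 81) := by
        rw [div_pow, one_pow]; field_simp; ring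
      _ ≤ _ := by gcongr
  have h4 := le_of_mul_le_mul_right h3 hN0
  have h5 := h1.trans h2
  rw [show 3 ^ 4 = 81 from rfl] at h5
  generalize ((1 : ℝ) / 10 ^ 32) ^ 81 = κ at *
  linarith

end Absorbers

/-! ### Selecting disjoint tuples -/

section Selection

variable {ι V I : Type} [Fintype ι] [DecidableEq ι] [Fintype V] [Fintype I]

/-- The number of tuples meeting a given set. -/
theorem cnt_meets_le (U : Finset V) :
    cnt (fun τ : ι → V => ∃ v ∈ U, ∃ i, τ i = v) * Fintype.card V ≤
      U.card * Fintype.card ι * Fintype.card (ι → V) := by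
  calc _ ≤ (∑ v ∈ U, cnt (fun τ : ι → V => ∃ i, τ i = v)) * Fintype.card V :=
        mul_le_mul_of_nonneg_right (cnt_exists_le _ _) (by positivity)
    _ ≤ ∑ v ∈ U, (Fintype.card ι * Fintype.card (ι → V) : ℝ) := by
        rw [Finset.sum_mul]
        exact Finset.sum_le_sum fun v _ => cnt_mem_range_le v
    _ = _ := by simp; ring

/-- Averaging: some tuple avoiding a small set hits a large weight of dense families. -/
theorem exists_tuple_hitting (Q : I → (ι → V) → Prop) {c : ℝ} (hc : 0 < c)
    (hQ : ∀ i, c * Fintype.card (ι → V) ≤ cnt (Q i)) (U : Finset V)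
    (hU : (U.card : ℝ) * Fintype.card ι ≤ c / 2 * Fintype.card V) [Nonempty V]
    (ω : I → ℝ) (hω : ∀ i, 0 ≤ ω i)
    (hω0 : 0 < ∑ i, ω i) [∀ i, DecidablePred (Q i)] :
    ∃ τ : ι → V, (∀ j, τ j ∉ U) ∧ c / 2 * ∑ i, ω i ≤ ∑ i, if Q i τ then ω i else 0 := by
  classical
  have hN : (0 : ℝ) < Fintype.card V := by exact_mod_cast Fintype.card_pos
  have hM : (0 : ℝ) < Fintype.card (ι → V) := by exact_mod_cast Fintype.card_pos
  set M : ℝ := ((Fintype.card (ι → V) : ℕ) : ℝ) with hMdef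
  have h1 : cnt (fun τ : ι → V => ∃ v ∈ U, ∃ i, τ i = v) ≤ c / 2 * M := by
    have := cnt_meets_le (ι := ι) U
    refine le_of_mul_le_mul_right (this.trans ?_) hN
    have := mul_le_mul_of_nonneg_right hU hM.le
    linarith
  have h2 : ∀ i, c / 2 * M ≤ cnt (fun τ => (∀ j, τ j ∉ U) ∧ Q i τ) := by
    intro i
    have h3 : cnt (Q i) ≤ cnt (fun τ => (∀ j, τ j ∉ U) ∧ Q i τ) +
        cnt (fun τ : ι → V => ∃ v ∈ U, ∃ i, τ i = v) := by
      refine cnt_le_add fun τ hτ => ?_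
      by_cases h : ∀ j, τ j ∉ U
      · exact Or.inl ⟨h, hτ⟩
      · push Not at h
        obtain ⟨j, hj⟩ := h
        exact Or.inr ⟨τ j, hj, j, rfl⟩
    have := hQ i
    linarith
  by_contra hcon
  push Not at hcon
  have h3 : ∑ τ : ι → V, (if ∀ j, τ j ∉ U then ∑ i, (if Q i τ then ω i else 0) else 0) =
      ∑ i, ω i * cnt (fun τ => (∀ j, τ j ∉ U) ∧ Q i τ) := by
    simp only [cnt, Finset.mul_sum]
    rw [Finset.sum_comm]
    refine Finset.sum_congr rfl fun τ _ => ?_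
    by_cases h : ∀ j, τ j ∉ U
    · rw [if_pos h]
      refine Finset.sum_congr rfl fun i _ => ?_
      by_cases hq : Q i τ <;> simp [h, hq]
    · rw [if_neg h]
      symm
      refine Finset.sum_eq_zero fun i _ => ?_
      simp [h]
  have h4 : c / 2 * M * ∑ i, ω i ≤ ∑ i, ω i * cnt (fun τ => (∀ j, τ j ∉ U) ∧ Q i τ) := by
    rw [Finset.mul_sum]
    refine Finset.sum_le_sum fun i _ => ?_
    rw [mul_comm]
    exact mul_le_mul_of_nonneg_left (h2 i) (hω i)
  have h5 : ∑ τ : ι → V, (if ∀ j, τ j ∉ U then ∑ i, (if Q i τ then ω i else 0) else 0) <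
      ∑ _τ : ι → V, c / 2 * ∑ i, ω i := by
    refine Finset.sum_lt_sum_of_nonempty Finset.univ_nonempty fun τ _ => ?_
    by_cases h : ∀ j, τ j ∉ U
    · rw [if_pos h]; exact hcon τ h
    · rw [if_neg h]; positivity
  rw [Finset.sum_const, Finset.card_univ, nsmul_eq_mul, h3, ← hMdef] at h5
  linarith

/-- Greedy selection of disjoint tuples so that each dense family is represented many times. -/
theorem exists_disjoint_family [Nonempty V] [Nonempty I] [DecidableEq V]
    (Q : I → (ι → V) → Prop) {c : ℝ} (hc : 0 < c) (hc1 : c ≤ 1) [Nonempty ι]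
    (hQ : ∀ i, c * Fintype.card (ι → V) ≤ cnt (Q i)) (Z : Finset V)
    [∀ i, DecidablePred (Q i)] (N : ℕ)
    (hN : ((Z.card : ℝ) + N * Fintype.card ι) * Fintype.card ι ≤ c / 2 * Fintype.card V) :
    ∃ F : Finset (ι → V), F.card ≤ N ∧ (∀ τ ∈ F, ∀ j, τ j ∉ Z) ∧
      (∀ τ ∈ F, ∀ τ' ∈ F, τ ≠ τ' → ∀ j j', τ j ≠ τ' j') ∧
      ∑ i, (1 / 2 : ℝ) ^ (F.filter (Q i)).card ≤ Fintype.card I * (1 - c / 4) ^ N := by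
  induction N with
  | zero => exact ⟨∅, by simp⟩
  | succ N ih =>
    obtain ⟨F, hF, hFZ, hFd, hS⟩ := ih (by
      refine le_trans ?_ hN
      push_cast
      gcongr
      linarith)
    set U : Finset V := Z ∪ F.biUnion fun τ => Finset.univ.image τ with hUdef
    have hU : (U.card : ℝ) ≤ Z.card + N * Fintype.card ι := by
      have h1 := Finset.card_union_le Z (F.biUnion fun τ => Finset.univ.image τ)
      have h2 : (F.biUnion fun τ => Finset.univ.image τ).card ≤ F.card * Fintype.card ι :=
        Finset.card_biUnion_le_card_mul _ _ _ fun τ _ => Finset.card_image_le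
      have h3 := Nat.mul_le_mul_right (Fintype.card ι) hF
      have : U.card ≤ Z.card + N * Fintype.card ι := by rw [hUdef]; omega
      exact_mod_cast this
    obtain ⟨τ, hτU, hτ⟩ := exists_tuple_hitting Q hc hQ U (by
      refine le_trans ?_ hN
      push_cast
      gcongr
      linarith) (fun i => (1 / 2 : ℝ) ^ (F.filter (Q i)).card) (fun i => by positivity)
        (Finset.sum_pos (fun i _ => by positivity) Finset.univ_nonempty)
    have hτZ : ∀ j, τ j ∉ Z := fun j hj => hτU j (Finset.mem_union_left _ hj)
    have hτF : ∀ τ' ∈ F, ∀ j j', τ j ≠ τ' j' := fun τ' h' j j' e => hτU j (by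
      rw [e]
      exact Finset.mem_union_right _ (Finset.mem_biUnion.2
        ⟨τ', h', Finset.mem_image_of_mem _ (Finset.mem_univ _)⟩))
    have hτn : τ ∉ F := fun h => hτF τ h (Classical.arbitrary ι) (Classical.arbitrary ι) rfl
    refine ⟨insert τ F, ?_, ?_, ?_, ?_⟩
    · rw [Finset.card_insert_of_notMem hτn]; omega
    · intro σ hσ
      rcases Finset.mem_insert.1 hσ with rfl | hσ
      · exact hτZ
      · exact hFZ σ hσ
    · intro σ hσ σ' hσ' hne
      rcases Finset.mem_insert.1 hσ with e | h1 <;> rcases Finset.mem_insert.1 hσ' with e' | h1'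
      · exact absurd (e.trans e'.symm) hne
      · exact e ▸ hτF σ' h1'
      · exact fun j j' => e' ▸ (hτF σ h1 j' j).symm
      · exact hFd σ h1 σ' h1' hne
    · have h1 : ∀ i, (1 / 2 : ℝ) ^ ((insert τ F).filter (Q i)).card =
          (1 / 2 : ℝ) ^ (F.filter (Q i)).card -
            1 / 2 * (if Q i τ then (1 / 2 : ℝ) ^ (F.filter (Q i)).card else 0) := by
        intro i
        rw [Finset.filter_insert]
        by_cases h : Q i τ
        · rw [if_pos h, if_pos h, Finset.card_insert_of_notMem (by simp [hτn]), pow_succ]; ring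
        · rw [if_neg h, if_neg h]; ring
      rw [Finset.sum_congr rfl fun i _ => h1 i, Finset.sum_sub_distrib, ← Finset.mul_sum, pow_succ]
      have h2 : 0 ≤ 1 - c / 4 := by linarith
      have := mul_le_mul_of_nonneg_right hS h2
      linarith

/-- A linear-size disjoint family in which each of polynomially many dense families is
represented linearly often. -/
theorem exists_family_hits (ι : Type) [Fintype ι] [DecidableEq ι] [Nonempty ι] {c θ : ℝ}
    (hc : 0 < c) (hc1 : c ≤ 1) (hθ : 0 < θ) (hθc : θ * (Fintype.card ι : ℝ) ^ 2 ≤ c / 4) :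
    ∃ n₀ : ℕ, ∀ (V : Type) [Fintype V] [DecidableEq V], n₀ ≤ Fintype.card V →
      ∀ (Q : V × V → (ι → V) → Prop) [∀ i, DecidablePred (Q i)],
      ∀ G : Finset (V × V), (∀ p ∈ G, c * Fintype.card (ι → V) ≤ cnt (Q p)) →
      ∀ Z : Finset V, (Z.card : ℝ) * Fintype.card ι ≤ c / 4 * Fintype.card V →
      ∃ F : Finset (ι → V), (F.card : ℝ) ≤ θ * Fintype.card V ∧ (∀ τ ∈ F, ∀ j, τ j ∉ Z) ∧
        (∀ τ ∈ F, ∀ τ' ∈ F, τ ≠ τ' → ∀ j j', τ j ≠ τ' j') ∧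
        ∀ p ∈ G, c * θ / 16 * Fintype.card V ≤ ((F.filter (Q p)).card : ℝ) := by
  have hlim : ∃ n₀ : ℕ, ∀ n : ℕ, n₀ ≤ n →
      (n : ℝ) ^ 2 * Real.exp (-(c * θ / 8) * n) < 1 / 4 := by
    have h1 := Real.tendsto_pow_mul_exp_neg_atTop_nhds_zero 2
    have hpos : 0 < c * θ / 8 := by positivity
    have h2 : Filter.Tendsto (fun n : ℕ => c * θ / 8 * (n : ℝ)) Filter.atTop Filter.atTop :=
      Filter.Tendsto.const_mul_atTop hpos tendsto_natCast_atTop_atTop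
    have h3 := (h1.comp h2).eventually (gt_mem_nhds (show (0 : ℝ) < (c * θ / 8) ^ 2 * (1 / 4) by
      positivity))
    obtain ⟨n₀, hn⟩ := Filter.eventually_atTop.1 h3
    refine ⟨n₀, fun n hle => ?_⟩
    have := hn n hle
    simp only [Function.comp, mul_pow] at this
    rw [mul_assoc] at this
    rw [neg_mul]
    exact lt_of_mul_lt_mul_left this (by positivity)
  obtain ⟨n₀, hn₀⟩ := hlim
  refine ⟨max n₀ 1, fun V _ _ hn Q _ G hG Z hZ => ?_⟩
  have hn1 : n₀ ≤ Fintype.card V := le_trans (le_max_left _ _) hn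
  have hn2 : 0 < Fintype.card V := lt_of_lt_of_le one_pos (le_trans (le_max_right _ _) hn)
  have : Nonempty V := Fintype.card_pos_iff.1 hn2
  rcases G.eq_empty_or_nonempty with rfl | hGne
  · exact ⟨∅, by simp; positivity⟩
  have : Nonempty {p // p ∈ G} := hGne.to_subtype
  set n : ℝ := ((Fintype.card V : ℕ) : ℝ) with hndef
  have hnpos : 0 < n := Nat.cast_pos.2 hn2
  set N := ⌊θ * n⌋₊ with hN
  have hN1 : (N : ℝ) ≤ θ * n := Nat.floor_le (by positivity)
  have hN2 : θ * n < N + 1 := Nat.lt_floor_add_one _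
  obtain ⟨F, hF, hFZ, hFd, hS⟩ := exists_disjoint_family
    (fun (p : {p // p ∈ G}) => Q p.1) hc hc1 (fun p => hG p.1 p.2) Z N (by
      rw [add_mul]
      have : (N : ℝ) * Fintype.card ι * Fintype.card ι ≤ c / 4 * n := by
        calc (N : ℝ) * Fintype.card ι * Fintype.card ι ≤ θ * n * Fintype.card ι * Fintype.card ι := by
              gcongr
          _ = θ * (Fintype.card ι : ℝ) ^ 2 * n := by ring
          _ ≤ c / 4 * n := by gcongr
      rw [← hndef]
      linarith)
  refine ⟨F, le_trans (by exact_mod_cast hF) hN1, hFZ, hFd, fun p hp => ?_⟩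
  have h1 : (1 / 2 : ℝ) ^ (F.filter (Q p)).card ≤ n ^ 2 * (1 - c / 4) ^ N := by
    refine le_trans (Finset.single_le_sum (f := fun i : {p // p ∈ G} =>
      (1 / 2 : ℝ) ^ (F.filter (Q i.1)).card) (fun i _ => by positivity)
        (Finset.mem_univ ⟨p, hp⟩)) (hS.trans ?_)
    refine mul_le_mul_of_nonneg_right ?_ (pow_nonneg (by linarith) _)
    rw [Fintype.card_coe]
    have := Finset.card_le_univ G
    rw [Fintype.card_prod] at this
    rw [hndef, sq]
    exact_mod_cast this
  have h2 : (1 - c / 4) ^ N ≤ Real.exp (-(c / 4) * N) := by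
    rw [mul_comm, Real.exp_nat_mul]
    refine pow_le_pow_left₀ (by linarith) ?_ _
    have := Real.add_one_le_exp (-(c / 4))
    linarith
  by_contra hlt
  push Not at hlt
  set h := (F.filter (Q p)).card
  have h3 : Real.exp (-(h : ℝ)) ≤ (1 / 2 : ℝ) ^ h := by
    rw [← mul_neg_one, Real.exp_nat_mul]
    refine pow_le_pow_left₀ (Real.exp_pos _).le ?_ _
    rw [Real.exp_neg, one_div]
    exact inv_anti₀ (by norm_num) (by have := Real.add_one_le_exp (1 : ℝ); linarith)
  have h4 : Real.exp (-(c * θ / 16 * n)) ≤ n ^ 2 * Real.exp (-(c / 4) * N) :=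
    calc _ ≤ Real.exp (-(h : ℝ)) := Real.exp_le_exp.2 (by linarith)
      _ ≤ _ := h3.trans (h1.trans (by gcongr))
  have h5 : Real.exp (-(c / 4) * N) ≤ Real.exp 1 * Real.exp (-(c * θ / 8) * n) *
      Real.exp (-(c * θ / 16 * n)) := by
    rw [← Real.exp_add, ← Real.exp_add]
    refine Real.exp_le_exp.2 ?_
    have h6 := mul_le_mul_of_nonneg_left hN2.le (show 0 ≤ c / 4 by linarith)
    have h7 : 0 ≤ c * θ * n := by positivity
    linarith
  have h6 := hn₀ _ hn1
  rw [← hndef] at h6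
  have h7 : Real.exp 1 < 4 := by have := Real.exp_one_lt_d9; linarith
  have hE := Real.exp_pos (-(c * θ / 16 * n))
  have h8 : n ^ 2 * Real.exp (-(c / 4) * N) ≤ (n ^ 2 * Real.exp (-(c * θ / 8) * n)) *
      Real.exp 1 * Real.exp (-(c * θ / 16 * n)) := by
    calc _ ≤ n ^ 2 * (Real.exp 1 * Real.exp (-(c * θ / 8) * n) *
          Real.exp (-(c * θ / 16 * n))) := by gcongr
      _ = _ := by ring
  have h9 : (n ^ 2 * Real.exp (-(c * θ / 8) * n)) * Real.exp 1 < 1 := by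
    have h10 : 0 ≤ n ^ 2 * Real.exp (-(c * θ / 8) * n) := by positivity
    have := mul_lt_mul'' h6 h7 h10 (Real.exp_pos 1).le
    linarith
  have h11 := mul_lt_mul_of_pos_right h9 hE
  linarith

end Selection

/-! ### Flexible paths -/

section Flexible

variable {V : Type} [DecidableEq V] {H : Finset (Finset V)}

/-- A path from `s` to `t` through `A` into which every absorber of the family `F` can
independently insert one of the pairs it absorbs. -/
def Flex (H : Finset (Finset V)) (F : Finset (Fin 26 → V)) (s t : V) (A : Finset V) : Prop :=
  ∀ g : (Fin 26 → V) → Finset V,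
    (∀ τ ∈ F, g τ = ∅ ∨ ∃ a b, a ≠ b ∧ g τ = {a, b} ∧ IsAbs H τ a b) →
    (∀ τ ∈ F, ∀ τ' ∈ F, τ ≠ τ' → Disjoint (g τ) (g τ')) →
    (∀ τ ∈ F, Disjoint (g τ) A) → HP H s t (A ∪ F.biUnion g)

theorem Flex.nil (s : V) : Flex H ∅ s s ∅ := fun g _ _ _ => by simpa using HP.nil s

theorem Flex.append {F : Finset (Fin 26 → V)} {s t u : V} {A B : Finset V} (h : Flex H F s t A)
    (hB : HP H t u B) (hAB : Disjoint A B) : Flex H F s u (A ∪ B) := by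
  intro g h1 h2 h3
  have h4 := h g h1 h2 fun τ hτ => (h3 τ hτ).mono_right Finset.subset_union_left
  refine (h4.trans hB ?_).congr ?_
  · rw [Finset.disjoint_union_left, Finset.disjoint_biUnion_left]
    exact ⟨hAB, fun τ hτ => (h3 τ hτ).mono_right Finset.subset_union_right⟩
  · rw [Finset.union_right_comm]

theorem Flex.addAbsorber {F : Finset (Fin 26 → V)} {s t : V} {A : Finset V} (h : Flex H F s t A)
    {τ : Fin 26 → V} (hτ : τ ∉ F) (hp : HP H (τ 0) (τ 15) (absIx.image τ))
    (ht : t = τ 0) (hd : Disjoint A (absIx.image τ)) :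
    Flex H (insert τ F) s (τ 15) (A ∪ absIx.image τ) := by
  subst ht
  intro g h1 h2 h3
  have h4 := h g (fun σ hσ => h1 σ (Finset.mem_insert_of_mem hσ))
    (fun σ hσ σ' hσ' => h2 σ (Finset.mem_insert_of_mem hσ) σ' (Finset.mem_insert_of_mem hσ'))
    (fun σ hσ => (h3 σ (Finset.mem_insert_of_mem hσ)).mono_right Finset.subset_union_left)
  have h5 : HP H (τ 0) (τ 15) (absIx.image τ ∪ g τ) := by
    rcases h1 τ (Finset.mem_insert_self _ _) with e | ⟨a, b, -, e, hab⟩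
    · rw [e]; simpa using hp
    · rw [e]; exact hab.2
  refine (h4.trans h5 ?_).congr ?_
  · rw [Finset.disjoint_union_left, Finset.disjoint_union_right, Finset.disjoint_biUnion_left]
    refine ⟨⟨hd, ((h3 τ (Finset.mem_insert_self _ _)).mono_right
      Finset.subset_union_left).symm⟩, fun σ hσ => ?_⟩
    rw [Finset.disjoint_union_right]
    exact ⟨(h3 σ (Finset.mem_insert_of_mem hσ)).mono_right Finset.subset_union_right,
      h2 σ (Finset.mem_insert_of_mem hσ) τ (Finset.mem_insert_self _ _)
        (fun e => hτ (e ▸ hσ))⟩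
  · rw [Finset.biUnion_insert, Finset.union_union_union_comm, Finset.union_comm (F.biUnion g)]

open Classical in
/-- Distributing an even set among the absorbers. -/
theorem exists_absorption (F : Finset (Fin 26 → V)) : ∀ (k : ℕ) (W : Finset V), W.card = 2 * k →
    (∀ a b, a ≠ b → k ≤ (F.filter fun τ => IsAbs H τ a b).card) →
    ∃ g : (Fin 26 → V) → Finset V,
      (∀ τ ∈ F, g τ = ∅ ∨ ∃ a b, a ≠ b ∧ g τ = {a, b} ∧ IsAbs H τ a b) ∧
      (∀ τ ∈ F, ∀ τ' ∈ F, τ ≠ τ' → Disjoint (g τ) (g τ')) ∧ F.biUnion g = W ∧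
      (F.filter fun τ => g τ ≠ ∅).card ≤ k := by
  intro k
  induction k with
  | zero =>
    intro W hW _
    refine ⟨fun _ => ∅, by simp, by simp, ?_, by simp⟩
    have hW0 : W = ∅ := Finset.card_eq_zero.1 (by simpa using hW)
    rw [hW0]
    ext; simp
  | succ k ih =>
    intro W hW hF
    obtain ⟨a, ha, b, hb, hab⟩ := Finset.one_lt_card.1 (by omega : 1 < W.card)
    have hbe : b ∈ W.erase a := Finset.mem_erase.2 ⟨hab.symm, hb⟩
    obtain ⟨g, h1, h2, h3, h4⟩ := ih ((W.erase a).erase b) (by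
      rw [Finset.card_erase_of_mem hbe, Finset.card_erase_of_mem ha]; omega)
      fun a b h => (Nat.le_succ k).trans (hF a b h)
    obtain ⟨τ, hτ, hτg⟩ := Finset.exists_mem_notMem_of_card_lt_card
      (lt_of_le_of_lt h4 (hF a b hab))
    rw [Finset.mem_filter] at hτ
    have hg : g τ = ∅ := by
      by_contra hne
      exact hτg (Finset.mem_filter.2 ⟨hτ.1, hne⟩)
    have hsub : ∀ σ ∈ F, ∀ x ∈ g σ, x ∈ W ∧ x ≠ a ∧ x ≠ b := by
      intro σ hσ x hx
      have : x ∈ (W.erase a).erase b := h3 ▸ Finset.mem_biUnion.2 ⟨σ, hσ, hx⟩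
      simp only [Finset.mem_erase] at this
      exact ⟨this.2.2, this.2.1, this.1⟩
    have hdis : ∀ σ ∈ F, Disjoint (g σ) {a, b} := by
      intro σ hσ
      rw [Finset.disjoint_left]
      intro x hx hx'
      have := hsub σ hσ x hx
      simp only [Finset.mem_insert, Finset.mem_singleton] at hx'
      rcases hx' with e | e
      · exact this.2.1 e
      · exact this.2.2 e
    refine ⟨Function.update g τ {a, b}, ?_, ?_, ?_, ?_⟩
    · intro σ hσ
      by_cases e : σ = τ
      · subst e; exact Or.inr ⟨a, b, hab, by simp, hτ.2⟩
      · simpa [Function.update_of_ne e] using h1 σ hσ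
    · intro σ hσ σ' hσ' hne
      by_cases e : σ = τ
      · have e' : σ' ≠ τ := fun h => hne (e.trans h.symm)
        rw [e, Function.update_self, Function.update_of_ne e']
        exact (hdis σ' hσ').symm
      · rw [Function.update_of_ne e]
        by_cases e' : σ' = τ
        · rw [e', Function.update_self]; exact hdis σ hσ
        · rw [Function.update_of_ne e']; exact h2 σ hσ σ' hσ' hne
    · ext x
      constructor
      · intro hx
        obtain ⟨σ, hσ, hx⟩ := Finset.mem_biUnion.1 hx
        by_cases e : σ = τ
        · rw [e, Function.update_self] at hx
          simp only [Finset.mem_insert, Finset.mem_singleton] at hx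
          rcases hx with rfl | rfl
          · exact ha
          · exact hb
        · rw [Function.update_of_ne e] at hx
          exact (hsub σ hσ x hx).1
      · intro hx
        by_cases hx' : x = a ∨ x = b
        · exact Finset.mem_biUnion.2 ⟨τ, hτ.1, by simpa using hx'⟩
        · push Not at hx'
          have : x ∈ F.biUnion g := by
            rw [h3]; simp [hx', hx]
          obtain ⟨σ, hσ, hxσ⟩ := Finset.mem_biUnion.1 this
          refine Finset.mem_biUnion.2 ⟨σ, hσ, ?_⟩
          have e : σ ≠ τ := by
            rintro rfl
            simp [hg] at hxσ
          rwa [Function.update_of_ne e]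
    · refine le_trans (Finset.card_le_card (t := insert τ (F.filter fun τ => g τ ≠ ∅)) ?_)
        ((Finset.card_insert_le _ _).trans (Nat.succ_le_succ h4))
      intro σ hσ
      rw [Finset.mem_filter] at hσ
      by_cases e : σ = τ
      · exact e ▸ Finset.mem_insert_self _ _
      · rw [Function.update_of_ne e] at hσ
        exact Finset.mem_insert_of_mem (Finset.mem_filter.2 hσ)

open Classical in
theorem Flex.absorb {F : Finset (Fin 26 → V)} {s t : V} {A W : Finset V} (h : Flex H F s t A)
    (hW : Even W.card) (hAW : Disjoint A W)
    (hF : ∀ a b, a ≠ b → W.card ≤ 2 * (F.filter fun τ => IsAbs H τ a b).card) :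
    HP H s t (A ∪ W) := by
  obtain ⟨k, hk⟩ := hW.two_dvd
  obtain ⟨g, h1, h2, h3, -⟩ := exists_absorption (H := H) F k W hk fun a b hab => by
    have := hF a b hab
    omega
  rw [← h3] at hAW ⊢
  rw [Finset.disjoint_biUnion_right] at hAW
  exact h g h1 h2 fun τ hτ => (hAW τ hτ).symm

open Classical in
/-- Joining a flexible path and a family of paths into a Hamilton cycle with the help of a
reservoir `R` of connecting triples. -/
theorem Flex.hp_univ [Fintype V] (h3 : ∀ e ∈ H, e.card = 3) (hV : Even (Fintype.card V))
    {F : Finset (Fin 26 → V)} {s₀ t₀ : V} {A : Finset V} (hA : Flex H F s₀ t₀ A) (hs : s₀ ∉ A)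
    {R : Finset (Fin 3 → V)} (hRd : ∀ τ ∈ R, ∀ τ' ∈ R, τ ≠ τ' → ∀ j j', τ j ≠ τ' j')
    (hRA : ∀ τ ∈ R, ∀ j, τ j ∉ insert s₀ A)
    {κ : Type} (J : Finset κ) (s t : κ → V) (B : κ → Finset V)
    (hB : ∀ j ∈ J, HP H (s j) (t j) (B j)) (hsB : ∀ j ∈ J, s j ∉ B j)
    (hJd : ∀ j ∈ J, ∀ j' ∈ J, j ≠ j' → Disjoint (insert (s j) (B j)) (insert (s j') (B j')))
    (hJA : ∀ j ∈ J, Disjoint (insert (s j) (B j)) (insert s₀ A))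
    (hJR : ∀ j ∈ J, ∀ τ ∈ R, ∀ i, τ i ∉ insert (s j) (B j))
    (hits : ∀ a b, J.card + 1 ≤ (R.filter fun τ => Conn H a b τ ∧ τ 0 ≠ τ 2).card)
    (habs : ∀ a b, a ≠ b → 3 * R.card + (Finset.univ \ (insert s₀ A ∪
      (R.biUnion fun τ => Finset.univ.image τ) ∪ J.biUnion fun j => insert (s j) (B j))).card ≤
        2 * (F.filter fun τ => IsAbs H τ a b).card) :
    HP H s₀ s₀ Finset.univ := by
  have key : ∀ J' ⊆ J, ∃ (t' : V) (A' : Finset V) (R' : Finset (Fin 3 → V)),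
      Flex H F s₀ t' A' ∧ s₀ ∉ A' ∧ R' ⊆ R ∧ R.card ≤ R'.card + J'.card ∧
      (∀ τ ∈ R', ∀ i, τ i ∉ A') ∧ A ⊆ A' ∧ (∀ j ∈ J', insert (s j) (B j) ⊆ A') ∧
      (∀ j ∈ J, j ∉ J' → Disjoint (insert (s j) (B j)) A') := by
    intro J'
    induction J' using Finset.induction_on with
    | empty =>
      intro _
      refine ⟨t₀, A, R, hA, hs, le_rfl, by simp, fun τ hτ i hi => hRA τ hτ i
        (Finset.mem_insert_of_mem hi), le_rfl, by simp, fun j hj _ =>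
        (hJA j hj).mono_right (Finset.subset_insert _ _)⟩
    | insert j J' hj ih =>
      intro hJ'
      obtain ⟨t', A', R', g1, g2, g3, g4, g5, g6, g7, g8⟩ :=
        ih ((Finset.subset_insert _ _).trans hJ')
      have hjJ : j ∈ J := hJ' (Finset.mem_insert_self _ _)
      have hcard : J'.card + 1 ≤ J.card := by
        rw [← Finset.card_insert_of_notMem hj]; exact Finset.card_le_card hJ'
      obtain ⟨τ, hτ, hτR⟩ := Finset.exists_mem_notMem_of_card_lt_card
        (show (R \ R').card < (R.filter fun τ => Conn H t' (s j) τ ∧ τ 0 ≠ τ 2).card by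
          have := hits t' (s j)
          rw [Finset.card_sdiff_of_subset g3]; omega)
      rw [Finset.mem_filter] at hτ
      have hτR' : τ ∈ R' := by
        by_contra hn
        exact hτR (Finset.mem_sdiff.2 ⟨hτ.1, hn⟩)
      have hjr := hJR j hjJ τ hτ.1
      simp only [Finset.mem_insert, not_or] at hjr
      have hp1 : HP H t' (s j) {τ 0, τ 1, τ 2, s j} :=
        HP.of_conn h3 hτ.2.1.1 hτ.2.1.2 hτ.2.2 (hjr 0).1
      have hp2 := hp1.trans (hB j hjJ) (by
        simp only [Finset.disjoint_insert_left, Finset.disjoint_singleton_left]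
        exact ⟨(hjr 0).2, (hjr 1).2, (hjr 2).2, hsB j hjJ⟩)
      have hjd := g8 j hjJ hj
      have hd : Disjoint A' ({τ 0, τ 1, τ 2, s j} ∪ B j) := by
        rw [Finset.disjoint_insert_left] at hjd
        simp only [Finset.disjoint_union_right, Finset.disjoint_insert_right,
          Finset.disjoint_singleton_right]
        exact ⟨⟨g5 τ hτR' 0, g5 τ hτR' 1, g5 τ hτR' 2, hjd.1⟩, hjd.2.symm⟩
      have hs0 : ∀ i, s₀ ≠ τ i := fun i e => hRA τ hτ.1 i (by simp [e])
      have hs1 := hJA j hjJ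
      rw [Finset.disjoint_insert_right] at hs1
      simp only [Finset.mem_insert, not_or] at hs1
      refine ⟨t j, A' ∪ ({τ 0, τ 1, τ 2, s j} ∪ B j), R'.erase τ, g1.append hp2 hd, ?_,
        (Finset.erase_subset _ _).trans g3, ?_, ?_, g6.trans Finset.subset_union_left, ?_, ?_⟩
      · simp [g2, hs0, hs1.1.1, hs1.1.2]
      · rw [Finset.card_erase_of_mem hτR', Finset.card_insert_of_notMem hj]
        have := Finset.card_pos.2 ⟨τ, hτR'⟩
        omega
      · intro σ hσ i
        have hne := Finset.ne_of_mem_erase hσ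
        have hσR' := Finset.mem_of_mem_erase hσ
        have e1 := hRd σ (g3 hσR') τ hτ.1 hne i
        have e2 := hJR j hjJ σ (g3 hσR') i
        simp only [Finset.mem_insert, not_or] at e2
        simp [g5 σ hσR' i, e1, e2]
      · intro k hk
        rcases Finset.mem_insert.1 hk with rfl | hk
        · intro x hx
          simp only [Finset.mem_insert] at hx
          simp only [Finset.mem_union, Finset.mem_insert, Finset.mem_singleton]
          tauto
        · exact (g7 k hk).trans Finset.subset_union_left
      · intro k hk hkJ
        rw [Finset.mem_insert, not_or] at hkJ
        have e1 := hJd k hk j hjJ hkJ.1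
        have e2 := hJR k hk τ hτ.1
        have e3 := g8 k hk hkJ.2
        rw [Finset.disjoint_insert_right] at e1
        simp only [Finset.disjoint_union_right, Finset.disjoint_insert_right,
          Finset.disjoint_singleton_right]
        exact ⟨e3, ⟨e2 0, e2 1, e2 2, e1.1⟩, e1.2⟩
  obtain ⟨t', A', R', g1, g2, g3, g4, g5, g6, g7, -⟩ := key J le_rfl
  obtain ⟨τ, hτ, hτR⟩ := Finset.exists_mem_notMem_of_card_lt_card
    (show (R \ R').card < (R.filter fun τ => Conn H t' s₀ τ ∧ τ 0 ≠ τ 2).card by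
      have := hits t' s₀
      rw [Finset.card_sdiff_of_subset g3]; omega)
  rw [Finset.mem_filter] at hτ
  have hτR' : τ ∈ R' := by
    by_contra hn
    exact hτR (Finset.mem_sdiff.2 ⟨hτ.1, hn⟩)
  have hs0 : ∀ i, τ i ≠ s₀ := fun i e => hRA τ hτ.1 i (by simp [e])
  have hp1 : HP H t' s₀ {τ 0, τ 1, τ 2, s₀} :=
    HP.of_conn h3 hτ.2.1.1 hτ.2.1.2 hτ.2.2 (hs0 0)
  have hfl := g1.append hp1 (by
    simp only [Finset.disjoint_insert_right, Finset.disjoint_singleton_right]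
    exact ⟨g5 τ hτR' 0, g5 τ hτR' 1, g5 τ hτR' 2, g2⟩)
  set C := A' ∪ {τ 0, τ 1, τ 2, s₀} with hC
  have hCe : Even C.card := by
    have := hfl (fun _ => ∅) (by simp) (by simp) (by simp)
    have e : F.biUnion (fun _ => (∅ : Finset V)) = ∅ := by ext; simp
    rw [e, Finset.union_empty] at this
    exact this.even
  refine (hfl.absorb (W := Finset.univ \ C) ?_ Finset.disjoint_sdiff ?_).congr (by simp)
  · rw [Finset.card_sdiff_of_subset (Finset.subset_univ _), Finset.card_univ]
    exact (Nat.even_sub (Finset.card_le_univ _)).2 ⟨fun _ => hCe, fun _ => hV⟩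
  · intro a b hab
    refine le_trans ?_ (habs a b hab)
    have hsub : Finset.univ \ C ⊆ (R.biUnion fun τ => Finset.univ.image τ) ∪
        (Finset.univ \ (insert s₀ A ∪ (R.biUnion fun τ => Finset.univ.image τ) ∪
          J.biUnion fun j => insert (s j) (B j))) := by
      intro x hx
      rw [Finset.mem_sdiff] at hx
      have hxC := hx.2
      rw [hC, Finset.mem_union, not_or] at hxC
      by_cases hxR : x ∈ R.biUnion fun τ => Finset.univ.image τ
      · exact Finset.mem_union_left _ hxR
      · refine Finset.mem_union_right _ (Finset.mem_sdiff.2 ⟨hx.1, ?_⟩)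
        rw [Finset.mem_union, Finset.mem_union, not_or, not_or]
        refine ⟨⟨?_, hxR⟩, ?_⟩
        · rw [Finset.mem_insert, not_or]
          exact ⟨fun e => hxC.2 (by simp [e]), fun e => hxC.1 (g6 e)⟩
        · intro hx
          obtain ⟨j, hj, hx⟩ := Finset.mem_biUnion.1 hx
          exact hxC.1 (g7 j hj hx)
    refine (Finset.card_le_card hsub).trans ((Finset.card_union_le _ _).trans ?_)
    refine Nat.add_le_add_right ?_ _
    rw [mul_comm]
    refine Finset.card_biUnion_le_card_mul _ _ _ fun τ _ => ?_
    exact Finset.card_image_le.trans (by simp)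

end Flexible

/-! ### The absorbing path -/

section AbsorbingPath

variable {V : Type} [DecidableEq V] [Fintype V] {H : Finset (Finset V)}

theorem exists_conn_avoiding
    (hd : ∀ v : V, 43 / 100 * (Fintype.card V : ℝ) ^ 2 ≤
      cnt (fun p : V × V => Tri H v p.1 p.2))
    (a b : V) (U : Finset V)
    (hU : 3 * (U.card : ℝ) + 1 < 1 / 10 ^ 6 * Fintype.card V) :
    ∃ τ : Fin 3 → V, Conn H a b τ ∧ τ 0 ≠ τ 2 ∧ ∀ j, τ j ∉ U := by
  by_contra! hcon
  have h1 : cnt (Conn H a b) ≤ cnt (fun τ : Fin 3 → V => ∃ v ∈ U, ∃ i, τ i = v) +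
      cnt (fun τ : Fin 3 → V => τ 0 = τ 2) := by
    refine cnt_le_add fun τ hτ => ?_
    by_cases h : τ 0 = τ 2
    · exact Or.inr h
    · obtain ⟨j, hj⟩ := hcon τ hτ h
      exact Or.inl ⟨τ j, hj, j, rfl⟩
  have h2 := cnt_meets_le (ι := Fin 3) U
  have h3 := cnt_coord_eq_coord (V := V) (i := (0 : Fin 3)) (j := 2) (by decide)
  have h4 := cnt_conn_ge hd a b
  have hn : (0 : ℝ) < Fintype.card V := Nat.cast_pos.2 (Fintype.card_pos_iff.2 ⟨a⟩)
  have e : (Fintype.card (Fin 3 → V) : ℝ) = (Fintype.card V : ℝ) ^ 3 := by simp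
  rw [e] at h2 h3
  simp only [Fintype.card_fin, Nat.cast_ofNat] at h2
  set n : ℝ := ((Fintype.card V : ℕ) : ℝ) with hndef
  have h5 : 1 / 10 ^ 6 * n ^ 3 * n ≤ (3 * (U.card : ℝ) + 1) * n ^ 3 := by
    have := mul_le_mul_of_nonneg_right (h4.trans h1) hn.le
    linarith
  have h6 := mul_lt_mul_of_pos_right hU (pow_pos hn 3)
  linarith

theorem exists_flex
    (hd : ∀ v : V, 43 / 100 * (Fintype.card V : ℝ) ^ 2 ≤
      cnt (fun p : V × V => Tri H v p.1 p.2))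
    (h3 : ∀ e ∈ H, e.card = 3) (s₀ : V) (F : Finset (Fin 26 → V))
    (hp : ∀ τ ∈ F, HP H (τ 0) (τ 15) (absIx.image τ)) (hinj : ∀ τ ∈ F, Function.Injective τ)
    (hdis : ∀ τ ∈ F, ∀ τ' ∈ F, τ ≠ τ' → ∀ j j', τ j ≠ τ' j') (hs : ∀ τ ∈ F, ∀ j, τ j ≠ s₀)
    (hsize : 156 * (F.card : ℝ) + 4 < 1 / 10 ^ 6 * Fintype.card V) :
    ∃ (t : V) (A : Finset V), Flex H F s₀ t A ∧ s₀ ∉ A ∧ A.card ≤ 26 * F.card := by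
  have key : ∀ F' ⊆ F, ∃ (t : V) (A : Finset V), Flex H F' s₀ t A ∧ s₀ ∉ A ∧
      A.card ≤ 26 * F'.card ∧ ∀ τ ∈ F, τ ∉ F' → ∀ j, τ j ∉ A := by
    intro F'
    induction F' using Finset.induction_on with
    | empty => exact fun _ => ⟨s₀, ∅, Flex.nil s₀, by simp, by simp, by simp⟩
    | insert σ F' hσ ih =>
      intro hF'
      obtain ⟨t, A, g1, g2, g3, g4⟩ := ih ((Finset.subset_insert _ _).trans hF')
      have hσF : σ ∈ F := hF' (Finset.mem_insert_self _ _)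
      have hle : F'.card ≤ F.card := Finset.card_le_card ((Finset.subset_insert _ _).trans hF')
      obtain ⟨ξ, c1, c2, c3⟩ := exists_conn_avoiding hd t (σ 0)
        (insert s₀ (A ∪ F.biUnion fun τ => Finset.univ.image τ)) (by
          have u1 : (F.biUnion fun τ => Finset.univ.image τ).card ≤ F.card * 26 :=
            Finset.card_biUnion_le_card_mul _ _ _ fun τ _ =>
              Finset.card_image_le.trans (by simp)
          have u2 := Finset.card_union_le A (F.biUnion fun τ => Finset.univ.image τ)
          have u3 := Finset.card_insert_le s₀ (A ∪ F.biUnion fun τ => Finset.univ.image τ)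
          have u4 : ((insert s₀ (A ∪ F.biUnion fun τ => Finset.univ.image τ)).card : ℝ) ≤
              52 * F.card + 1 := by
            exact_mod_cast (show _ ≤ 52 * F.card + 1 by omega)
          linarith)
      simp only [Finset.mem_insert, Finset.mem_union, Finset.mem_biUnion, Finset.mem_image,
        Finset.mem_univ, true_and, not_or, not_exists, not_and] at c3
      have hd1 : Disjoint A {ξ 0, ξ 1, ξ 2, σ 0} := by
        simp only [Finset.disjoint_insert_right, Finset.disjoint_singleton_right]
        exact ⟨(c3 0).2.1, (c3 1).2.1, (c3 2).2.1, g4 σ hσF hσ 0⟩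
      have h5 := (g1.append (HP.of_conn h3 c1.1 c1.2 c2
        (fun e => (c3 0).2.2 σ hσF 0 e.symm)) hd1).addAbsorber hσ (hp σ hσF) rfl (by
          rw [Finset.disjoint_right]
          intro x hx
          obtain ⟨i, hi, rfl⟩ := Finset.mem_image.1 hx
          have hi0 : i ≠ 0 := by rintro rfl; revert hi; decide
          have hne : ∀ k, σ i ≠ ξ k := fun k => (c3 k).2.2 σ hσF i
          simp [g4 σ hσF hσ i, hne, (hinj σ hσF).ne hi0])
      refine ⟨_, _, h5, ?_, ?_, ?_⟩
      · have hne : ∀ k, s₀ ≠ ξ k := fun k e => (c3 k).1 e.symm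
        simp [g2, hne, (hs σ hσF 0).symm, hs σ hσF]
      · have u1 := Finset.card_union_le (A ∪ {ξ 0, ξ 1, ξ 2, σ 0}) (absIx.image σ)
        have u2 := Finset.card_union_le A {ξ 0, ξ 1, ξ 2, σ 0}
        have u3 : ({ξ 0, ξ 1, ξ 2, σ 0} : Finset V).card ≤ 4 := Finset.card_le_four
        have u4 : (absIx.image σ).card ≤ 22 := Finset.card_image_le.trans (by decide)
        rw [Finset.card_insert_of_notMem hσ]
        omega
      · intro τ hτ hτF j
        rw [Finset.mem_insert, not_or] at hτF
        have e1 := hdis τ hτ σ hσF hτF.1 j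
        have hne : ∀ k, τ j ≠ ξ k := fun k => (c3 k).2.2 τ hτ j
        simp [g4 τ hτ hτF.2 j, hne, e1, fun k => (e1 k).symm]
  obtain ⟨t, A, g1, g2, g3, -⟩ := key F le_rfl
  exact ⟨t, A, g1, g2, g3⟩

end AbsorbingPath

/-! ### Tiles -/

section Tiles

variable {V : Type} [DecidableEq V] {H : Finset (Finset V)}

/-- `φ` embeds the blow-up of the 3-graph with edges `abc`, `abc'` in which every vertex is
replaced by `t` copies. -/
def Tile (H : Finset (Finset V)) (t : ℕ) (φ : Fin 4 → Fin t → V) : Prop :=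
  Function.Injective (fun x : Fin 4 × Fin t => φ x.1 x.2) ∧
    ∀ j l m, Tri H (φ 0 j) (φ 1 l) (φ 2 m) ∧ Tri H (φ 0 j) (φ 1 l) (φ 3 m)

theorem Tile.exists_path (h3 : ∀ e ∈ H, e.card = 3) {s : ℕ} {φ : Fin 4 → Fin (s + 1) → V}
    (h : Tile H (s + 1) φ) : ∃ A : Finset V, HP H (φ 0 0) (φ 0 (Fin.last s)) A ∧ φ 0 0 ∉ A ∧
      A.card = 4 * s ∧ ∀ x ∈ A, ∃ i j, x = φ i j := by
  have hinj : ∀ i j i' j', φ i j = φ i' j' → i = i' ∧ j = j' := fun i j i' j' e => by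
    have := h.1 (a₁ := (i, j)) (a₂ := (i', j')) e
    exact ⟨congrArg Prod.fst this, congrArg Prod.snd this⟩
  have key : ∀ (j : ℕ) (hj : j < s + 1), ∃ A : Finset V, HP H (φ 0 0) (φ 0 ⟨j, hj⟩) A ∧
      A.card = 4 * j ∧ ∀ x ∈ A, ∃ i k, x = φ i k ∧
        ((i = 0 ∧ 0 < k.val ∧ k.val ≤ j) ∨ (i ≠ 0 ∧ k.val < j)) := by
    intro j
    induction j with
    | zero => exact fun _ => ⟨∅, HP.nil _, by simp, by simp⟩
    | succ j ih =>
      intro hj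
      have hj' : j < s + 1 := by omega
      obtain ⟨A, h1, h2, h4⟩ := ih hj'
      have hn : ∀ i k, ((i = 0 ∧ j < k.val) ∨ (i ≠ 0 ∧ j ≤ k.val)) → φ i k ∉ A := by
        intro i k hik hmem
        obtain ⟨i', k', e, hik'⟩ := h4 _ hmem
        obtain ⟨rfl, rfl⟩ := hinj _ _ _ _ e
        rcases hik with hik | hik <;> rcases hik' with hik' | hik'
        · omega
        · exact hik'.1 hik.1
        · exact hik.1 hik'.1
        · omega
      have hne : ∀ i k i' k', i ≠ i' → φ i k ≠ φ i' k' := fun i k i' k' hi e =>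
        hi (hinj _ _ _ _ e).1
      have hstep : HP H (φ 0 ⟨j, hj'⟩) (φ 0 ⟨j + 1, hj⟩)
          {φ 2 ⟨j, hj'⟩, φ 1 ⟨j, hj'⟩, φ 3 ⟨j, hj'⟩, φ 0 ⟨j + 1, hj⟩} :=
        HP.of_conn h3 (h.2 _ _ _).1.swap_right
          (h.2 ⟨j + 1, hj⟩ ⟨j, hj'⟩ ⟨j, hj'⟩).2.rotate (hne _ _ _ _ (by decide))
          (hne _ _ _ _ (by decide))
      have hdis : Disjoint A {φ 2 ⟨j, hj'⟩, φ 1 ⟨j, hj'⟩, φ 3 ⟨j, hj'⟩, φ 0 ⟨j + 1, hj⟩} := by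
        simp only [Finset.disjoint_insert_right, Finset.disjoint_singleton_right]
        exact ⟨hn _ _ (Or.inr ⟨by decide, le_rfl⟩), hn _ _ (Or.inr ⟨by decide, le_rfl⟩),
          hn _ _ (Or.inr ⟨by decide, le_rfl⟩), hn _ _ (Or.inl ⟨rfl, Nat.lt_succ_self j⟩)⟩
      refine ⟨_, h1.trans hstep hdis, ?_, ?_⟩
      · rw [Finset.card_union_of_disjoint hdis, h2, Finset.card_insert_of_notMem,
          Finset.card_insert_of_notMem, Finset.card_insert_of_notMem, Finset.card_singleton]
        · ring
        · simp [hne]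
        · simp [hne]
        · simp [hne]
      · intro x hx
        rcases Finset.mem_union.1 hx with hx | hx
        · obtain ⟨i, k, e, hik⟩ := h4 x hx
          exact ⟨i, k, e, hik.imp (fun h => ⟨h.1, h.2.1, by omega⟩) fun h => ⟨h.1, by omega⟩⟩
        · simp only [Finset.mem_insert, Finset.mem_singleton] at hx
          rcases hx with e | e | e | e
          · exact ⟨_, _, e, Or.inr ⟨by decide, Nat.lt_succ_self j⟩⟩
          · exact ⟨_, _, e, Or.inr ⟨by decide, Nat.lt_succ_self j⟩⟩
          · exact ⟨_, _, e, Or.inr ⟨by decide, Nat.lt_succ_self j⟩⟩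
          · exact ⟨_, _, e, Or.inl ⟨rfl, Nat.succ_pos j, le_rfl⟩⟩
  obtain ⟨A, h1, h2, h4⟩ := key s (Nat.lt_succ_self s)
  refine ⟨A, h1, fun hmem => ?_, h2, fun x hx => ?_⟩
  · obtain ⟨i, k, e, hik⟩ := h4 _ hmem
    obtain ⟨rfl, rfl⟩ := hinj _ _ _ _ e
    rcases hik with hik | hik
    · simp at hik
    · exact hik.1 rfl
  · obtain ⟨i, k, e, -⟩ := h4 x hx
    exact ⟨i, k, e⟩

end Tiles

/-! ### Fractional covers of dense graphs -/

section Threshold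

variable {V : Type} [Fintype V]

open MeasureTheory in
theorem exists_threshold (w : V → ℝ) (hw : ∀ v, 0 ≤ w v) :
    ∃ θ : ℝ, 0 < θ ∧ θ ≤ 1 / 2 ∧
      cnt (fun v => θ ≤ w v) + cnt (fun v => 1 - θ < w v) ≤ 2 * ∑ v, w v := by
  classical
  set f : ℝ → ℝ := fun θ => ∑ v, ((Set.Iic (w v)).indicator (fun _ => (1 : ℝ)) θ +
    (Set.Ioi (1 - w v)).indicator (fun _ => (1 : ℝ)) θ) with hf
  have hI : ∀ v, IntegrableOn ((Set.Iic (w v)).indicator (fun _ => (1 : ℝ)))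
      (Set.Ioc 0 (1 / 2)) volume := fun v =>
    (integrableOn_const (by simp) (by simp)).indicator measurableSet_Iic
  have hJ : ∀ v, IntegrableOn ((Set.Ioi (1 - w v)).indicator (fun _ => (1 : ℝ)))
      (Set.Ioc 0 (1 / 2)) volume := fun v =>
    (integrableOn_const (by simp) (by simp)).indicator measurableSet_Ioi
  obtain ⟨θ, hθ, hle⟩ := exists_le_setAverage (μ := volume) (s := Set.Ioc (0 : ℝ) (1 / 2))
    (f := f) (by simp) (by simp) (integrable_finsetSum _ fun v _ => (hI v).add (hJ v))
  refine ⟨θ, hθ.1, hθ.2, ?_⟩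
  have e1 : f θ = cnt (fun v => θ ≤ w v) + cnt (fun v => 1 - θ < w v) := by
    unfold cnt
    rw [hf, ← Finset.sum_add_distrib]
    refine Finset.sum_congr rfl fun v _ => ?_
    simp only [Set.indicator_apply, Set.mem_Iic, Set.mem_Ioi]
    congr 1
    exact if_congr (by constructor <;> intro h <;> linarith) rfl rfl
  have e2 : ∫ a in Set.Ioc (0 : ℝ) (1 / 2), f a ≤ ∑ v, w v := by
    have e3 := integral_finsetSum (μ := volume.restrict (Set.Ioc (0 : ℝ) (1 / 2))) Finset.univ
      fun v _ => (hI v).add (hJ v)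
    simp only [Pi.add_apply] at e3
    rw [hf]
    refine e3.le.trans ?_
    refine Finset.sum_le_sum fun v _ => ?_
    rw [integral_add (hI v) (hJ v), setIntegral_indicator measurableSet_Iic,
      setIntegral_indicator measurableSet_Ioi, Set.Ioc_inter_Iic, Set.Ioc_inter_Ioi]
    simp only [setIntegral_const, smul_eq_mul, mul_one, Real.volume_real_Ioc]
    have := hw v
    rcases le_total (1 / 2 : ℝ) (w v) with h | h
    · rw [min_eq_left h]
      rcases le_total 0 (1 - w v) with h' | h'
      · rw [max_eq_right h', max_eq_left (by linarith), max_eq_left (by linarith)]; linarith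
      · rw [max_eq_left h', max_eq_left (by linarith)]; linarith
    · rw [min_eq_right h, max_eq_left (by linarith), max_eq_right (a := (0 : ℝ)) (by linarith),
        max_eq_right (by linarith)]
      linarith
  rw [setAverage_eq, Real.volume_real_Ioc, smul_eq_mul, e1] at hle
  norm_num at hle
  linarith

theorem cnt_le_of_threshold (w : V → ℝ) (hw : ∀ v, 0 ≤ w v) {γ : ℝ}
    (hsum : ∑ v, w v ≤ 1 / 4 * Fintype.card V)
    (hpairs : (7 / 16 - γ) * (Fintype.card V : ℝ) ^ 2 ≤
      cnt (fun p : V × V => 1 ≤ w p.1 + w p.2)) :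
    cnt (fun v => 1 / 8 ≤ w v) ≤ (1 / 4 + 100 * γ) * Fintype.card V := by
  classical
  obtain ⟨θ, h0, h1, hθ⟩ := exists_threshold w hw
  rcases isEmpty_or_nonempty V with hV | ⟨⟨v₀⟩⟩
  · unfold cnt; simp
  have hn : (0 : ℝ) < Fintype.card V := Nat.cast_pos.2 (Fintype.card_pos_iff.2 ⟨v₀⟩)
  set α := cnt (fun v => 1 - θ < w v) with hα
  set μ := cnt (fun v => θ ≤ w v ∧ w v ≤ 1 - θ) with hμ
  set l := cnt (fun v => w v < θ) with hl
  have c1 : cnt (fun v => θ ≤ w v) = α + μ := by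
    rw [hα, hμ]
    unfold cnt
    rw [← Finset.sum_add_distrib]
    refine Finset.sum_congr rfl fun v _ => ?_
    by_cases a1 : θ ≤ w v <;> by_cases a2 : w v ≤ 1 - θ
    · simp [a1, a2, not_lt.2 a2]
    · simp [a1, a2, not_le.1 a2]
    · simp [a1, a2, not_lt.2 a2]
    · exfalso; linarith
  have c2 : α + μ + l = Fintype.card V := by
    rw [← c1, hl, ← cnt_add_cnt_not (fun v => θ ≤ w v)]
    congr 1
    exact cnt_congr fun v => not_le.symm
  have c3 : cnt (fun v => ¬ 1 - θ < w v) = μ + l := by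
    have := cnt_add_cnt_not (fun v => 1 - θ < w v)
    linarith
  set N := cnt (fun p : V × V => (1 - θ < w p.1 ∧ w p.2 < θ) ∧ w p.1 + w p.2 < 1) with hN
  have hN0 : 0 ≤ N := cnt_nonneg _
  have c4 : cnt (fun p : V × V => 1 ≤ w p.1 + w p.2) + N + (μ + l) ^ 2 ≤
      (Fintype.card V : ℝ) ^ 2 + μ ^ 2 := by
    have e1 : (μ + l) ^ 2 = cnt (fun p : V × V => ¬ 1 - θ < w p.1 ∧ ¬ 1 - θ < w p.2) := by
      rw [cnt_prod_and (fun v => ¬ 1 - θ < w v) (fun v => ¬ 1 - θ < w v), c3, sq]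
    have e2 : μ ^ 2 = cnt (fun p : V × V => (θ ≤ w p.1 ∧ w p.1 ≤ 1 - θ) ∧
        (θ ≤ w p.2 ∧ w p.2 ≤ 1 - θ)) := by
      rw [cnt_prod_and (fun v => θ ≤ w v ∧ w v ≤ 1 - θ) (fun v => θ ≤ w v ∧ w v ≤ 1 - θ), sq]
    have e3 : (Fintype.card V : ℝ) ^ 2 = cnt (fun _ : V × V => True) := by
      rw [cnt_true]; simp [sq]
    rw [e1, e2, e3, hN]
    unfold cnt
    rw [← Finset.sum_add_distrib, ← Finset.sum_add_distrib, ← Finset.sum_add_distrib]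
    refine Finset.sum_le_sum fun p _ => ?_
    by_cases a1 : 1 - θ < w p.1
    · by_cases a3 : 1 ≤ w p.1 + w p.2
      · simp [a1, a3, not_lt.2 a3, not_le.2 a1]
      · by_cases a4 : w p.2 < θ <;> simp [a1, a3, a4, not_le.1 a3, not_le.2 a1]
    · by_cases a2 : 1 - θ < w p.2
      · by_cases a3 : 1 ≤ w p.1 + w p.2 <;> simp [a1, a2, a3, not_le.2 a2]
      · by_cases a3 : 1 ≤ w p.1 + w p.2
        · have b1 : θ ≤ w p.1 := by linarith
          have b2 : θ ≤ w p.2 := by linarith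
          simp [a1, a2, a3, b1, b2, not_lt.1 a1, not_lt.1 a2]
        · by_cases a4 : (θ ≤ w p.1 ∧ w p.1 ≤ 1 - θ) ∧ (θ ≤ w p.2 ∧ w p.2 ≤ 1 - θ)
          · simp [a1, a2, a3, a4]
          · simp only [a1, a2, a3, a4, if_false, false_and, if_true, not_false_iff, and_self]
            norm_num
  set n : ℝ := ((Fintype.card V : ℕ) : ℝ) with hndef
  set S := ∑ v, w v with hS
  set T := ∑ v, if w v < θ then w v else 0 with hT
  have hT0 : 0 ≤ T := Finset.sum_nonneg fun v _ => by split_ifs <;> simp [hw]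
  have hμ0 : 0 ≤ μ := cnt_nonneg _
  have hl0 : 0 ≤ l := cnt_nonneg _
  have hα0 : 0 ≤ α := cnt_nonneg _
  have hαμ : 2 * α + μ ≤ n / 2 := by linarith
  -- the size of the upper part
  have d0 : 3 / 16 * n ^ 2 - γ * n ^ 2 + N ≤ 3 * α ^ 2 := by
    have : μ ^ 2 ≤ (n / 2 - 2 * α) ^ 2 := by
      apply pow_le_pow_left₀ hμ0; linarith
    have e : μ + l = n - α := by linarith
    rw [e] at c4
    linarith [this, c4, hpairs]
  have d1 : 3 / 4 * (n / 4 - α) ≤ γ * n := by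
    have hq : 0 ≤ n / 4 - α := by linarith
    have : 3 * (n / 4 - α) * (n / 4 + α) ≤ γ * n * n := by linarith
    have h2 : 3 * (n / 4 - α) * (n / 4) ≤ 3 * (n / 4 - α) * (n / 4 + α) :=
      mul_le_mul_of_nonneg_left (by linarith) (by linarith)
    refine le_of_mul_le_mul_right ?_ hn
    linarith
  have d2 : N ≤ γ * n ^ 2 := by
    have : α ^ 2 ≤ (n / 4) ^ 2 := pow_le_pow_left₀ hα0 (by linarith) 2
    linarith
  -- the weight of the lower part
  have d3 : α * l - N ≤ l * (S - T) + α * T := by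
    have f1 : α * l = cnt (fun p : V × V => 1 - θ < w p.1 ∧ w p.2 < θ) := by
      rw [cnt_prod_and (fun v => 1 - θ < w v) (fun v => w v < θ)]
    have f2 : l * (∑ v, if 1 - θ < w v then w v else 0) + α * T =
        ∑ p : V × V, if 1 - θ < w p.1 ∧ w p.2 < θ then w p.1 + w p.2 else 0 := by
      rw [hl, hα, hT]
      unfold cnt
      rw [Fintype.sum_prod_type, mul_comm, Finset.sum_mul_sum, Finset.sum_mul_sum,
        ← Finset.sum_add_distrib]
      refine Finset.sum_congr rfl fun x _ => ?_
      rw [← Finset.sum_add_distrib]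
      refine Finset.sum_congr rfl fun y _ => ?_
      by_cases a1 : 1 - θ < w x <;> by_cases a2 : w y < θ <;> simp [a1, a2]
    have f3 : (∑ v, if 1 - θ < w v then w v else 0) ≤ S - T := by
      rw [hS, hT, ← Finset.sum_sub_distrib]
      refine Finset.sum_le_sum fun v _ => ?_
      by_cases a1 : 1 - θ < w v
      · simp [a1, not_lt.2 (show θ ≤ w v by linarith)]
      · by_cases a2 : w v < θ <;> simp [a1, a2, hw]
    have f4 : α * l - N ≤
        ∑ p : V × V, if 1 - θ < w p.1 ∧ w p.2 < θ then w p.1 + w p.2 else 0 := by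
      rw [f1, hN]
      unfold cnt
      rw [← Finset.sum_sub_distrib]
      refine Finset.sum_le_sum fun p _ => ?_
      have := hw p.1
      have := hw p.2
      by_cases a1 : 1 - θ < w p.1 ∧ w p.2 < θ
      · by_cases a2 : w p.1 + w p.2 < 1
        · simp [a1, a2]; linarith
        · simp [a1, a2]; linarith
      · simp [a1]
    have := mul_le_mul_of_nonneg_left f3 hl0
    linarith
  have d4 : T ≤ 5 * γ * n := by
    have g1 : n / 2 * T ≤ (l - α) * T := mul_le_mul_of_nonneg_right (by linarith) hT0
    have g2 : l * (S - T) ≤ l * (n / 4 - T) := mul_le_mul_of_nonneg_left (by linarith) hl0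
    have g3 : l * (n / 4 - α) ≤ n * (n / 4 - α) :=
      mul_le_mul_of_nonneg_right (by linarith) (by linarith)
    have g4 : n * (n / 4 - α) ≤ n * (4 / 3 * (γ * n)) :=
      mul_le_mul_of_nonneg_left (by linarith) hn.le
    have hγ : 0 ≤ γ * n ^ 2 := hN0.trans d2
    refine le_of_mul_le_mul_left (a := n / 2) ?_ (by linarith)
    ring_nf at *
    linarith
  have d5 : cnt (fun v => 1 / 8 ≤ w v ∧ w v < θ) ≤ 8 * T := by
    rw [hT, Finset.mul_sum]
    unfold cnt
    refine Finset.sum_le_sum fun v _ => ?_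
    have := hw v
    by_cases a1 : w v < θ <;> by_cases a2 : 1 / 8 ≤ w v <;>
      simp only [a1, a2, and_self, and_false, false_and, if_true, if_false] <;> linarith
  have d6 : cnt (fun v => 1 / 8 ≤ w v) ≤
      cnt (fun v => 1 / 8 ≤ w v ∧ w v < θ) + cnt (fun v => θ ≤ w v) :=
    cnt_le_add fun v hv => by
      rcases lt_or_ge (w v) θ with h | h
      · exact Or.inl ⟨hv, h⟩
      · exact Or.inr h
  have hγ : 0 ≤ γ * n := by linarith [hT0, d4]
  linarith

end Threshold

/-! ### Least-squares fractional tilings -/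

section LeastSquares

variable {ι V : Type} [Fintype ι] [DecidableEq V] (S : ι → Finset V)

/-- The total weight at `v` of the sets `S p` with weights `x p`. -/
noncomputable def tot (x : ι → ℝ) (v : V) : ℝ := ∑ p, if v ∈ S p then x p else 0

variable {S}

theorem tot_nonneg {x : ι → ℝ} (hx : ∀ p, 0 ≤ x p) (v : V) : 0 ≤ tot S x v :=
  Finset.sum_nonneg fun p _ => by split_ifs <;> simp [hx]

theorem tot_mono {x y : ι → ℝ} (h : ∀ p, x p ≤ y p) (v : V) : tot S x v ≤ tot S y v :=
  Finset.sum_le_sum fun p _ => by split_ifs <;> simp [h]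

theorem sum_mul_tot {U : Finset V} (hS : ∀ p, S p ⊆ U) (f : V → ℝ) (x : ι → ℝ) :
    ∑ v ∈ U, f v * tot S x v = ∑ p, x p * ∑ v ∈ S p, f v := by
  simp only [tot, Finset.mul_sum]
  rw [Finset.sum_comm]
  refine Finset.sum_congr rfl fun p _ => ?_
  rw [← Finset.sum_subset (hS p)]
  · exact Finset.sum_congr rfl fun v hv => by rw [if_pos hv, mul_comm]
  · intro v _ hv
    rw [if_neg hv, mul_zero]

theorem sum_tot {U : Finset V} (hS : ∀ p, S p ⊆ U) {k : ℕ} (hk : ∀ p, (S p).card = k)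
    (x : ι → ℝ) : ∑ v ∈ U, tot S x v = k * ∑ p, x p := by
  have := sum_mul_tot hS (fun _ => 1) x
  simp only [one_mul, Finset.sum_const, hk, nsmul_eq_mul, mul_one] at this
  rw [this, ← Finset.sum_mul, mul_comm]

theorem exists_least_squares {U : Finset V} (hS : ∀ p, S p ⊆ U) {C : ℝ} (hC : 0 ≤ C) :
    ∃ x : ι → ℝ, (∀ p, 0 ≤ x p ∧ x p ≤ C) ∧
      C * ∑ p, max 0 (∑ v ∈ S p, (1 - tot S x v)) ≤
        ∑ v ∈ U, ((1 - tot S x v) - (1 - tot S x v) ^ 2) := by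
  have hcont : Continuous fun x : ι → ℝ => ∑ v ∈ U, (1 - tot S x v) ^ 2 := by
    unfold tot
    refine continuous_finsetSum _ fun v _ => (continuous_const.sub
      (continuous_finsetSum _ fun p _ => ?_)).pow 2
    split_ifs
    · exact continuous_apply p
    · exact continuous_const
  obtain ⟨x, hx, hmin⟩ := (isCompact_Icc (a := (0 : ι → ℝ)) (b := fun _ => C)).exists_isMinOn
    ⟨0, le_rfl, fun _ => hC⟩ hcont.continuousOn
  refine ⟨x, fun p => ⟨hx.1 p, hx.2 p⟩, ?_⟩
  classical
  set u : V → ℝ := fun v => 1 - tot S x v with hu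
  set y : ι → ℝ := fun p => if 0 < ∑ v ∈ S p, u v then C else 0 with hy
  have hyC : y ∈ Set.Icc (0 : ι → ℝ) (fun _ => C) :=
    ⟨fun p => by simp only [hy, Pi.zero_apply]; split_ifs <;> simp [hC],
      fun p => by simp only [hy]; split_ifs <;> simp [hC]⟩
  have hlin : ∀ (e : ℝ) (v : V), tot S (fun p => (1 - e) * x p + e * y p) v =
      (1 - e) * tot S x v + e * tot S y v := by
    intro e v
    simp only [tot, Finset.mul_sum]
    rw [← Finset.sum_add_distrib]
    exact Finset.sum_congr rfl fun p _ => by split_ifs <;> simp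
  set a := ∑ v ∈ U, u v * (tot S y v - tot S x v) with ha
  set b := ∑ v ∈ U, (tot S y v - tot S x v) ^ 2 with hb
  have hb0 : 0 ≤ b := Finset.sum_nonneg fun v _ => sq_nonneg _
  have hquad : ∀ e : ℝ, 0 < e → e ≤ 1 → 2 * a ≤ e * b := by
    intro e he0 he1
    have hmem : (fun p => (1 - e) * x p + e * y p) ∈ Set.Icc (0 : ι → ℝ) (fun _ => C) := by
      refine ⟨fun p => ?_, fun p => ?_⟩
      · have h1 := mul_nonneg (sub_nonneg.2 he1) (hx.1 p)
        have h2 := mul_nonneg he0.le (hyC.1 p)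
        simp only [Pi.zero_apply] at h1 h2 ⊢
        linarith
      · have h1 := mul_le_mul_of_nonneg_left (hx.2 p) (sub_nonneg.2 he1)
        have h2 := mul_le_mul_of_nonneg_left (hyC.2 p) he0.le
        simp only at h1 h2 ⊢
        linarith
    have h := hmin hmem
    simp only [Set.mem_ofPred_eq, hlin] at h
    have e1 : ∑ v ∈ U, (1 - ((1 - e) * tot S x v + e * tot S y v)) ^ 2 =
        ∑ v ∈ U, (1 - tot S x v) ^ 2 - 2 * e * a + e ^ 2 * b := by
      rw [ha, hb, Finset.mul_sum, Finset.mul_sum, ← Finset.sum_sub_distrib,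
        ← Finset.sum_add_distrib]
      exact Finset.sum_congr rfl fun v _ => by rw [hu]; ring
    rw [e1] at h
    refine le_of_mul_le_mul_left ?_ he0
    linarith
  have ha0 : a ≤ 0 := by
    by_contra! hpos
    have h1 := hquad 1 one_pos le_rfl
    have h2 := hquad (a / b) (div_pos hpos (by linarith)) (by
      rw [div_le_one (by linarith)]; linarith)
    rw [div_mul_cancel₀ _ (by linarith)] at h2
    linarith
  have e1 : C * ∑ p, max 0 (∑ v ∈ S p, u v) = ∑ v ∈ U, u v * tot S y v := by
    rw [sum_mul_tot hS, Finset.mul_sum]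
    refine Finset.sum_congr rfl fun p _ => ?_
    simp only [hy]
    split_ifs with h
    · rw [max_eq_right h.le]
    · rw [max_eq_left (not_lt.1 h)]; simp
  have e2 : ∑ v ∈ U, (u v - u v ^ 2) = ∑ v ∈ U, u v * tot S x v :=
    Finset.sum_congr rfl fun v _ => by rw [hu]; ring
  rw [e1, e2]
  have : a = ∑ v ∈ U, u v * tot S y v - ∑ v ∈ U, u v * tot S x v := by
    rw [ha, ← Finset.sum_sub_distrib]
    exact Finset.sum_congr rfl fun v _ => by ring
  linarith

/-- Scaling a fractional tiling down so that no vertex is overloaded. -/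
theorem exists_scaling {U : Finset V} (hS : ∀ p, S p ⊆ U) {k : ℕ} (hk : ∀ p, (S p).card = k)
    {x : ι → ℝ} (hx : ∀ p, 0 ≤ x p) :
    ∃ y : ι → ℝ, (∀ p, 0 ≤ y p ∧ y p ≤ x p) ∧ (∀ v, tot S y v ≤ 1) ∧
      ∑ v ∈ U, (1 - tot S y v) ≤ (k + 1) * ∑ v ∈ U, |1 - tot S x v| := by
  set s : V → ℝ := fun v => max 0 (tot S x v - 1) with hs
  have hs0 : ∀ v, 0 ≤ s v := fun v => le_max_left _ _
  set M : ι → ℝ := fun p => 1 + ∑ v ∈ S p, s v with hM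
  have hM1 : ∀ p, 1 ≤ M p := fun p => by
    have := Finset.sum_nonneg fun v (_ : v ∈ S p) => hs0 v
    simp only [hM]; linarith
  have hMs : ∀ p, ∀ v ∈ S p, 1 + s v ≤ M p := fun p v hv => by
    have := Finset.single_le_sum (fun v (_ : v ∈ S p) => hs0 v) hv
    simp only [hM]; linarith
  have hMpos : ∀ p, 0 < M p := fun p => lt_of_lt_of_le one_pos (hM1 p)
  have hspos : ∀ v, 0 < 1 + s v := fun v => by linarith [hs0 v]
  refine ⟨fun p => x p / M p, fun p => ⟨div_nonneg (hx p) (hMpos p).le,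
    div_le_self (hx p) (hM1 p)⟩, ?_, ?_⟩
  · intro v
    have h1 : tot S (fun p => x p / M p) v ≤ tot S x v / (1 + s v) := by
      unfold tot
      rw [Finset.sum_div]
      refine Finset.sum_le_sum fun p _ => ?_
      split_ifs with h
      · exact div_le_div_of_nonneg_left (hx p) (hspos v) (hMs p v h)
      · simp
    refine h1.trans ((div_le_one (hspos v)).2 ?_)
    have := le_max_right 0 (tot S x v - 1)
    simp only [hs]; linarith
  · have h1 : ∑ p, (x p - x p / M p) ≤ ∑ v ∈ U, s v := by
      have e : ∑ v ∈ U, s v / (1 + s v) * tot S x v ≤ ∑ v ∈ U, s v := by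
        refine Finset.sum_le_sum fun v _ => ?_
        rcases le_total (tot S x v) 1 with h | h
        · have : s v = 0 := max_eq_left (by linarith)
          simp [this]
        · have : s v = tot S x v - 1 := max_eq_right (by linarith)
          have e2 : 1 + s v = tot S x v := by rw [this]; ring
          rw [e2, div_mul_cancel₀ _ (by linarith)]
      rw [sum_mul_tot hS] at e
      refine le_trans (Finset.sum_le_sum fun p _ => ?_) e
      have e3 : x p - x p / M p = x p * ((∑ v ∈ S p, s v) / M p) := by
        have := (hMpos p).ne'
        field_simp
        simp only [hM]; ring
      rw [e3, Finset.sum_div]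
      refine mul_le_mul_of_nonneg_left (Finset.sum_le_sum fun v hv => ?_) (hx p)
      exact div_le_div_of_nonneg_left (hs0 v) (hspos v) (hMs p v hv)
    have h2 : ∑ v ∈ U, s v ≤ ∑ v ∈ U, |1 - tot S x v| :=
      Finset.sum_le_sum fun v _ => max_le (abs_nonneg _) (by rw [abs_sub_comm]; exact le_abs_self _)
    have h4 : ∑ v ∈ U, (1 - tot S x v) ≤ ∑ v ∈ U, |1 - tot S x v| :=
      Finset.sum_le_sum fun v _ => le_abs_self _
    have e4 : ∑ v ∈ U, (1 - tot S (fun p => x p / M p) v) =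
        ∑ v ∈ U, (1 - tot S x v) + k * ∑ p, (x p - x p / M p) := by
      rw [Finset.sum_sub_distrib, Finset.sum_sub_distrib, sum_tot hS hk, sum_tot hS hk,
        Finset.sum_sub_distrib]
      ring
    rw [e4]
    have := mul_le_mul_of_nonneg_left (h1.trans h2) (Nat.cast_nonneg (α := ℝ) k)
    linarith

end LeastSquares

/-! ### From heavy edges to heavy tiles -/

section HeavyTiles

/-- The edge `abc` inside `U` is heavy for the weight `u`, with `c` counted twice. -/
def Heavy {V : Type} [DecidableEq V] (H : Finset (Finset V)) (U : Finset V) (u : V → ℝ) (δ : ℝ)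
    (a b c : V) : Prop :=
  a ∈ U ∧ b ∈ U ∧ c ∈ U ∧ Tri H a b c ∧ δ < u a + u b + 2 * u c

theorem cnt_heavy_tiles_ge {t : ℕ} (ht : 0 < t) {ξ : ℝ} (hξ : 0 < ξ) : ∃ n₀ : ℕ,
    ∀ (V : Type) [Fintype V] [DecidableEq V] (H : Finset (Finset V)) (U : Finset V) (u : V → ℝ)
      (δ : ℝ), n₀ ≤ Fintype.card V →
      ξ * (Fintype.card V : ℝ) ^ 3 ≤
        cnt (fun x : V × V × V => Heavy H U u δ x.2.1 x.2.2 x.1) →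
      (ξ ^ 2) ^ t ^ 4 / 2 * (Fintype.card V : ℝ) ^ (4 * t) ≤
        cnt (fun φ : Fin 4 → Fin t → V => (Tile H t φ ∧ ∀ i j, φ i j ∈ U) ∧
          t * δ < ∑ i, ∑ j, u (φ i j)) := by
  set c := (ξ ^ 2) ^ t ^ 4 with hc
  have hc0 : 0 < c := by positivity
  obtain ⟨n₀, hn₀⟩ := exists_nat_ge ((4 * t : ℝ) ^ 2 * 2 / c)
  refine ⟨n₀ + 1, fun V _ _ H U u δ hn h => ?_⟩
  have h1 := cnt_blowup_one (fun (x : V) (y : V × V) => Heavy H U u δ y.1 y.2 x) 2 hξ.le (by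
    simpa [pow_succ, mul_assoc] using h)
  set R : (Fin 4 → V) → Prop := fun q =>
    (∀ i, q i ∈ U) ∧ Tri H (q 0) (q 1) (q 2) ∧ Tri H (q 0) (q 1) (q 3) ∧ δ < ∑ i, u (q i) with hR
  have h2 : ξ ^ 2 * Fintype.card ((Fin 4 → V) × Unit) ≤
      cnt (fun x : (Fin 4 → V) × Unit => R x.1) := by
    have e : (Fintype.card ((Fin 4 → V) × Unit) : ℝ) =
        Fintype.card ((Fin 2 → V) × V × V) := by
      simp; ring
    rw [e]
    refine h1.trans (cnt_le_of_injective (fun x => (![x.2.1, x.2.2, x.1 0, x.1 1], ())) ?_ ?_)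
    · rintro ⟨f, a, b⟩ ⟨f', a', b'⟩ e
      simp only [Prod.mk.injEq, and_true] at e
      have e0 := congrFun e 0
      have e1 := congrFun e 1
      have e2 := congrFun e 2
      have e3 := congrFun e 3
      simp at e0 e1 e2 e3
      have : f = f' := by
        funext j
        fin_cases j
        · exact e2
        · exact e3
      rw [this, e0, e1]
    · rintro ⟨f, a, b⟩ hx
      obtain ⟨p1, p2, p3, p4, p5⟩ := hx 0
      obtain ⟨-, -, q3, q4, q5⟩ := hx 1
      refine ⟨?_, p4, q4, ?_⟩
      · intro i
        fin_cases i
        · exact p1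
        · exact p2
        · exact p3
        · exact q3
      · simp only [Fin.sum_univ_four]
        simp
        simp only at p5 q5
        linarith
  have h3 := cnt_blowup t 4 (fun (q : Fin 4 → V) (_ : Unit) => R q) (by positivity) h2
  have h4 : cnt (fun x : (Fin 4 → Fin t → V) × Unit =>
      ∀ σ : Fin 4 → Fin t, R (fun i => x.1 i (σ i))) ≤
      cnt (fun φ : Fin 4 → Fin t → V => ∀ σ : Fin 4 → Fin t, R (fun i => φ i (σ i))) :=
    cnt_le_of_injective Prod.fst (fun x y e => Prod.ext e rfl) fun x hx => hx
  have e1 : (Fintype.card ((Fin 4 → Fin t → V) × Unit) : ℝ) =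
      (Fintype.card V : ℝ) ^ (4 * t) := by
    simp [pow_mul, mul_comm 4 t]
  rw [e1, ← hc] at h3
  have h5 : cnt (fun φ : Fin 4 → Fin t → V => ∀ σ : Fin 4 → Fin t, R (fun i => φ i (σ i))) ≤
      cnt (fun φ : Fin 4 → Fin t → V => (Tile H t φ ∧ ∀ i j, φ i j ∈ U) ∧
          t * δ < ∑ i, ∑ j, u (φ i j)) +
      cnt (fun φ : Fin 4 → Fin t → V =>
        ¬ Function.Injective (fun x : Fin 4 × Fin t => φ x.1 x.2)) := by
    refine cnt_le_add fun φ hφ => ?_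
    by_cases hi : Function.Injective (fun x : Fin 4 × Fin t => φ x.1 x.2)
    · refine Or.inl ⟨⟨⟨hi, fun j l m => ?_⟩, fun i j => (hφ fun _ => j).1 i⟩, ?_⟩
      · have g1 := (hφ ![j, l, m, m]).2.1
        have g2 := (hφ ![j, l, m, m]).2.2.1
        exact ⟨g1, g2⟩
      · rw [Finset.sum_comm]
        have : (t : ℝ) * δ = ∑ _j : Fin t, δ := by simp
        rw [this]
        exact Finset.sum_lt_sum_of_nonempty ⟨⟨0, ht⟩, Finset.mem_univ _⟩
          fun j _ => (hφ fun _ => j).2.2.2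
    · exact Or.inr hi
  have h6 : cnt (fun φ : Fin 4 → Fin t → V =>
        ¬ Function.Injective (fun x : Fin 4 × Fin t => φ x.1 x.2)) * Fintype.card V ≤
      (4 * t : ℝ) ^ 2 * (Fintype.card V : ℝ) ^ (4 * t) := by
    have := cnt_not_injective_le (ι := Fin 4 × Fin t) (V := V)
    rw [← cnt_equiv (Equiv.curry (Fin 4) (Fin t) V).symm] at this
    simp only [Equiv.curry_symm_apply, Function.uncurry_def] at this
    simpa using this
  have hV : (n₀ : ℝ) + 1 ≤ Fintype.card V := by exact_mod_cast hn
  have hpos : (0 : ℝ) < Fintype.card V := lt_of_lt_of_le (by positivity) hV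
  set n : ℝ := ((Fintype.card V : ℕ) : ℝ) with hndef
  have h7 : (4 * t : ℝ) ^ 2 ≤ c / 2 * n := by
    rw [div_le_iff₀ hc0] at hn₀
    have := mul_le_mul_of_nonneg_left (show (n₀ : ℝ) ≤ n by linarith) hc0.le
    linarith
  have h8 : cnt (fun φ : Fin 4 → Fin t → V =>
        ¬ Function.Injective (fun x : Fin 4 × Fin t => φ x.1 x.2)) ≤ c / 2 * n ^ (4 * t) := by
    refine le_of_mul_le_mul_right ?_ hpos
    have := mul_le_mul_of_nonneg_right h7 (show 0 ≤ n ^ (4 * t) by positivity)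
    linarith
  linarith

end HeavyTiles

/-! ### Few heavy edges force a nearly independent set -/

theorem exists_level {V : Type} [Fintype V] {U : Finset V} {u : V → ℝ} {ε : ℝ}
    (hu : ∀ v, u v ≤ 1) (hε : 0 < ε)
    (hV : 0 < Fintype.card V) (hsum : ε * Fintype.card V ≤ ∑ v ∈ U, u v) :
    ∃ q, ε / 2 ≤ q ∧ q ≤ 1 ∧ ε / 2 * Fintype.card V ≤ (U.filter fun v => q ≤ u v).card ∧
      ((U.filter fun v => q < u v).card : ℝ) ≤ ε / 2 * Fintype.card V := by
  set n : ℝ := ((Fintype.card V : ℕ) : ℝ) with hndef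
  have hn : 0 < n := Nat.cast_pos.2 hV
  have hUn : (U.card : ℝ) ≤ n := Nat.cast_le.2 (Finset.card_le_univ U)
  have h1 : ε / 2 * n ≤ (U.filter fun v => ε / 2 ≤ u v).card := by
    have : ∑ v ∈ U, u v ≤ ∑ v ∈ U, ((if ε / 2 ≤ u v then 1 else 0) + ε / 2) := by
      refine Finset.sum_le_sum fun v _ => ?_
      split_ifs with h
      · linarith [hu v]
      · linarith
    rw [Finset.sum_add_distrib, Finset.sum_boole, Finset.sum_const, nsmul_eq_mul] at this
    have := mul_le_mul_of_nonneg_right hUn hε.le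
    linarith
  set K := U.filter fun v => ε / 2 * n ≤ (U.filter fun w => u v ≤ u w).card with hK
  have hpos : 0 < ε / 2 * n := by positivity
  have hL : (U.filter fun v => ε / 2 ≤ u v).Nonempty := by
    rw [← Finset.card_pos, ← Nat.cast_pos (α := ℝ)]; linarith
  obtain ⟨v₀, hv₀, hmin⟩ := Finset.exists_min_image _ u hL
  rw [Finset.mem_filter] at hv₀
  have hv₀K : v₀ ∈ K := by
    rw [hK, Finset.mem_filter]
    refine ⟨hv₀.1, h1.trans (Nat.cast_le.2 (Finset.card_le_card fun w hw => ?_))⟩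
    exact Finset.mem_filter.2 ⟨(Finset.mem_filter.1 hw).1, hmin w hw⟩
  obtain ⟨v₁, hv₁, hmax⟩ := Finset.exists_max_image K u ⟨v₀, hv₀K⟩
  refine ⟨u v₁, hv₀.2.trans (hmax v₀ hv₀K), hu _, (Finset.mem_filter.1 hv₁).2, ?_⟩
  by_contra! hgt
  have hne : (U.filter fun v => u v₁ < u v).Nonempty := by
    rw [← Finset.card_pos, ← Nat.cast_pos (α := ℝ)]; linarith
  obtain ⟨v₂, hv₂, hmin₂⟩ := Finset.exists_min_image _ u hne
  have hv₂K : v₂ ∈ K := by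
    rw [hK, Finset.mem_filter]
    refine ⟨(Finset.mem_filter.1 hv₂).1, hgt.le.trans (Nat.cast_le.2
      (Finset.card_le_card fun w hw => ?_))⟩
    exact Finset.mem_filter.2 ⟨(Finset.mem_filter.1 hw).1, hmin₂ w hw⟩
  exact absurd (hmax v₂ hv₂K) (not_le.2 (Finset.mem_filter.1 hv₂).2)

section FewHeavy

variable {V : Type} [DecidableEq V] [Fintype V] {H : Finset (Finset V)}

theorem cnt_mem (B : Finset V) : cnt (fun v => v ∈ B) = B.card := by
  rw [cnt_eq_card']; simp

/-- The number of ordered edges inside `B`. -/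
noncomputable def ordEdges (H : Finset (Finset V)) (B : Finset V) : ℝ :=
  cnt (fun x : V × V × V => (x.1 ∈ B ∧ x.2.1 ∈ B ∧ x.2.2 ∈ B) ∧ Tri H x.1 x.2.1 x.2.2)

theorem exists_set_of_card (B₀ : Finset V) {κ ξ : ℝ} (hκ : 0 ≤ κ)
    (hB₀ : (3 / 4 - κ) * Fintype.card V ≤ B₀.card)
    (he : ordEdges H B₀ ≤ ξ * (Fintype.card V : ℝ) ^ 3) :
    ∃ B : Finset V, B.card = 3 * Fintype.card V / 4 ∧
      ordEdges H B ≤ (ξ + 3 * κ) * (Fintype.card V : ℝ) ^ 3 := by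
  have hκ3 : 0 ≤ 3 * κ * (Fintype.card V : ℝ) ^ 3 := by positivity
  rcases le_total (3 * Fintype.card V / 4) B₀.card with h | h
  · obtain ⟨B, hB, hBc⟩ := Finset.exists_subset_card_eq h
    refine ⟨B, hBc, ?_⟩
    have : ordEdges H B ≤ ordEdges H B₀ :=
      cnt_mono fun x hx => ⟨⟨hB hx.1.1, hB hx.1.2.1, hB hx.1.2.2⟩, hx.2⟩
    linarith
  · obtain ⟨B, hB, -, hBc⟩ := Finset.exists_subsuperset_card_eq (Finset.subset_univ B₀) h
      (by rw [Finset.card_univ]; omega)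
    refine ⟨B, hBc, ?_⟩
    set n : ℝ := ((Fintype.card V : ℕ) : ℝ) with hndef
    have hn : 0 ≤ n := Nat.cast_nonneg _
    have hd : cnt (fun v => v ∈ B \ B₀) ≤ κ * n := by
      rw [cnt_mem, Finset.card_sdiff_of_subset hB, Nat.cast_sub (Finset.card_le_card hB), hBc]
      have : ((3 * Fintype.card V / 4 : ℕ) : ℝ) ≤ 3 / 4 * n := by
        have := Nat.cast_div_le (α := ℝ) (m := 3 * Fintype.card V) (n := 4)
        push_cast at this
        linarith
      linarith
    have c1 : cnt (fun x : V × V × V => x.1 ∈ B \ B₀ ∧ True) =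
        cnt (fun v => v ∈ B \ B₀) * cnt (fun _ : V × V => True) :=
      cnt_prod_and (fun v => v ∈ B \ B₀) (fun _ => True)
    have c2 : cnt (fun x : V × V × V => True ∧ (x.2.1 ∈ B \ B₀ ∧ True)) =
        cnt (fun _ : V => True) * cnt (fun x : V × V => x.1 ∈ B \ B₀ ∧ True) :=
      cnt_prod_and (fun _ => True) (fun x : V × V => x.1 ∈ B \ B₀ ∧ True)
    have c3 : cnt (fun x : V × V × V => True ∧ (True ∧ x.2.2 ∈ B \ B₀)) =
        cnt (fun _ : V => True) * cnt (fun x : V × V => True ∧ x.2 ∈ B \ B₀) :=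
      cnt_prod_and (fun _ => True) (fun x : V × V => True ∧ x.2 ∈ B \ B₀)
    rw [cnt_prod_and (fun v => v ∈ B \ B₀) (fun _ : V => True)] at c2
    rw [cnt_prod_and (fun _ : V => True) (fun v => v ∈ B \ B₀)] at c3
    rw [cnt_true] at c1 c2 c3
    rw [Fintype.card_prod, Nat.cast_mul] at c1
    have hall : ordEdges H B ≤ ordEdges H B₀ +
        (cnt (fun x : V × V × V => x.1 ∈ B \ B₀ ∧ True) +
        (cnt (fun x : V × V × V => True ∧ (x.2.1 ∈ B \ B₀ ∧ True)) +
        cnt (fun x : V × V × V => True ∧ (True ∧ x.2.2 ∈ B \ B₀)))) := by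
      have k1 := cnt_or_le (fun x : V × V × V => True ∧ (x.2.1 ∈ B \ B₀ ∧ True))
        (fun x : V × V × V => True ∧ (True ∧ x.2.2 ∈ B \ B₀))
      have k2 := cnt_or_le (fun x : V × V × V => x.1 ∈ B \ B₀ ∧ True)
        (fun x : V × V × V => (True ∧ (x.2.1 ∈ B \ B₀ ∧ True)) ∨ (True ∧ (True ∧ x.2.2 ∈ B \ B₀)))
      have k3 : ordEdges H B ≤ ordEdges H B₀ +
          cnt (fun x : V × V × V => (x.1 ∈ B \ B₀ ∧ True) ∨
            ((True ∧ (x.2.1 ∈ B \ B₀ ∧ True)) ∨ (True ∧ (True ∧ x.2.2 ∈ B \ B₀)))) := by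
        refine cnt_le_add fun x hx => ?_
        simp only [Finset.mem_sdiff]
        have := hx.1
        have := hx.2
        tauto
      linarith
    have := mul_le_mul_of_nonneg_right hd (sq_nonneg n)
    rw [c1, c2, c3] at hall
    linarith

theorem exists_sparse_of_few_heavy {U : Finset V} {u : V → ℝ} {ε ρ γ ξ : ℝ}
    (hV : 0 < Fintype.card V) (hε : 0 < ε) (hε1 : ε < 1) (hρ : 0 ≤ ρ) (hγ : 0 ≤ γ) (hξ : 0 ≤ ξ)
    (hlink : ∀ v, (7 / 16 - γ) * (Fintype.card V : ℝ) ^ 2 ≤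
      cnt (fun p : V × V => Tri H v p.1 p.2))
    (hU : (1 - ρ) * Fintype.card V ≤ U.card) (hu : ∀ v, u v ≤ 1)
    (hsum : ε * Fintype.card V ≤ ∑ v ∈ U, u v)
    (hheavy : cnt (fun x : V × V × V => Heavy H U u (ε ^ 2) x.2.1 x.2.2 x.1) ≤
      ξ * (Fintype.card V : ℝ) ^ 3) :
    ∃ B : Finset V, B.card = 3 * Fintype.card V / 4 ∧ ordEdges H B ≤
      (ξ + 3 * (ρ + 100 * (γ + 2 * ρ + 2 * ξ / ε))) * (Fintype.card V : ℝ) ^ 3 := by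
  obtain ⟨q, hq0, hq1, hge, hgt⟩ := exists_level hu hε hV hsum
  set n : ℝ := ((Fintype.card V : ℕ) : ℝ) with hndef
  have hn : 0 < n := Nat.cast_pos.2 hV
  have hUn : (U.card : ℝ) ≤ n := Nat.cast_le.2 (Finset.card_le_univ U)
  have hqpos : 0 < q := by linarith
  have hnU : cnt (fun v => v ∉ U) ≤ ρ * n := by
    have h1 := cnt_add_cnt_not (fun v => v ∈ U)
    rw [cnt_mem] at h1
    linarith
  -- the vertex
  obtain ⟨v, hvU, hvq, hvH⟩ : ∃ v ∈ U, q ≤ u v ∧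
      cnt (fun p : V × V => Heavy H U u (ε ^ 2) p.1 p.2 v) ≤ 2 * ξ / ε * n ^ 2 := by
    by_contra! hcon
    set L := U.filter fun v => q ≤ u v with hL
    have hLne : L.Nonempty := by
      rw [← Finset.card_pos, ← Nat.cast_pos (α := ℝ)]
      exact lt_of_lt_of_le (by positivity) hge
    have h1 : ∑ v ∈ L, 2 * ξ / ε * n ^ 2 <
        ∑ v ∈ L, cnt (fun p : V × V => Heavy H U u (ε ^ 2) p.1 p.2 v) :=
      Finset.sum_lt_sum_of_nonempty hLne fun v hv => hcon v (Finset.mem_filter.1 hv).1 (Finset.mem_filter.1 hv).2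
    have h2 : ∑ v ∈ L, cnt (fun p : V × V => Heavy H U u (ε ^ 2) p.1 p.2 v) ≤
        cnt (fun x : V × V × V => Heavy H U u (ε ^ 2) x.2.1 x.2.2 x.1) := by
      rw [cnt_prod]
      exact Finset.sum_le_sum_of_subset_of_nonneg (Finset.subset_univ _)
        fun v _ _ => cnt_nonneg _
    rw [Finset.sum_const, nsmul_eq_mul] at h1
    have h3 : ε / 2 * n * (2 * ξ / ε * n ^ 2) ≤ L.card * (2 * ξ / ε * n ^ 2) :=
      mul_le_mul_of_nonneg_right hge (by positivity)
    have h4 : ε / 2 * n * (2 * ξ / ε * n ^ 2) = ξ * n ^ 3 := by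
      field_simp
    linarith
  set m : V → ℝ := fun a => min (u a / q) 1 with hm
  set w : V → ℝ := fun a => if a ∈ U then (1 - m a) / (4 * (1 - ε / 2)) else 0 with hw
  have hεpos : 0 < 4 * (1 - ε / 2) := by linarith
  have hm1 : ∀ a, m a ≤ 1 := fun a => min_le_right _ _
  have hw0 : ∀ a, 0 ≤ w a := fun a => by
    simp only [hw]
    split_ifs
    · exact div_nonneg (by linarith [hm1 a]) hεpos.le
    · exact le_rfl
  have hmsum : ε / 2 * n ≤ ∑ a ∈ U, m a := by
    have h1 : ∑ a ∈ U, u a ≤ ∑ a ∈ U, (q * m a + if q < u a then 1 else 0) := by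
      refine Finset.sum_le_sum fun a _ => ?_
      simp only [hm]
      split_ifs with h
      · rw [min_eq_right ((one_le_div hqpos).2 h.le)]; linarith [hu a]
      · rw [min_eq_left ((div_le_one hqpos).2 (not_lt.1 h)), mul_div_cancel₀ _ hqpos.ne']
        linarith
    rw [Finset.sum_add_distrib, Finset.sum_boole, ← Finset.mul_sum] at h1
    have h2 : ε / 2 * n ≤ q * ∑ a ∈ U, m a := by linarith
    have h3 : 0 ≤ ∑ a ∈ U, m a := by
      by_contra! hneg
      have := mul_neg_of_pos_of_neg hqpos hneg
      have : 0 < ε / 2 * n := by positivity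
      linarith
    have := mul_le_mul_of_nonneg_right hq1 h3
    linarith
  have hwsum : ∑ a, w a ≤ 1 / 4 * n := by
    have e : ∑ a, w a = (U.card - ∑ a ∈ U, m a) / (4 * (1 - ε / 2)) := by
      simp only [hw]
      rw [Finset.sum_ite_mem, Finset.univ_inter, ← Finset.sum_div, Finset.sum_sub_distrib]
      simp
    rw [e, div_le_iff₀ hεpos]
    linarith
  have hpairs : (7 / 16 - (γ + 2 * ρ + 2 * ξ / ε)) * n ^ 2 ≤
      cnt (fun p : V × V => 1 ≤ w p.1 + w p.2) := by
    have h1 : cnt (fun p : V × V => Tri H v p.1 p.2) ≤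
        cnt (fun p : V × V => 1 ≤ w p.1 + w p.2) +
          (cnt (fun p : V × V => Heavy H U u (ε ^ 2) p.1 p.2 v) +
          (cnt (fun p : V × V => p.1 ∉ U ∧ True) + cnt (fun p : V × V => True ∧ p.2 ∉ U))) := by
      have k1 := cnt_or_le (fun p : V × V => p.1 ∉ U ∧ True) (fun p : V × V => True ∧ p.2 ∉ U)
      have k2 := cnt_or_le (fun p : V × V => Heavy H U u (ε ^ 2) p.1 p.2 v)
        (fun p : V × V => (p.1 ∉ U ∧ True) ∨ (True ∧ p.2 ∉ U))
      have k3 : cnt (fun p : V × V => Tri H v p.1 p.2) ≤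
          cnt (fun p : V × V => 1 ≤ w p.1 + w p.2) +
          cnt (fun p : V × V => Heavy H U u (ε ^ 2) p.1 p.2 v ∨
            (p.1 ∉ U ∧ True) ∨ (True ∧ p.2 ∉ U)) := by
        refine cnt_le_add fun p hp => ?_
        by_cases a1 : p.1 ∈ U
        · by_cases a2 : p.2 ∈ U
          · by_cases a3 : Heavy H U u (ε ^ 2) p.1 p.2 v
            · exact Or.inr (Or.inl a3)
            · refine Or.inl ?_
              have a4 : u p.1 + u p.2 + 2 * u v ≤ ε ^ 2 := by
                by_contra! hlt
                exact a3 ⟨a1, a2, hvU, hp.rotate, hlt⟩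
              simp only [hw, if_pos a1, if_pos a2]
              rw [← add_div, le_div_iff₀ hεpos]
              have b1 : m p.1 ≤ u p.1 / q := min_le_left _ _
              have b2 : m p.2 ≤ u p.2 / q := min_le_left _ _
              have b3 : u p.1 / q + u p.2 / q ≤ 2 * ε - 2 := by
                rw [← add_div, div_le_iff₀ hqpos]
                have := mul_le_mul_of_nonneg_left hq0 hε.le
                linarith
              linarith
          · exact Or.inr (Or.inr (Or.inr ⟨trivial, a2⟩))
        · exact Or.inr (Or.inr (Or.inl ⟨a1, trivial⟩))
      linarith
    rw [cnt_prod_and (fun v => v ∉ U) (fun _ => True),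
      cnt_prod_and (fun _ : V => True) (fun v => v ∉ U), cnt_true, ← hndef] at h1
    have h2 := mul_le_mul_of_nonneg_right hnU hn.le
    have h3 := hlink v
    linarith
  have hM7 := cnt_le_of_threshold w hw0 hwsum hpairs
  set B₀ := U.filter fun a => w a < 1 / 8 with hB₀
  refine exists_set_of_card B₀ (by positivity) ?_ (le_trans ?_ hheavy)
  · have h1 := cnt_add_cnt_not (fun a => 1 / 8 ≤ w a)
    have h2 : cnt (fun a => ¬ 1 / 8 ≤ w a) ≤ cnt (fun a => a ∈ B₀) + cnt (fun a => a ∉ U) :=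
      cnt_le_add fun a ha => by
        by_cases haU : a ∈ U
        · exact Or.inl (Finset.mem_filter.2 ⟨haU, not_le.1 ha⟩)
        · exact Or.inr haU
    rw [cnt_mem] at h2
    linarith
  · have hB : ∀ a ∈ B₀, a ∈ U ∧ q / 2 < u a := by
      intro a ha
      obtain ⟨ha, haw⟩ := Finset.mem_filter.1 ha
      refine ⟨ha, ?_⟩
      simp only [hw, if_pos ha] at haw
      rw [div_lt_iff₀ hεpos] at haw
      have h1 : 1 / 2 < m a := by linarith
      have h2 := lt_of_lt_of_le h1 (min_le_left _ _)
      rw [lt_div_iff₀ hqpos] at h2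
      linarith
    refine cnt_mono fun x hx => ?_
    obtain ⟨⟨h1, h2, h4⟩, h5⟩ := hx
    obtain ⟨h1, k1⟩ := hB _ h1
    obtain ⟨h2, k2⟩ := hB _ h2
    obtain ⟨h4, k4⟩ := hB _ h4
    refine ⟨h2, h4, h1, h5.rotate, ?_⟩
    have : ε ^ 2 ≤ ε := by
      rw [sq]; exact mul_le_of_le_one_left hε.le hε1.le
    linarith

end FewHeavy

/-! ### Almost perfect fractional tilings -/

section Fractional

theorem cnt_subtype_le {α : Type} [Fintype α] {P Q : α → Prop} [Fintype {x // P x}] (hQ : ∀ x, Q x → P x)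
    (f : {x // P x} → ℝ) (hf : ∀ x, 0 ≤ f x) {c : ℝ} (hc : ∀ x, Q x.1 → c ≤ f x) :
    c * cnt Q ≤ ∑ x, f x := by
  classical
  have h1 : cnt Q = ∑ x : {x // P x}, if Q x.1 then (1 : ℝ) else 0 := by
    have := cnt_eq_card' Q
    rw [this, Finset.sum_boole]
    congr 1
    symm
    refine Finset.card_nbij Subtype.val (fun x hx => by simpa using hx) (fun x _ y _ e => Subtype.ext e) ?_
    intro x hx
    have hx : Q x := by simpa using hx
    exact ⟨⟨x, hQ x hx⟩, by simpa using hx, rfl⟩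
  rw [h1, Finset.mul_sum]
  refine Finset.sum_le_sum fun x _ => ?_
  split_ifs with h
  · rw [mul_one]; exact hc x h
  · rw [mul_zero]; exact hf x

/-- An almost perfect fractional tiling with small codegrees. -/
theorem exists_fractional_tiling {β ε ρ γ ξ : ℝ} (hε : 0 < ε) (hε1 : ε < 1) (hρ : 0 ≤ ρ)
    (hγ : 0 ≤ γ) (hξ : 0 < ξ) (hβ : ξ + 3 * (ρ + 100 * (γ + 2 * ρ + 2 * ξ / ε)) ≤ β)
    {t : ℕ} (ht : 0 < t) : ∃ (C : ℝ) (n₀ : ℕ), 0 < C ∧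
    ∀ (V : Type) [Fintype V] [DecidableEq V] (H : Finset (Finset V)) (U : Finset V),
      n₀ ≤ Fintype.card V →
      (∀ v, (7 / 16 - γ) * (Fintype.card V : ℝ) ^ 2 ≤
        cnt (fun p : V × V => Tri H v p.1 p.2)) →
      (∀ B : Finset V, B.card = 3 * Fintype.card V / 4 →
        β * (Fintype.card V : ℝ) ^ 3 < ordEdges H B) →
      (1 - ρ) * Fintype.card V ≤ U.card →
      ∃ (ι : Type) (_ : Fintype ι) (S : ι → Finset V) (y : ι → ℝ),
        (∀ p, ∃ φ, Tile H t φ ∧ (∀ i j, φ i j ∈ U) ∧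
          S p = Finset.univ.image fun x : Fin 4 × Fin t => φ x.1 x.2) ∧
        (∀ p, 0 ≤ y p) ∧ (∀ v, tot S y v ≤ 1) ∧
        ∑ v ∈ U, (1 - tot S y v) ≤ (4 * t + 1) * √ε * Fintype.card V ∧
        ∀ v w, v ≠ w → (∑ p, if v ∈ S p ∧ w ∈ S p then y p else 0) ≤ C / Fintype.card V := by
  obtain ⟨n₀, hn₀⟩ := cnt_heavy_tiles_ge ht hξ
  set c := (ξ ^ 2) ^ t ^ 4 with hc
  have hc0 : 0 < c := by positivity
  have ht0 : (0 : ℝ) < t := Nat.cast_pos.2 ht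
  set C := 1 / (c * t * ε ^ 2) with hC
  have hC0 : 0 < C := by positivity
  refine ⟨C * (4 * t) ^ 2, n₀ + 1, by positivity, ?_⟩
  intro V _ _ H U hn hlink hext hU
  classical
  have hVpos : 0 < Fintype.card V := by omega
  have hnn := hn₀ V H U
  set n : ℝ := ((Fintype.card V : ℕ) : ℝ) with hndef
  have hnpos : 0 < n := Nat.cast_pos.2 hVpos
  set ι := {φ : Fin 4 → Fin t → V // Tile H t φ ∧ ∀ i j, φ i j ∈ U} with hι
  set S : ι → Finset V := fun p => Finset.univ.image fun x : Fin 4 × Fin t => p.1 x.1 x.2 with hS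
  have hSU : ∀ p, S p ⊆ U := by
    intro p v hv
    obtain ⟨x, -, rfl⟩ := Finset.mem_image.1 hv
    exact p.2.2 _ _
  have hScard : ∀ p, (S p).card = 4 * t := by
    intro p
    rw [hS, Finset.card_image_of_injective _ p.2.1.1]
    simp
  have hSsum : ∀ p (f : V → ℝ), ∑ v ∈ S p, f v = ∑ i, ∑ j, f (p.1 i j) := by
    intro p f
    rw [hS, Finset.sum_image fun x _ y _ e => p.2.1.1 e, Fintype.sum_prod_type]
  set cap := C * n / n ^ (4 * t) with hcap
  have hcap0 : 0 < cap := by positivity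
  obtain ⟨x, hx, hmin⟩ := exists_least_squares hSU hcap0.le
  set u : V → ℝ := fun v => 1 - tot S x v with hu
  have hu1 : ∀ v, u v ≤ 1 := fun v => by
    have := tot_nonneg (S := S) (fun p => (hx p).1) v
    simp only [hu]; linarith
  have hUn : (U.card : ℝ) ≤ n := Nat.cast_le.2 (Finset.card_le_univ U)
  have hquarter : ∑ v ∈ U, (u v - u v ^ 2) ≤ n / 4 := by
    have : ∑ v ∈ U, (u v - u v ^ 2) ≤ ∑ _v ∈ U, (1 / 4 : ℝ) :=
      Finset.sum_le_sum fun v _ => by linarith [sq_nonneg (u v - 1 / 2)]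
    rw [Finset.sum_const, nsmul_eq_mul] at this
    linarith
  have hpos_sum : 0 ≤ ∑ v ∈ U, (u v - u v ^ 2) :=
    le_trans (mul_nonneg hcap0.le (Finset.sum_nonneg fun p _ => le_max_left _ _)) hmin
  have hsq : ∑ v ∈ U, u v ^ 2 ≤ ∑ v ∈ U, u v := by
    rw [Finset.sum_sub_distrib] at hpos_sum
    linarith
  have hheavy : cnt (fun x : V × V × V => Heavy H U u (ε ^ 2) x.2.1 x.2.2 x.1) ≤ ξ * n ^ 3 := by
    by_contra! hgt
    have h1 := hnn u (ε ^ 2) (by omega) hgt.le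
    have h2 := cnt_subtype_le (P := fun φ : Fin 4 → Fin t → V => Tile H t φ ∧ ∀ i j, φ i j ∈ U)
      (Q := fun φ => (Tile H t φ ∧ ∀ i j, φ i j ∈ U) ∧ t * ε ^ 2 < ∑ i, ∑ j, u (φ i j))
      (fun φ h => h.1) (fun p => max 0 (∑ v ∈ S p, u v)) (fun p => le_max_left _ _)
      (c := t * ε ^ 2) (fun p hp => by
        refine le_trans ?_ (le_max_right _ _)
        rw [hSsum]
        exact hp.2.le)
    have h3 := (mul_le_mul_of_nonneg_left h2 hcap0.le).trans (hmin.trans hquarter)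
    have h4 := mul_le_mul_of_nonneg_left h1 (show 0 ≤ cap * (t * ε ^ 2) by positivity)
    have h5 : cap * (t * ε ^ 2) * (c / 2 * n ^ (4 * t)) = n / 2 := by
      rw [hcap, hC]
      field_simp
    linarith
  have hsum : ∑ v ∈ U, u v < ε * n := by
    by_contra! hge
    obtain ⟨B, hB, hB2⟩ := exists_sparse_of_few_heavy hVpos hε hε1 hρ hγ hξ.le hlink hU hu1 hge
      hheavy
    have h1 := hext B hB
    have h2 := mul_le_mul_of_nonneg_right hβ (show 0 ≤ n ^ 3 by positivity)
    linarith
  have habs : ∑ v ∈ U, |u v| ≤ √ε * n := by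
    have h1 := sq_sum_le_card_mul_sum_sq (s := U) (f := fun v => |u v|)
    simp only [sq_abs] at h1
    refine le_of_sq_le_sq ?_ (by positivity)
    rw [mul_pow, Real.sq_sqrt hε.le]
    have h2 : (U.card : ℝ) * ∑ v ∈ U, u v ^ 2 ≤ n * (ε * n) :=
      mul_le_mul hUn (by linarith) (Finset.sum_nonneg fun v _ => sq_nonneg _) hnpos.le
    linarith
  obtain ⟨y, hy, hy1, hy2⟩ := exists_scaling hSU hScard fun p => (hx p).1
  refine ⟨ι, inferInstance, S, y, fun p => ⟨p.1, p.2.1, p.2.2, rfl⟩, fun p => (hy p).1, hy1, ?_, ?_⟩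
  · refine hy2.trans ?_
    push_cast
    have := mul_le_mul_of_nonneg_left habs (show (0 : ℝ) ≤ 4 * t + 1 by positivity)
    linarith
  · intro v w hvw
    have h1 : (∑ p, if v ∈ S p ∧ w ∈ S p then y p else 0) ≤
        cap * ∑ p, if v ∈ S p ∧ w ∈ S p then (1 : ℝ) else 0 := by
      rw [Finset.mul_sum]
      refine Finset.sum_le_sum fun p _ => ?_
      split_ifs
      · rw [mul_one]; exact (hy p).2.trans (hx p).2
      · simp
    have h2 : (∑ p : ι, if v ∈ S p ∧ w ∈ S p then (1 : ℝ) else 0) ≤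
        cnt (fun f : Fin 4 × Fin t → V => (∃ i, f i = v) ∧ ∃ j, f j = w) := by
      have : (∑ p : ι, if v ∈ S p ∧ w ∈ S p then (1 : ℝ) else 0) =
          cnt (fun p : ι => v ∈ S p ∧ w ∈ S p) := by
        rw [cnt_eq_card', Finset.sum_boole]
      rw [this]
      refine cnt_le_of_injective (fun p x => p.1 x.1 x.2) ?_ ?_
      · intro p q e
        refine Subtype.ext (funext fun i => funext fun j => ?_)
        exact congrFun e (i, j)
      · rintro p ⟨hv, hw⟩
        obtain ⟨a, -, ha⟩ := Finset.mem_image.1 hv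
        obtain ⟨b, -, hb⟩ := Finset.mem_image.1 hw
        exact ⟨⟨a, ha⟩, b, hb⟩
    have h3 := cnt_two_mem_range_le (ι := Fin 4 × Fin t) hvw
    have e1 : (Fintype.card (Fin 4 × Fin t) : ℝ) = 4 * t := by simp
    have e2 : (Fintype.card (Fin 4 × Fin t → V) : ℝ) = n ^ (4 * t) := by simp [hndef]
    rw [e1, e2] at h3
    rw [le_div_iff₀ hnpos]
    have h4 : cap * cnt (fun f : Fin 4 × Fin t → V => (∃ i, f i = v) ∧ ∃ j, f j = w) * n ^ 2 ≤
        C * (4 * t) ^ 2 * n := by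
      calc _ = cap * (cnt (fun f : Fin 4 × Fin t → V => (∃ i, f i = v) ∧ ∃ j, f j = w) * n ^ 2) := by
            ring
        _ ≤ cap * ((4 * t) ^ 2 * n ^ (4 * t)) := mul_le_mul_of_nonneg_left h3 hcap0.le
        _ = _ := by
            rw [hcap]; field_simp
    have h5 := mul_le_mul_of_nonneg_left h2 hcap0.le
    refine le_of_mul_le_mul_right ?_ hnpos
    have h6 := mul_le_mul_of_nonneg_right (h1.trans h5) (sq_nonneg n)
    linarith

end Fractional

/-! ### From fractional to integral tilings -/

section Greedy

variable {ι V : Type} [Fintype ι] [DecidableEq V] {S : ι → Finset V} {y : ι → ℝ} {U : Finset V}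

theorem sum_mul_sum_ite (hS : ∀ p, y p ≠ 0 → S p ⊆ U) (f : V → ℝ) (g : ι → V → ℝ) :
    ∑ v ∈ U, f v * ∑ p, (if v ∈ S p then y p * g p v else 0) =
      ∑ p, y p * ∑ v ∈ S p, f v * g p v := by
  simp only [Finset.mul_sum]
  rw [Finset.sum_comm]
  refine Finset.sum_congr rfl fun p _ => ?_
  by_cases hp : y p = 0
  · simp [hp]
  rw [← Finset.sum_subset (hS p hp)]
  · exact Finset.sum_congr rfl fun v hv => by rw [if_pos hv]; ring
  · intro v _ hv
    rw [if_neg hv, mul_zero]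

theorem sum_mul_tot_of_support (hS : ∀ p, y p ≠ 0 → S p ⊆ U) (f : V → ℝ) :
    ∑ v ∈ U, f v * tot S y v = ∑ p, y p * ∑ v ∈ S p, f v := by
  have := sum_mul_sum_ite hS f fun _ _ => 1
  simpa [tot] using this

theorem sum_tot_eq_sum_card (A : Finset V) :
    ∑ v ∈ A, tot S y v = ∑ p, y p * ((A ∩ S p).card : ℝ) := by
  simp only [tot]
  rw [Finset.sum_comm]
  refine Finset.sum_congr rfl fun p _ => ?_
  rw [← Finset.sum_filter, Finset.sum_const, nsmul_eq_mul, Finset.filter_mem_eq_inter, mul_comm]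

theorem sum_codeg_eq_sum_card (A : Finset V) :
    ∑ x ∈ A.offDiag, (∑ p, if x.1 ∈ S p ∧ x.2 ∈ S p then y p else 0) =
      ∑ p, y p * ((A ∩ S p).offDiag.card : ℝ) := by
  rw [Finset.sum_comm]
  refine Finset.sum_congr rfl fun p _ => ?_
  rw [← Finset.sum_filter, Finset.sum_const, nsmul_eq_mul, mul_comm]
  congr 3
  ext x
  simp only [Finset.mem_filter, Finset.mem_offDiag, Finset.mem_inter]
  tauto

theorem ite_le_card_erase_inter {v : V} {A B : Finset V} (hv : v ∈ A) :
    (if v ∉ B ∧ ¬ Disjoint A B then 1 else 0) ≤ ((A.erase v) ∩ B).card ∧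
      ((A.erase v) ∩ B).card ≤
        (if v ∉ B ∧ ¬ Disjoint A B then 1 else 0) + (A ∩ B).offDiag.card := by
  have e : (A.erase v) ∩ B = (A ∩ B).erase v := by
    ext x; simp only [Finset.mem_inter, Finset.mem_erase]; tauto
  rw [e, Finset.offDiag_card]
  by_cases hB : v ∈ B
  · have : v ∈ A ∩ B := Finset.mem_inter.2 ⟨hv, hB⟩
    have hpos := Finset.card_pos.2 ⟨v, this⟩
    rw [Finset.card_erase_of_mem this]
    simp only [hB, not_true, false_and, if_false, zero_le, zero_add, true_and]
    rw [← Nat.mul_sub_one]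
    exact Nat.le_mul_of_pos_left _ hpos
  · rw [Finset.erase_eq_of_notMem fun h => hB (Finset.mem_inter.1 h).2]
    by_cases hd : Disjoint A B
    · simp [hd, Finset.disjoint_iff_inter_eq_empty.1 hd]
    · have hpos : 0 < (A ∩ B).card := by
        rw [Finset.card_pos, Finset.nonempty_iff_ne_empty, Ne,
          ← Finset.disjoint_iff_inter_eq_empty]
        exact hd
      rw [if_pos ⟨hB, hd⟩]
      refine ⟨hpos, ?_⟩
      rw [← Nat.mul_sub_one]
      obtain h | h := Nat.lt_or_ge 1 (A ∩ B).card
      · have := Nat.mul_le_mul_left (A ∩ B).card (show 1 ≤ (A ∩ B).card - 1 by omega)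
        omega
      · omega

/-- The weight at `v` of the sets meeting `S p`. -/
noncomputable def lost (S : ι → Finset V) (y : ι → ℝ) (v : V) (p : ι) : ℝ :=
  ∑ q, if v ∈ S q ∧ ¬ Disjoint (S q) (S p) then y q else 0

theorem tot_disjoint (v : V) (p : ι) :
    tot S (fun q => if Disjoint (S q) (S p) then y q else 0) v = tot S y v - lost S y v p := by
  rw [tot, tot, lost, ← Finset.sum_sub_distrib]
  refine Finset.sum_congr rfl fun q _ => ?_
  by_cases h1 : v ∈ S q <;> by_cases h2 : Disjoint (S q) (S p) <;> simp [h1, h2]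

theorem lost_nonneg (hy : ∀ p, 0 ≤ y p) (v : V) (p : ι) : 0 ≤ lost S y v p :=
  Finset.sum_nonneg fun q _ => by split_ifs <;> simp [hy]

theorem lost_le (hy : ∀ p, 0 ≤ y p) {d : ℝ}
    (hd : ∀ v w, v ≠ w → (∑ p, if v ∈ S p ∧ w ∈ S p then y p else 0) ≤ d) {v : V} {p : ι}
    (hv : v ∉ S p) : lost S y v p ≤ (S p).card * d := by
  have h1 : lost S y v p ≤ ∑ w ∈ S p, ∑ q, if v ∈ S q ∧ w ∈ S q then y q else 0 := by
    rw [Finset.sum_comm]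
    refine Finset.sum_le_sum fun q _ => ?_
    have h0 : ∀ w ∈ S p, 0 ≤ if v ∈ S q ∧ w ∈ S q then y q else 0 := fun w _ => by
      split_ifs <;> simp [hy]
    split_ifs with h
    · obtain ⟨w, hwq, hwp⟩ := Finset.not_disjoint_iff.1 h.2
      refine le_trans ?_ (Finset.single_le_sum h0 hwp)
      rw [if_pos ⟨h.1, hwq⟩]
    · exact Finset.sum_nonneg h0
  refine h1.trans ?_
  rw [← nsmul_eq_mul]
  refine Finset.sum_le_card_nsmul _ _ _ fun w hw => hd v w ?_
  rintro rfl
  exact hv hw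

theorem abs_sum_lost_sub_le (hy : ∀ p, 0 ≤ y p) {d : ℝ} {k : ℕ} (hk : ∀ p, (S p).card = k)
    (hd0 : 0 ≤ d)
    (hd : ∀ v w, v ≠ w → (∑ p, if v ∈ S p ∧ w ∈ S p then y p else 0) ≤ d)
    {v : V} (hT : tot S y v ≤ 1) :
    |(∑ p, if v ∉ S p then y p * lost S y v p else 0) -
      ∑ q, if v ∈ S q then y q * ((∑ w ∈ S q, tot S y w) - tot S y v) else 0| ≤ k ^ 2 * d := by
  have e1 : (∑ p, if v ∉ S p then y p * lost S y v p else 0) =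
      ∑ q, if v ∈ S q then
        y q * ∑ p, y p * (((if v ∉ S p ∧ ¬ Disjoint (S q) (S p) then 1 else 0 : ℕ)) : ℝ) else 0 := by
    have a1 : ∀ p, (if v ∉ S p then y p * lost S y v p else 0) =
        ∑ q, if v ∉ S p ∧ v ∈ S q ∧ ¬ Disjoint (S q) (S p) then y p * y q else 0 := by
      intro p
      by_cases h : v ∈ S p
      · simp [h]
      · simp only [lost, Finset.mul_sum, mul_ite, mul_zero, h, not_false_iff, true_and, if_true]
    simp only [a1]
    rw [Finset.sum_comm]
    refine Finset.sum_congr rfl fun q _ => ?_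
    split_ifs with h
    · rw [Finset.mul_sum]
      refine Finset.sum_congr rfl fun p _ => ?_
      by_cases h1 : v ∉ S p ∧ ¬ Disjoint (S q) (S p)
      · rw [if_pos ⟨h1.1, h, h1.2⟩, if_pos h1]; push_cast; ring
      · rw [if_neg fun h2 => h1 ⟨h2.1, h2.2.2⟩, if_neg h1]; push_cast; ring
    · exact Finset.sum_eq_zero fun p _ => if_neg fun h2 => h h2.2.1
  have e2 : ∀ q, v ∈ S q → (∑ w ∈ S q, tot S y w) - tot S y v =
      ∑ p, y p * ((((S q).erase v) ∩ S p).card : ℝ) := by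
    intro q hq
    rw [← sum_tot_eq_sum_card, ← Finset.sum_erase_add _ _ hq]
    ring
  have h1 : (∑ p, if v ∉ S p then y p * lost S y v p else 0) ≤
      ∑ q, if v ∈ S q then y q * ((∑ w ∈ S q, tot S y w) - tot S y v) else 0 := by
    rw [e1]
    refine Finset.sum_le_sum fun q _ => ?_
    split_ifs with h
    · rw [e2 q h]
      refine mul_le_mul_of_nonneg_left (Finset.sum_le_sum fun p _ =>
        mul_le_mul_of_nonneg_left ?_ (hy p)) (hy q)
      exact Nat.cast_le.2 (ite_le_card_erase_inter h).1
    · exact le_rfl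
  have h2 : (∑ q, if v ∈ S q then y q * ((∑ w ∈ S q, tot S y w) - tot S y v) else 0) ≤
      (∑ p, if v ∉ S p then y p * lost S y v p else 0) + k ^ 2 * d * tot S y v := by
    rw [e1, tot, Finset.mul_sum, ← Finset.sum_add_distrib]
    refine Finset.sum_le_sum fun q _ => ?_
    split_ifs with h
    · rw [← tot, e2 q h]
      have h3 : ∑ p, y p * ((((S q).erase v) ∩ S p).card : ℝ) ≤
          ∑ p, y p * (((if v ∉ S p ∧ ¬ Disjoint (S q) (S p) then 1 else 0 : ℕ)) : ℝ) +
            ∑ p, y p * ((S q ∩ S p).offDiag.card : ℝ) := by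
        rw [← Finset.sum_add_distrib]
        refine Finset.sum_le_sum fun p _ => ?_
        rw [← mul_add]
        refine mul_le_mul_of_nonneg_left ?_ (hy p)
        exact_mod_cast (ite_le_card_erase_inter h).2
      have h4 : ∑ p, y p * ((S q ∩ S p).offDiag.card : ℝ) ≤ k ^ 2 * d := by
        rw [← sum_codeg_eq_sum_card]
        refine (Finset.sum_le_card_nsmul _ _ d fun x hx => hd _ _ ?_).trans ?_
        · exact (Finset.mem_offDiag.1 hx).2.2
        · rw [nsmul_eq_mul]
          refine mul_le_mul_of_nonneg_right ?_ hd0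
          rw [Finset.offDiag_card, hk, sq]
          exact_mod_cast Nat.sub_le _ _
      have h5 := mul_le_mul_of_nonneg_left (h3.trans (add_le_add_right h4 _)) (hy q)
      linarith
    · simp
  have h3 : k ^ 2 * d * tot S y v ≤ k ^ 2 * d := mul_le_of_le_one_right (by positivity) hT
  rw [abs_le]
  constructor <;> linarith

/-- The potential after removing the set `S p` and everything meeting it. -/
theorem exists_greedy_step (hy : ∀ p, 0 ≤ y p) (hS : ∀ p, y p ≠ 0 → S p ⊆ U) {k : ℕ}
    (hk1 : 1 ≤ k) (hk : ∀ p, (S p).card = k) (hT : ∀ v, tot S y v ≤ 1) {d : ℝ} (hd0 : 0 ≤ d)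
    (hd : ∀ v w, v ≠ w → (∑ p, if v ∈ S p ∧ w ∈ S p then y p else 0) ≤ d)
    {τ σ X n : ℝ} (hτ0 : 0 ≤ τ) (hτ1 : τ ≤ 1) (hX : ∑ p, y p = X) (hX0 : 0 < X)
    (hσ : σ * X = (k - 1) * τ ^ 2) (hn : (U.card : ℝ) ≤ n) :
    ∃ p, y p ≠ 0 ∧
      ∑ v ∈ U \ S p, (tot S (fun q => if Disjoint (S q) (S p) then y q else 0) v - (τ - σ)) ^ 2 ≤
        ∑ v ∈ U, (tot S y v - τ) ^ 2 +
          2 / X * (∑ v ∈ U, (tot S y v - τ) ^ 2 + σ * n + k ^ 2 * d * n) +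
          n * (σ + k * d) ^ 2 := by
  have hk1' : (1 : ℝ) ≤ k := by exact_mod_cast hk1
  have hσ0 : 0 ≤ σ := by
    have : 0 ≤ σ * X := by rw [hσ]; exact mul_nonneg (by linarith) (sq_nonneg _)
    exact nonneg_of_mul_nonneg_left this hX0
  have hn0 : 0 ≤ n := (Nat.cast_nonneg _).trans hn
  set T := tot S y with hTdef
  have hT0 : ∀ v, 0 ≤ T v := tot_nonneg hy
  set δ : V → ℝ := fun v => T v - τ with hδ
  have hδabs : ∀ v, |δ v| ≤ 1 := fun v => by
    rw [abs_le]; constructor <;> simp only [hδ] <;> linarith [hT v, hT0 v]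
  set Φ := ∑ v ∈ U, δ v ^ 2 with hΦ
  have hexp : ∀ p, ∑ v ∈ U \ S p,
      (tot S (fun q => if Disjoint (S q) (S p) then y q else 0) v - (τ - σ)) ^ 2 ≤
      Φ + 2 * (∑ v ∈ U, δ v * if v ∉ S p then σ - lost S y v p else 0) +
        n * (σ + k * d) ^ 2 := by
    intro p
    have h1 : ∀ v ∈ U \ S p,
        (tot S (fun q => if Disjoint (S q) (S p) then y q else 0) v - (τ - σ)) ^ 2 ≤
        δ v ^ 2 + 2 * (δ v * (σ - lost S y v p)) + (σ + k * d) ^ 2 := by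
      intro v hv
      have hv := (Finset.mem_sdiff.1 hv).2
      rw [tot_disjoint]
      have h2 := lost_le hy hd hv
      rw [hk] at h2
      have h3 := lost_nonneg hy v p (S := S)
      have h4 : (σ - lost S y v p) ^ 2 ≤ (σ + k * d) ^ 2 := by
        rw [sq_le_sq, abs_of_nonneg (show 0 ≤ σ + k * d by positivity), abs_le]
        constructor <;> linarith
      have h5 : (tot S y v - lost S y v p - (τ - σ)) ^ 2 =
          δ v ^ 2 + 2 * (δ v * (σ - lost S y v p)) + (σ - lost S y v p) ^ 2 := by
        simp only [hδ, hTdef]; ring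
      linarith
    refine (Finset.sum_le_sum h1).trans ?_
    rw [Finset.sum_add_distrib, Finset.sum_add_distrib, ← Finset.mul_sum, Finset.sum_const,
      nsmul_eq_mul]
    have h2 : ∑ v ∈ U \ S p, δ v ^ 2 ≤ Φ :=
      Finset.sum_le_sum_of_subset_of_nonneg Finset.sdiff_subset fun v _ _ => sq_nonneg _
    have h3 : ∑ v ∈ U \ S p, δ v * (σ - lost S y v p) =
        ∑ v ∈ U, δ v * if v ∉ S p then σ - lost S y v p else 0 := by
      rw [← Finset.sum_subset (Finset.sdiff_subset (s := U) (t := S p))]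
      · exact Finset.sum_congr rfl fun v hv => by rw [if_pos (Finset.mem_sdiff.1 hv).2]
      · intro v hv hv2
        rw [if_neg, mul_zero]
        intro h
        exact hv2 (Finset.mem_sdiff.2 ⟨hv, h⟩)
    have h4 : ((U \ S p).card : ℝ) ≤ n :=
      (Nat.cast_le.2 (Finset.card_le_card Finset.sdiff_subset)).trans hn
    have h5 := mul_le_mul_of_nonneg_right h4 (sq_nonneg (σ + k * d))
    linarith
  have hkey : ∑ p, y p * (∑ v ∈ U, δ v * if v ∉ S p then σ - lost S y v p else 0) ≤
      Φ + σ * n + k ^ 2 * d * n := by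
    set G : V → ℝ := fun v => ∑ q, if v ∈ S q then y q * ((∑ w ∈ S q, T w) - T v) else 0 with hG
    set M : V → ℝ := fun v => ∑ p, if v ∉ S p then y p * lost S y v p else 0 with hM
    have h1 : ∑ p, y p * (∑ v ∈ U, δ v * if v ∉ S p then σ - lost S y v p else 0) =
        ∑ v ∈ U, δ v * (σ * (X - T v) - M v) := by
      simp only [Finset.mul_sum]
      rw [Finset.sum_comm]
      refine Finset.sum_congr rfl fun v _ => ?_
      have a1 : X - T v = ∑ p, if v ∉ S p then y p else 0 := by
        rw [← hX, hTdef, tot, ← Finset.sum_sub_distrib]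
        refine Finset.sum_congr rfl fun p _ => ?_
        by_cases h : v ∈ S p <;> simp [h]
      rw [a1]
      simp only [hM]
      rw [Finset.mul_sum, ← Finset.sum_sub_distrib, Finset.mul_sum]
      refine Finset.sum_congr rfl fun p _ => ?_
      split_ifs <;> ring
    have h2 : ∀ v ∈ U, δ v * (σ * (X - T v) - M v) ≤
        σ * X * δ v + σ - δ v * G v + k ^ 2 * d := by
      intro v _
      have a1 := abs_sum_lost_sub_le hy hk hd0 hd (hT v)
      have a2 : |δ v * (M v - G v)| ≤ 1 * (k ^ 2 * d) := by
        rw [abs_mul]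
        exact mul_le_mul (hδabs v) a1 (abs_nonneg _) zero_le_one
      have a3 := (abs_le.1 a2).1
      have a4 : |δ v * T v| ≤ 1 * 1 := by
        rw [abs_mul]
        exact mul_le_mul (hδabs v) (by rw [abs_of_nonneg (hT0 v)]; exact hT v)
          (abs_nonneg _) zero_le_one
      have a5 := mul_le_mul_of_nonneg_left (abs_le.1 a4).1 hσ0
      linarith
    have h3 : ∑ v ∈ U, δ v * G v =
        ∑ q, y q * ((k - 1) * τ * ∑ v ∈ S q, δ v + (∑ v ∈ S q, δ v) ^ 2 -
          ∑ v ∈ S q, δ v ^ 2) := by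
      rw [sum_mul_sum_ite hS δ fun q v => (∑ w ∈ S q, T w) - T v]
      refine Finset.sum_congr rfl fun q _ => ?_
      congr 1
      have b1 : ∑ w ∈ S q, T w = k * τ + ∑ w ∈ S q, δ w := by
        simp only [hδ]
        rw [Finset.sum_sub_distrib, Finset.sum_const, nsmul_eq_mul, hk]; ring
      have b2 : ∀ v ∈ S q, δ v * ((∑ w ∈ S q, T w) - T v) =
          ((k - 1) * τ + ∑ w ∈ S q, δ w) * δ v - δ v ^ 2 := by
        intro v _
        rw [b1]
        have : T v = τ + δ v := by simp only [hδ]; ring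
        rw [this]; ring
      rw [Finset.sum_congr rfl b2, Finset.sum_sub_distrib, ← Finset.mul_sum]
      ring
    have h4 : (k - 1) * τ * ∑ v ∈ U, δ v * T v - ∑ v ∈ U, δ v ^ 2 * T v ≤ ∑ v ∈ U, δ v * G v := by
      rw [h3, hTdef, sum_mul_tot_of_support hS, sum_mul_tot_of_support hS, Finset.mul_sum,
        ← Finset.sum_sub_distrib]
      refine Finset.sum_le_sum fun q _ => ?_
      have := mul_nonneg (hy q) (sq_nonneg (∑ v ∈ S q, δ v))
      linarith
    have h5 : ∑ v ∈ U, δ v ^ 2 * T v ≤ Φ :=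
      Finset.sum_le_sum fun v _ => mul_le_of_le_one_right (sq_nonneg _) (hT v)
    have h6 : τ * ∑ v ∈ U, δ v ≤ ∑ v ∈ U, δ v * T v := by
      rw [Finset.mul_sum]
      refine Finset.sum_le_sum fun v _ => ?_
      have : T v = τ + δ v := by simp only [hδ]; ring
      rw [this]
      linarith [sq_nonneg (δ v)]
    have h7 := mul_le_mul_of_nonneg_left h6 (show 0 ≤ (k - 1) * τ from
      mul_nonneg (by linarith) hτ0)
    rw [h1]
    refine (Finset.sum_le_sum h2).trans ?_
    rw [Finset.sum_add_distrib, Finset.sum_sub_distrib, Finset.sum_add_distrib, ← Finset.mul_sum,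
      Finset.sum_const, Finset.sum_const, nsmul_eq_mul, nsmul_eq_mul, hσ]
    have h8 := mul_le_mul_of_nonneg_right hn hσ0
    have h9 := mul_le_mul_of_nonneg_right hn (show 0 ≤ k ^ 2 * d by positivity)
    linarith
  by_contra! hcon
  set R := Φ + 2 / X * (Φ + σ * n + k ^ 2 * d * n) + n * (σ + k * d) ^ 2 with hR
  have hlt : ∑ p, y p * R < ∑ p, y p * (Φ +
      2 * (∑ v ∈ U, δ v * if v ∉ S p then σ - lost S y v p else 0) + n * (σ + k * d) ^ 2) := by
    refine Finset.sum_lt_sum (fun p _ => ?_) ?_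
    · by_cases hp : y p = 0
      · simp [hp]
      · exact mul_le_mul_of_nonneg_left ((hcon p hp).le.trans (hexp p)) (hy p)
    · by_contra! hall
      have : ∑ p, y p ≤ 0 := Finset.sum_nonpos fun p hp => by
        by_contra! hpos
        have := mul_lt_mul_of_pos_left ((hcon p hpos.ne').trans_le (hexp p)) hpos
        linarith [hall p hp]
      linarith
  have h1 : ∑ p, y p * (Φ +
      2 * (∑ v ∈ U, δ v * if v ∉ S p then σ - lost S y v p else 0) + n * (σ + k * d) ^ 2) =
      X * Φ + 2 * ∑ p, y p * (∑ v ∈ U, δ v * if v ∉ S p then σ - lost S y v p else 0) +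
        X * (n * (σ + k * d) ^ 2) := by
    simp only [mul_add, Finset.sum_add_distrib]
    rw [← Finset.sum_mul, ← Finset.sum_mul, hX, Finset.mul_sum _ _ (2 : ℝ)]
    congr 2
    exact Finset.sum_congr rfl fun p _ => by ring
  rw [h1, ← Finset.sum_mul, hX, hR] at hlt
  have h2 : X * (2 / X * (Φ + σ * n + k ^ 2 * d * n)) = 2 * (Φ + σ * n + k ^ 2 * d * n) := by
    field_simp
  rw [mul_add, mul_add, h2] at hlt
  linarith

end Greedy

section Greedy

variable {ι V : Type} [Fintype ι] [DecidableEq V] {S : ι → Finset V} {y : ι → ℝ} {U : Finset V}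

/-- One step of the greedy procedure while the uncovered set is still large. -/
theorem exists_greedy_step_of_large (hy : ∀ p, 0 ≤ y p) (hS : ∀ p, y p ≠ 0 → S p ⊆ U) {k : ℕ}
    (hk1 : 1 ≤ k) (hk : ∀ p, (S p).card = k) (hT : ∀ v, tot S y v ≤ 1) {D n : ℝ} (hD : 0 ≤ D)
    (hn0 : 0 < n)
    (hd : ∀ v w, v ≠ w → (∑ p, if v ∈ S p ∧ w ∈ S p then y p else 0) ≤ D / n)
    {τ η c : ℝ} (hη : 0 < η) (hc : 0 < c) (hcτ : c ≤ τ) (hτ1 : τ ≤ 1) (hn : (U.card : ℝ) ≤ n)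
    (hU : η * n ≤ U.card) (hΦ : ∑ v ∈ U, (tot S y v - τ) ^ 2 ≤ η * n * c ^ 2 / 4) :
    ∃ p, y p ≠ 0 ∧ ∃ τ', τ * (1 - 2 * k ^ 2 / η / n) ≤ τ' ∧ τ' ≤ τ ∧
      ∑ v ∈ U \ S p, (tot S (fun q => if Disjoint (S q) (S p) then y q else 0) v - τ') ^ 2 ≤
        (1 + 4 * k / (η * c) / n) * (∑ v ∈ U, (tot S y v - τ) ^ 2) +
          (4 * k / (η * c) * (2 * k ^ 2 / η + k ^ 2 * D) + (2 * k ^ 2 / η + k * D) ^ 2) / n := by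
  have hk0 : (0 : ℝ) < k := by exact_mod_cast hk1
  have hk1' : (1 : ℝ) ≤ k := by exact_mod_cast hk1
  have hτ0 : 0 < τ := hc.trans_le hcτ
  set Φ := ∑ v ∈ U, (tot S y v - τ) ^ 2 with hΦdef
  have hΦ0 : 0 ≤ Φ := Finset.sum_nonneg fun v _ => sq_nonneg _
  have hm0 : (0 : ℝ) < U.card := lt_of_lt_of_le (by positivity) hU
  set X := ∑ p, y p with hX
  have hsum : ∑ v ∈ U, tot S y v = k * X := by
    have := sum_mul_tot_of_support hS fun _ => (1 : ℝ)
    simp only [one_mul, Finset.sum_const, hk, nsmul_eq_mul, mul_one] at this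
    rw [this, ← Finset.sum_mul, mul_comm]
  have hdev : ∑ v ∈ U, (τ - tot S y v) ≤ U.card * τ / 2 := by
    refine le_of_sq_le_sq ?_ (by positivity)
    have h1 := sq_sum_le_card_mul_sum_sq (s := U) (f := fun v => τ - tot S y v)
    have h2 : ∑ v ∈ U, (τ - tot S y v) ^ 2 = Φ :=
      Finset.sum_congr rfl fun v _ => by ring
    rw [h2] at h1
    have h3 : η * n * c ^ 2 / 4 ≤ U.card * τ ^ 2 / 4 := by
      have := mul_le_mul hU (pow_le_pow_left₀ hc.le hcτ 2) (by positivity) hm0.le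
      linarith
    have h4 := mul_le_mul_of_nonneg_left (hΦ.trans h3) hm0.le
    calc _ ≤ _ := h1
      _ ≤ _ := h4
      _ = _ := by ring
  rw [Finset.sum_sub_distrib, hsum, Finset.sum_const, nsmul_eq_mul] at hdev
  have hXτ : η * n * τ / (2 * k) ≤ X := by
    rw [div_le_iff₀ (by positivity)]
    have := mul_le_mul_of_nonneg_right hU hτ0.le
    linarith
  have hXc : η * n * c / (2 * k) ≤ X := by
    refine le_trans ?_ hXτ
    gcongr
  have hX0 : 0 < X := lt_of_lt_of_le (by positivity) hXc
  set σ := (k - 1) * τ ^ 2 / X with hσ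
  have hσ0 : 0 ≤ σ := div_nonneg (mul_nonneg (by linarith) (sq_nonneg _)) hX0.le
  have hσ1 : σ ≤ 2 * k ^ 2 / η / n * τ := by
    rw [hσ, div_le_iff₀ hX0]
    have h1 := mul_le_mul_of_nonneg_left hXτ (show 0 ≤ 2 * k ^ 2 / η / n * τ by positivity)
    have h2 : 2 * k ^ 2 / η / n * τ * (η * n * τ / (2 * k)) = k * τ ^ 2 := by
      field_simp
    have := sq_nonneg τ
    linarith
  have hσ2 : σ * n ≤ 2 * k ^ 2 / η := by
    have h1 : 2 * k ^ 2 / η / n * τ ≤ 2 * k ^ 2 / η / n * 1 :=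
      mul_le_mul_of_nonneg_left hτ1 (by positivity)
    have h2 := mul_le_mul_of_nonneg_right (hσ1.trans h1) hn0.le
    rwa [mul_one, div_mul_cancel₀ _ hn0.ne'] at h2
  obtain ⟨p, hp, hstep⟩ := exists_greedy_step hy hS hk1 hk hT (by positivity) hd hτ0.le hτ1
    hX.symm hX0 (div_mul_cancel₀ _ hX0.ne') hn
  refine ⟨p, hp, τ - σ, by linarith, by linarith, hstep.trans ?_⟩
  rw [← hΦdef, ← hσ]
  have e1 : (k : ℝ) ^ 2 * (D / n) * n = k ^ 2 * D := by field_simp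
  rw [e1]
  have h1 : 2 / X ≤ 4 * k / (η * c) / n := by
    rw [div_le_iff₀ hX0]
    have h1 := mul_le_mul_of_nonneg_left hXc (show 0 ≤ 4 * k / (η * c) / n by positivity)
    have h2 : 4 * k / (η * c) / n * (η * n * c / (2 * k)) = 2 := by
      field_simp; norm_num
    linarith
  have h2 : 2 / X * (Φ + σ * n + k ^ 2 * D) ≤
      4 * k / (η * c) / n * (Φ + 2 * k ^ 2 / η + k ^ 2 * D) :=
    mul_le_mul h1 (by linarith) (by positivity) (by positivity)
  have h3 : n * (σ + k * (D / n)) ^ 2 ≤ (2 * k ^ 2 / η + k * D) ^ 2 / n := by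
    have e2 : n * (σ + k * (D / n)) ^ 2 = (σ * n + k * D) ^ 2 / n := by field_simp
    rw [e2]
    gcongr
  have e3 : (1 + 4 * k / (η * c) / n) * Φ +
      (4 * k / (η * c) * (2 * k ^ 2 / η + k ^ 2 * D) + (2 * k ^ 2 / η + k * D) ^ 2) / n =
      Φ + 4 * k / (η * c) / n * (Φ + 2 * k ^ 2 / η + k ^ 2 * D) +
        (2 * k ^ 2 / η + k * D) ^ 2 / n := by ring
  rw [e3]
  linarith

end Greedy

theorem exp_neg_le_one_sub_pow {A n : ℝ} (hA : 0 ≤ A) (hn : 0 < n) (hAn : 2 * A ≤ n) {i : ℕ}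
    (hi : i ≤ n) : Real.exp (-(2 * A)) ≤ (1 - A / n) ^ i := by
  have hx : A / n ≤ 1 / 2 := by rw [div_le_iff₀ hn]; linarith
  have hx0 : 0 ≤ A / n := by positivity
  have h1 : Real.exp (-(2 * (A / n))) ≤ 1 - A / n := by
    have h2 := Real.add_one_le_exp (2 * (A / n))
    rw [Real.exp_neg, inv_le_comm₀ (Real.exp_pos _) (by linarith)]
    refine le_trans ?_ h2
    rw [inv_le_iff_one_le_mul₀ (by linarith)]
    have := mul_nonneg hx0 (show 0 ≤ 1 - 2 * (A / n) by linarith)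
    linarith
  calc Real.exp (-(2 * A)) ≤ Real.exp (i * -(2 * (A / n))) := by
        rw [Real.exp_le_exp]
        have : i * (A / n) ≤ n * (A / n) := mul_le_mul_of_nonneg_right hi hx0
        rw [mul_div_cancel₀ _ hn.ne'] at this
        linarith
    _ = Real.exp (-(2 * (A / n))) ^ i := Real.exp_nat_mul _ _
    _ ≤ _ := pow_le_pow_left₀ (Real.exp_pos _).le h1 i

theorem one_add_pow_le_exp {a n : ℝ} (ha : 0 ≤ a) (hn : 0 < n) {i : ℕ} (hi : i ≤ n) :
    (1 + a / n) ^ i ≤ Real.exp a := by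
  have hx0 : 0 ≤ a / n := by positivity
  calc (1 + a / n) ^ i ≤ Real.exp (a / n) ^ i :=
        pow_le_pow_left₀ (by positivity) (by linarith [Real.add_one_le_exp (a / n)]) i
    _ = Real.exp (i * (a / n)) := (Real.exp_nat_mul _ _).symm
    _ ≤ _ := by
        rw [Real.exp_le_exp]
        have : i * (a / n) ≤ n * (a / n) := mul_le_mul_of_nonneg_right hi hx0
        rwa [mul_div_cancel₀ _ hn.ne'] at this

/-- An almost perfect fractional tiling with small codegrees yields an almost perfect tiling. -/
theorem exists_almost_partition {k : ℕ} (hk1 : 1 ≤ k) {η : ℝ} (hη : 0 < η) :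
    ∃ ε : ℝ, 0 < ε ∧ ∀ D : ℝ, 0 ≤ D → ∃ n₀ : ℕ,
      ∀ (ι V : Type) [Fintype ι] [Fintype V] [DecidableEq V] (S : ι → Finset V) (y : ι → ℝ)
        (U : Finset V), n₀ ≤ Fintype.card V → (∀ p, S p ⊆ U) → (∀ p, (S p).card = k) →
        (∀ p, 0 ≤ y p) → (∀ v, tot S y v ≤ 1) →
        ∑ v ∈ U, (1 - tot S y v) ≤ ε * Fintype.card V →
        (∀ v w, v ≠ w → (∑ p, if v ∈ S p ∧ w ∈ S p then y p else 0) ≤ D / Fintype.card V) →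
        ∃ F : Finset ι, (∀ p ∈ F, ∀ q ∈ F, p ≠ q → Disjoint (S p) (S q)) ∧
          ((U \ F.biUnion S).card : ℝ) ≤ η * Fintype.card V := by
  have hk0 : (0 : ℝ) < k := by exact_mod_cast hk1
  set A : ℝ := 2 * k ^ 2 / η with hA
  have hA0 : 0 < A := by positivity
  set c := Real.exp (-(2 * A)) with hc
  have hc0 : 0 < c := Real.exp_pos _
  set a : ℝ := 4 * k / (η * c) with ha
  have ha0 : 0 < a := by positivity
  set ε := η * c ^ 2 / 8 / Real.exp a with hε
  have hε0 : 0 < ε := by positivity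
  refine ⟨ε, hε0, ?_⟩
  intro D hD
  set b : ℝ := a * (A + k ^ 2 * D) + (A + k * D) ^ 2 with hb
  have hb0 : 0 ≤ b := by positivity
  refine ⟨max (max 1 ⌈2 * A⌉₊) ⌈b / ε⌉₊, ?_⟩
  intro ι V _ _ _ S y U hn hSU hk hy hT hsum hcod
  classical
  have hV1 : 1 ≤ Fintype.card V := (le_max_left _ _).trans ((le_max_left _ _).trans hn)
  have hV2 : 2 * A ≤ Fintype.card V := by
    refine (Nat.le_ceil _).trans (Nat.cast_le.2 ?_)
    exact (le_max_right _ _).trans ((le_max_left _ _).trans hn)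
  have hV3 : b / ε ≤ Fintype.card V :=
    (Nat.le_ceil _).trans (Nat.cast_le.2 ((le_max_right _ _).trans hn))
  set n : ℝ := ((Fintype.card V : ℕ) : ℝ) with hndef
  have hn0 : 0 < n := Nat.cast_pos.2 hV1
  have hb2 : b ≤ ε * n := by
    rw [div_le_iff₀ hε0] at hV3; linarith
  by_contra! hcon
  set Φ₀ := ∑ v ∈ U, (tot S y v - 1) ^ 2 with hΦ₀
  have hΦ₀le : Φ₀ ≤ ε * n := by
    refine le_trans (Finset.sum_le_sum fun v _ => ?_) hsum
    have h1 := tot_nonneg (S := S) hy v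
    have := mul_nonneg h1 (show 0 ≤ 1 - tot S y v by linarith [hT v])
    linarith
  have hΦ₀0 : 0 ≤ Φ₀ := Finset.sum_nonneg fun v _ => sq_nonneg _
  have main : ∀ i : ℕ, ∃ (F : Finset ι) (z : ι → ℝ) (τ : ℝ), F.card = i ∧
      (∀ p ∈ F, ∀ q ∈ F, p ≠ q → Disjoint (S p) (S q)) ∧ (∀ p, 0 ≤ z p ∧ z p ≤ y p) ∧
      (∀ p, z p ≠ 0 → S p ⊆ U \ F.biUnion S) ∧ (1 - A / n) ^ i ≤ τ ∧ τ ≤ 1 ∧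
      ∑ v ∈ U \ F.biUnion S, (tot S z v - τ) ^ 2 ≤ (1 + a / n) ^ i * (Φ₀ + i * (b / n)) := by
    intro i
    induction i with
    | zero =>
      refine ⟨∅, y, 1, rfl, by simp, fun p => ⟨hy p, le_rfl⟩, fun p _ => by simpa using hSU p,
        by simp, le_rfl, by simp [hΦ₀]⟩
    | succ i ih =>
      obtain ⟨F, z, τ, hF, hdisj, hz, hzS, hτ, hτ1, hΦ⟩ := ih
      have hcard : ((F.card * k : ℕ) : ℝ) ≤ n := by
        rw [← Finset.sum_const_nat (fun p _ => hk p), ← Finset.card_biUnion hdisj]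
        exact Nat.cast_le.2 (Finset.card_le_univ _)
      have hin : (i : ℝ) ≤ n := by
        refine le_trans ?_ hcard
        rw [hF]
        exact_mod_cast Nat.le_mul_of_pos_right i hk1
      have hcτ : c ≤ τ := (exp_neg_le_one_sub_pow hA0.le hn0 hV2 hin).trans hτ
      have hexp := one_add_pow_le_exp ha0.le hn0 hin
      have hle : ∑ v ∈ U \ F.biUnion S, (tot S z v - τ) ^ 2 ≤ η * n * c ^ 2 / 4 := by
        have h1 : (i : ℝ) * (b / n) ≤ n * (b / n) :=
          mul_le_mul_of_nonneg_right hin (by positivity)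
        rw [mul_div_cancel₀ _ hn0.ne'] at h1
        have h2 : (1 + a / n) ^ i * (Φ₀ + i * (b / n)) ≤ Real.exp a * (2 * (ε * n)) :=
          mul_le_mul hexp (by linarith) (by positivity) (Real.exp_pos _).le
        have h3 : Real.exp a * (2 * (ε * n)) = η * n * c ^ 2 / 4 := by
          rw [hε]; field_simp; norm_num
        linarith
      obtain ⟨p, hp, τ', hτ', hτ'τ, hstep⟩ := exists_greedy_step_of_large (fun p => (hz p).1) hzS
        hk1 hk (fun v => (tot_mono (fun p => (hz p).2) v).trans (hT v)) hD hn0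
        (fun v w hvw => (Finset.sum_le_sum fun p _ => by
          split_ifs
          · exact (hz p).2
          · exact le_rfl).trans (hcod v w hvw)) hη hc0 hcτ hτ1
        (Nat.cast_le.2 (Finset.card_le_univ _)) (hcon F hdisj).le hle
      have hpU := hzS p hp
      have hpne : (S p).Nonempty := by
        rw [← Finset.card_pos, hk]; exact hk1
      have hpF' : ∀ q ∈ F, Disjoint (S p) (S q) := by
        intro q hq
        rw [Finset.disjoint_left]
        intro v hv hvq
        exact (Finset.mem_sdiff.1 (hpU hv)).2 (Finset.mem_biUnion.2 ⟨q, hq, hvq⟩)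
      have hpF : p ∉ F := fun h => by
        obtain ⟨v, hv⟩ := hpne
        exact Finset.disjoint_left.1 (hpF' p h) hv hv
      have hU' : U \ (insert p F).biUnion S = (U \ F.biUnion S) \ S p := by
        rw [Finset.biUnion_insert, Finset.union_comm, Finset.sdiff_union_distrib]
        ext v; simp only [Finset.mem_inter, Finset.mem_sdiff]; tauto
      refine ⟨insert p F, fun q => if Disjoint (S q) (S p) then z q else 0, τ',
        by rw [Finset.card_insert_of_notMem hpF, hF], ?_, ?_, ?_, ?_, hτ'τ.trans hτ1, ?_⟩
      · intro q hq r hr hqr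
        rw [Finset.mem_insert] at hq hr
        rcases hq with rfl | hq <;> rcases hr with rfl | hr
        · exact absurd rfl hqr
        · exact hpF' r hr
        · exact (hpF' q hq).symm
        · exact hdisj q hq r hr hqr
      · intro q
        dsimp only
        split_ifs
        · exact hz q
        · exact ⟨le_rfl, hy q⟩
      · intro q hq
        dsimp only at hq
        split_ifs at hq with h
        · rw [hU']
          exact Finset.subset_sdiff.2 ⟨hzS q hq, h⟩
        · exact absurd rfl hq
      · rw [pow_succ]
        refine le_trans (mul_le_mul_of_nonneg_right hτ ?_) hτ'
        have : A / n ≤ 1 / 2 := by rw [div_le_iff₀ hn0]; linarith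
        linarith
      · rw [hU']
        refine hstep.trans ?_
        have h1 := mul_le_mul_of_nonneg_left hΦ (show 0 ≤ 1 + a / n by positivity)
        have h2 : b / n ≤ (1 + a / n) ^ (i + 1) * (b / n) := by
          refine le_mul_of_one_le_left (by positivity) (one_le_pow₀ ?_)
          have : 0 ≤ a / n := by positivity
          linarith
        have h3 : (1 + a / n) ^ (i + 1) * (Φ₀ + ((i + 1 : ℕ) : ℝ) * (b / n)) =
            (1 + a / n) * ((1 + a / n) ^ i * (Φ₀ + i * (b / n))) +
              (1 + a / n) ^ (i + 1) * (b / n) := by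
          push_cast; ring
        rw [h3]
        linarith
  obtain ⟨F, z, τ, hF, hdisj, -⟩ := main (Fintype.card V + 1)
  have hcard : F.card * k ≤ Fintype.card V := by
    rw [← Finset.sum_const_nat (fun p _ => hk p), ← Finset.card_biUnion hdisj]
    exact Finset.card_le_univ _
  have := Nat.le_mul_of_pos_right F.card hk1
  omega

/-- Almost perfect tilings of large vertex subsets in non-extremal 3-graphs. -/
theorem exists_tiling {β : ℝ} (hβ : 0 < β) : ∃ ρ : ℝ, 0 < ρ ∧ ∀ {t : ℕ}, 0 < t → ∀ {η : ℝ}, 0 < η →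
    ∃ n₀ : ℕ, ∀ (V : Type) [Fintype V] [DecidableEq V] (H : Finset (Finset V)) (U : Finset V),
      n₀ ≤ Fintype.card V →
      (∀ v, (7 / 16 - ρ) * (Fintype.card V : ℝ) ^ 2 ≤
        cnt (fun p : V × V => Tri H v p.1 p.2)) →
      (∀ B : Finset V, B.card = 3 * Fintype.card V / 4 →
        β * (Fintype.card V : ℝ) ^ 3 < ordEdges H B) →
      (1 - ρ) * Fintype.card V ≤ U.card →
      ∃ (κ : Type) (J : Finset κ) (φ : κ → Fin 4 → Fin t → V),
        (∀ p ∈ J, Tile H t (φ p) ∧ ∀ i j, φ p i j ∈ U) ∧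
        (∀ p ∈ J, ∀ q ∈ J, p ≠ q → ∀ i j i' j', φ p i j ≠ φ q i' j') ∧
        ((U.filter fun v => ∀ p ∈ J, ∀ i j, φ p i j ≠ v).card : ℝ) ≤ η * Fintype.card V := by
  refine ⟨β / 2000, by positivity, ?_⟩
  intro t ht η hη
  obtain ⟨ε₁, hε₁, hpart⟩ := exists_almost_partition (k := 4 * t) (by omega) hη
  have ht0 : (0 : ℝ) < 4 * t + 1 := by positivity
  set ε := min (1 / 2) ((ε₁ / (4 * t + 1)) ^ 2) with hε
  have hε0 : 0 < ε := lt_min (by norm_num) (by positivity)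
  have hε1 : ε < 1 := (min_le_left _ _).trans_lt (by norm_num)
  have hsqrt : (4 * t + 1) * √ε ≤ ε₁ := by
    have h1 : √ε ≤ ε₁ / (4 * t + 1) := by
      rw [← Real.sqrt_sq (show 0 ≤ ε₁ / (4 * t + 1) by positivity)]
      exact Real.sqrt_le_sqrt (min_le_right _ _)
    rw [le_div_iff₀ ht0] at h1
    linarith
  obtain ⟨C, n₁, hC, hfrac⟩ := exists_fractional_tiling (β := β) (ρ := β / 2000) (γ := β / 2000)
    (ξ := β * ε / 2000) hε0 hε1 (by positivity) (by positivity) (by positivity) (by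
      have h1 : 2 * (β * ε / 2000) / ε = β / 1000 := by field_simp; norm_num
      have h2 := mul_lt_mul_of_pos_left hε1 hβ
      rw [h1]; linarith) ht
  obtain ⟨n₂, hn₂⟩ := hpart C hC.le
  refine ⟨max n₁ n₂, ?_⟩
  intro V _ _ H U hn hlink hext hU
  obtain ⟨ι, _, S, y, hS, hy, hT, hsum, hcod⟩ :=
    hfrac V H U ((le_max_left _ _).trans hn) hlink hext hU
  choose φ hφ hφU hSφ using hS
  have hmem : ∀ p v, v ∈ S p ↔ ∃ i j, φ p i j = v := by
    intro p v
    rw [hSφ, Finset.mem_image]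
    constructor
    · rintro ⟨x, -, rfl⟩; exact ⟨_, _, rfl⟩
    · rintro ⟨i, j, rfl⟩; exact ⟨(i, j), Finset.mem_univ _, rfl⟩
  obtain ⟨F, hF, hcov⟩ := hn₂ ι V S y U ((le_max_right _ _).trans hn)
    (fun p v hv => by obtain ⟨i, j, rfl⟩ := (hmem p v).1 hv; exact hφU p i j)
    (fun p => by
      rw [hSφ, Finset.card_image_of_injective _ (hφ p).1]
      simp)
    hy hT (hsum.trans (mul_le_mul_of_nonneg_right hsqrt (Nat.cast_nonneg _))) hcod
  refine ⟨ι, F, φ, fun p _ => ⟨hφ p, hφU p⟩, ?_, ?_⟩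
  · intro p hp q hq hpq i j i' j' e
    exact Finset.disjoint_left.1 (hF p hp q hq hpq) ((hmem _ _).2 ⟨i, j, rfl⟩)
      ((hmem _ _).2 ⟨i', j', e.symm⟩)
  · refine le_trans (Nat.cast_le.2 (Finset.card_le_card ?_)) hcov
    intro v hv
    rw [Finset.mem_filter] at hv
    rw [Finset.mem_sdiff, Finset.mem_biUnion]
    refine ⟨hv.1, ?_⟩
    rintro ⟨p, hp, hvp⟩
    obtain ⟨i, j, e⟩ := (hmem _ _).1 hvp
    exact hv.2 p hp i j e

/-! ### Loose Hamilton cycles -/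

/-- A short path absorbing every pair of vertices many times. -/
theorem exists_absorbing_path {c θ : ℝ} (hc : c = (1 / 10 ^ 32) ^ 81 / 2) (hθ : 0 < θ)
    (hθ1 : θ ≤ 1 / 10 ^ 9) (hθc : θ ≤ c / 10 ^ 4) : ∃ n₀ : ℕ,
    ∀ (V : Type) [Fintype V] [DecidableEq V] (H : Finset (Finset V)), n₀ ≤ Fintype.card V →
      (∀ e ∈ H, e.card = 3) →
      (∀ v, 43 / 100 * (Fintype.card V : ℝ) ^ 2 ≤ cnt (fun p : V × V => Tri H v p.1 p.2)) →
      ∀ s₀ : V, ∃ (F : Finset (Fin 26 → V)) (t : V) (A : Finset V), Flex H F s₀ t A ∧ s₀ ∉ A ∧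
        (A.card : ℝ) ≤ 26 * θ * Fintype.card V ∧
        ∀ a b, a ≠ b → ∀ [DecidablePred fun τ => IsAbs H τ a b],
          c * θ / 16 * Fintype.card V ≤ (F.filter fun τ => IsAbs H τ a b).card := by
  have hc0 : 0 < c := by rw [hc]; positivity
  have hc1 : c ≤ 1 := by
    rw [hc]
    have : ((1 : ℝ) / 10 ^ 32) ^ 81 ≤ 1 := pow_le_one₀ (by positivity) (by norm_num)
    linarith
  obtain ⟨n₀, hn₀⟩ := exists_family_hits (Fin 26) hc0 hc1 hθ (by
    rw [Fintype.card_fin]; push_cast; linarith)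
  refine ⟨max n₀ (max ⌈(1456 : ℝ) * (10 ^ 32) ^ 81⌉₊ (max ⌈104 / c⌉₊ (10 ^ 8))), ?_⟩
  intro V _ _ H hn h3 hd s₀
  classical
  have hV1 : n₀ ≤ Fintype.card V := (le_max_left _ _).trans hn
  have hn := (le_max_right _ _).trans hn
  have hV2 : (1456 : ℝ) * (10 ^ 32) ^ 81 ≤ Fintype.card V :=
    (Nat.le_ceil _).trans (Nat.cast_le.2 ((le_max_left _ _).trans hn))
  have hn := (le_max_right _ _).trans hn
  have hV3 : 104 / c ≤ Fintype.card V :=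
    (Nat.le_ceil _).trans (Nat.cast_le.2 ((le_max_left _ _).trans hn))
  have hV4 : (10 : ℝ) ^ 8 ≤ Fintype.card V := by
    exact_mod_cast (le_max_right _ _).trans hn
  have habs := fun a b (hab : a ≠ b) => cnt_isAbs_ge hd hV2 hab
  have hhits := hn₀ V hV1
  clear hV2 hn
  rw [← hc] at habs
  clear hc
  set n : ℝ := ((Fintype.card V : ℕ) : ℝ) with hndef
  obtain ⟨F₀, hF₀, hZ, hdis, hmany⟩ := hhits
    (fun p τ => Function.Injective τ ∧ (∀ i, τ i ≠ p.1) ∧ (∀ i, τ i ≠ p.2) ∧ IsAbs H τ p.1 p.2)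
    (Finset.univ.filter fun p : V × V => p.1 ≠ p.2)
    (fun p hp => habs p.1 p.2 (Finset.mem_filter.1 hp).2) {s₀} (by
      rw [div_le_iff₀ hc0] at hV3
      simp only [Finset.card_singleton, Fintype.card_fin]
      push_cast
      linarith)
  set F := F₀.filter fun τ => Function.Injective τ ∧ ∃ a b, IsAbs H τ a b with hF
  have hFF : ∀ τ ∈ F, τ ∈ F₀ := fun τ h => (Finset.mem_filter.1 h).1
  have hFcard : (F.card : ℝ) ≤ θ * n :=
    (Nat.cast_le.2 (Finset.card_filter_le _ _)).trans hF₀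
  have hsize : 156 * (F.card : ℝ) + 4 < 1 / 10 ^ 6 * n := by
    have h1 := mul_le_mul_of_nonneg_right hθ1 (show 0 ≤ n by linarith)
    linarith
  obtain ⟨t, A, hA, hsA, hAcard⟩ := exists_flex hd h3 s₀ F
    (fun τ h => by
      obtain ⟨-, -, a, b, hab⟩ := Finset.mem_filter.1 h
      exact hab.1)
    (fun τ h => (Finset.mem_filter.1 h).2.1)
    (fun τ h τ' h' => hdis τ (hFF τ h) τ' (hFF τ' h'))
    (fun τ h j e => hZ τ (hFF τ h) j (Finset.mem_singleton.2 e)) hsize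
  refine ⟨F, t, A, hA, hsA, ?_, ?_⟩
  · have : (A.card : ℝ) ≤ 26 * F.card := by exact_mod_cast hAcard
    linarith
  · intro a b hab _
    refine (hmany (a, b) (Finset.mem_filter.2 ⟨Finset.mem_univ _, hab⟩)).trans
      (Nat.cast_le.2 (Finset.card_le_card fun τ hτ => ?_))
    simp only [Finset.mem_filter] at hτ
    obtain ⟨h1, h2, -, -, h3⟩ := hτ
    exact Finset.mem_filter.2 ⟨Finset.mem_filter.2 ⟨h1, h2, a, b, h3⟩, h3⟩

/-- A small family of disjoint triples containing connections between all pairs of vertices. -/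
theorem exists_reservoir {c θ : ℝ} (hc : c = 1 / (2 * 10 ^ 6)) (hθ : 0 < θ)
    (hθ1 : θ ≤ 1 / 10 ^ 8) : ∃ n₀ : ℕ,
    ∀ (V : Type) [Fintype V] [DecidableEq V] (H : Finset (Finset V)), n₀ ≤ Fintype.card V →
      (∀ v, 43 / 100 * (Fintype.card V : ℝ) ^ 2 ≤ cnt (fun p : V × V => Tri H v p.1 p.2)) →
      ∀ Z : Finset V, (Z.card : ℝ) * 3 ≤ c / 4 * Fintype.card V → ∃ R : Finset (Fin 3 → V),
        (R.card : ℝ) ≤ θ * Fintype.card V ∧ (∀ τ ∈ R, ∀ j, τ j ∉ Z) ∧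
        (∀ τ ∈ R, ∀ τ' ∈ R, τ ≠ τ' → ∀ j j', τ j ≠ τ' j') ∧
        ∀ a b, ∀ [DecidablePred fun τ => Conn H a b τ ∧ τ 0 ≠ τ 2],
          c * θ / 16 * Fintype.card V ≤ (R.filter fun τ => Conn H a b τ ∧ τ 0 ≠ τ 2).card := by
  have hc0 : 0 < c := by rw [hc]; positivity
  obtain ⟨n₀, hn₀⟩ := exists_family_hits (Fin 3) hc0 (by rw [hc]; norm_num) hθ (by
    rw [Fintype.card_fin, hc]; push_cast; linarith)
  refine ⟨max n₀ (2 * 10 ^ 6), ?_⟩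
  intro V _ _ H hn hd Z hZ
  classical
  have hV : (2 * 10 ^ 6 : ℝ) ≤ Fintype.card V := by
    exact_mod_cast (le_max_right _ _).trans hn
  obtain ⟨R, hR, hRZ, hdis, hmany⟩ := hn₀ V ((le_max_left _ _).trans hn)
    (fun p τ => Conn H p.1 p.2 τ ∧ τ 0 ≠ τ 2) Finset.univ (fun p _ => by
      have h1 := cnt_conn_ge hd p.1 p.2
      have h2 := cnt_coord_eq_coord (V := V) (show (0 : Fin 3) ≠ 2 by decide)
      have h3 : cnt (Conn H p.1 p.2) ≤ cnt (fun τ => Conn H p.1 p.2 τ ∧ τ 0 ≠ τ 2) +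
          cnt (fun τ : Fin 3 → V => τ 0 = τ 2) :=
        cnt_le_add fun τ hτ => by by_cases h : τ 0 = τ 2 <;> simp [h, hτ]
      rw [Fintype.card_fun, Fintype.card_fin] at h2 ⊢
      push_cast at h2 ⊢
      set n : ℝ := ((Fintype.card V : ℕ) : ℝ) with hndef
      have hn0 : 0 < n := by linarith
      have h4 : cnt (fun τ : Fin 3 → V => τ 0 = τ 2) = n ^ 2 :=
        mul_right_cancel₀ hn0.ne' (by rw [h2]; ring)
      have h5 := mul_le_mul_of_nonneg_right hV (sq_nonneg n)
      have h6 : n ^ 3 = n * n ^ 2 := by ring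
      rw [hc]
      linarith) Z (by rw [Fintype.card_fin]; exact_mod_cast hZ)
  refine ⟨R, hR, hRZ, hdis, fun a b _ => ?_⟩
  refine (hmany (a, b) (Finset.mem_univ _)).trans (Nat.cast_le.2 (Finset.card_le_card ?_))
  intro τ hτ
  simpa using hτ

section Links

variable {V : Type} [Fintype V] [DecidableEq V] {H : Finset (Finset V)}

theorem two_mul_hdeg_le (h3 : ∀ e ∈ H, e.card = 3) (v : V) :
    2 * (hdeg H v : ℝ) ≤ cnt (fun p : V × V => Tri H v p.1 p.2) := by
  classical
  rw [cnt_eq_card']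
  have hmap : ∀ p ∈ Finset.univ.filter (fun p : V × V => Tri H v p.1 p.2),
      ({v, p.1, p.2} : Finset V) ∈ H.filter fun e => v ∈ e := fun p hp =>
    Finset.mem_filter.2 ⟨(Finset.mem_filter.1 hp).2, Finset.mem_insert_self _ _⟩
  have key : (H.filter fun e => v ∈ e).card * 2 ≤
      (Finset.univ.filter fun p : V × V => Tri H v p.1 p.2).card := by
    rw [Finset.card_eq_sum_card_fiberwise hmap, ← smul_eq_mul]
    refine Finset.card_nsmul_le_sum _ _ _ fun e he => ?_
    obtain ⟨he, hv⟩ := Finset.mem_filter.1 he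
    have hcard : (e.erase v).card = 2 := by rw [Finset.card_erase_of_mem hv, h3 e he]
    obtain ⟨x, y, hxy, hexy⟩ := Finset.card_eq_two.1 hcard
    have hev : e = {v, x, y} := by rw [← hexy, Finset.insert_erase hv]
    have hev' : e = {v, y, x} := by rw [hev, Finset.pair_comm]
    rw [← Finset.card_pair (show (x, y) ≠ (y, x) from fun h => hxy (congrArg Prod.fst h))]
    refine Finset.card_le_card fun p hp => ?_
    rw [Finset.mem_insert, Finset.mem_singleton] at hp
    rw [Finset.mem_filter, Finset.mem_filter]
    rcases hp with rfl | rfl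
    · exact ⟨⟨Finset.mem_univ _, show _ ∈ H from hev ▸ he⟩, hev.symm⟩
    · exact ⟨⟨Finset.mem_univ _, show _ ∈ H from hev' ▸ he⟩, hev'.symm⟩
  rw [hdeg, mul_comm]
  exact_mod_cast key

theorem eIn_le_ordEdges (h3 : ∀ e ∈ H, e.card = 3) (B : Finset V) :
    (eIn H B : ℝ) ≤ ordEdges H B := by
  classical
  rw [ordEdges, cnt_eq_card', eIn, Nat.cast_le]
  refine Finset.card_le_card_of_surjOn (fun x : V × V × V => {x.1, x.2.1, x.2.2}) ?_
  intro e he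
  obtain ⟨he, heB⟩ := Finset.mem_filter.1 he
  obtain ⟨x, y, z, -, -, -, rfl⟩ := Finset.card_eq_three.1 (h3 e he)
  refine ⟨(x, y, z), ?_, rfl⟩
  simp only [Finset.coe_filter, Finset.mem_univ, true_and, Set.mem_ofPred_eq]
  exact ⟨⟨heB (by simp), heB (by simp), heB (by simp)⟩, he⟩

end Links

/-- Non-extremal 3-graphs with almost `7/16` of all pairs in every link have spanning closed
loose walks without repeated vertices. -/
theorem exists_hp_univ {β : ℝ} (hβ : 0 < β) : ∃ ρ : ℝ, 0 < ρ ∧ ∃ n₀ : ℕ,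
    ∀ (V : Type) [Fintype V] [DecidableEq V] (H : Finset (Finset V)), n₀ ≤ Fintype.card V →
      Even (Fintype.card V) → (∀ e ∈ H, e.card = 3) →
      (∀ v, 43 / 100 * (Fintype.card V : ℝ) ^ 2 ≤ cnt (fun p : V × V => Tri H v p.1 p.2)) →
      (∀ v, (7 / 16 - ρ) * (Fintype.card V : ℝ) ^ 2 ≤
        cnt (fun p : V × V => Tri H v p.1 p.2)) →
      (∀ B : Finset V, B.card = 3 * Fintype.card V / 4 →
        β * (Fintype.card V : ℝ) ^ 3 < ordEdges H B) →
      ∃ s, HP H s s Finset.univ := by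
  obtain ⟨ρ, hρ, htile⟩ := exists_tiling hβ
  refine ⟨ρ, hρ, ?_⟩
  obtain ⟨c₁, hc₁⟩ : ∃ c : ℝ, c = (1 / 10 ^ 32) ^ 81 / 2 := ⟨_, rfl⟩
  have hc₁0 : 0 < c₁ := by rw [hc₁]; positivity
  have hc₁1 : c₁ ≤ 1 := by
    rw [hc₁]
    have : ((1 : ℝ) / 10 ^ 32) ^ 81 ≤ 1 := pow_le_one₀ (by positivity) (by norm_num)
    linarith
  obtain ⟨θ₁, hθ₁0, hθ₁a, hθ₁b, hθ₁c⟩ : ∃ θ : ℝ, 0 < θ ∧ θ ≤ 1 / 10 ^ 9 ∧ θ ≤ c₁ / 10 ^ 4 ∧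
      θ ≤ ρ / 200 :=
    ⟨min (1 / 10 ^ 9) (min (c₁ / 10 ^ 4) (ρ / 200)),
      lt_min (by norm_num) (lt_min (by positivity) (by positivity)), min_le_left _ _,
      (min_le_right _ _).trans (min_le_left _ _), (min_le_right _ _).trans (min_le_right _ _)⟩
  obtain ⟨n₁, habsorb⟩ := exists_absorbing_path hc₁ hθ₁0 hθ₁a hθ₁b
  clear hc₁
  set h₁ := c₁ * θ₁ / 16 with hh₁
  have hh₁0 : 0 < h₁ := by positivity
  have hh₁θ : h₁ ≤ θ₁ / 16 := by
    have := mul_le_mul_of_nonneg_right hc₁1 hθ₁0.le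
    rw [hh₁]; linarith
  set θ₂ := h₁ / 4 with hθ₂
  obtain ⟨c₂, hc₂⟩ : ∃ c : ℝ, c = 1 / (2 * 10 ^ 6) := ⟨_, rfl⟩
  have hc₂0 : 0 < c₂ := by rw [hc₂]; positivity
  have hc₂1 : c₂ ≤ 1 := by rw [hc₂]; norm_num
  obtain ⟨n₂, hreserve⟩ := exists_reservoir hc₂ (θ := θ₂) (by positivity) (by linarith)
  set h₂ := c₂ * θ₂ / 16 with hh₂
  have hh₂0 : 0 < h₂ := by positivity
  have hh₂h₁ : h₂ ≤ h₁ / 64 := by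
    have := mul_le_mul_of_nonneg_right hc₂1 (show 0 ≤ θ₂ by positivity)
    rw [hh₂]; linarith
  obtain ⟨s, hs⟩ : ∃ s : ℕ, 1 / h₂ ≤ s := ⟨_, Nat.le_ceil _⟩
  obtain ⟨n₃, htile⟩ := htile (t := s + 1) (by omega) (η := h₁ / 4) (by positivity)
  refine ⟨max (max n₁ n₂) (max n₃ (max (max ⌈2 / h₂⌉₊ ⌈10 / ρ⌉₊) (10 ^ 9))), ?_⟩
  intro V _ _ H hn heven h3 hd hlink hext
  classical
  have hV1 : n₁ ≤ Fintype.card V := (le_max_left _ _).trans ((le_max_left _ _).trans hn)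
  have hV2 : n₂ ≤ Fintype.card V := (le_max_right _ _).trans ((le_max_left _ _).trans hn)
  have hn := (le_max_right _ _).trans hn
  have hV3 : n₃ ≤ Fintype.card V := (le_max_left _ _).trans hn
  have hn := (le_max_right _ _).trans hn
  have hV4 : 2 / h₂ ≤ Fintype.card V := (Nat.le_ceil _).trans
    (Nat.cast_le.2 ((le_max_left _ _).trans ((le_max_left _ _).trans hn)))
  have hV5 : 10 / ρ ≤ Fintype.card V := (Nat.le_ceil _).trans
    (Nat.cast_le.2 ((le_max_right _ _).trans ((le_max_left _ _).trans hn)))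
  have hV6 : (10 : ℝ) ^ 9 ≤ Fintype.card V := by exact_mod_cast (le_max_right _ _).trans hn
  have hVpos : 0 < Fintype.card V := by
    rw [← Nat.cast_pos (α := ℝ)]; linarith
  obtain ⟨s₀⟩ := Fintype.card_pos_iff.1 hVpos
  obtain ⟨F, t₀, A, hA, hsA, hAcard, hcap⟩ := habsorb V H hV1 h3 hd s₀
  have hres := hreserve V H hV2 hd (insert s₀ A)
  have htile := fun U => htile V H U hV3 hlink hext
  set n : ℝ := ((Fintype.card V : ℕ) : ℝ) with hndef
  have hn0 : 0 < n := by linarith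
  rw [div_le_iff₀ hh₂0] at hV4
  rw [div_le_iff₀ hρ] at hV5
  rw [div_le_iff₀ hh₂0] at hs
  have hZ : ((insert s₀ A).card : ℝ) ≤ 26 * θ₁ * n + 1 := by
    rw [Finset.card_insert_of_notMem hsA]; push_cast; linarith
  have hθ₁n := mul_le_mul_of_nonneg_right hθ₁a hn0.le
  have hθ₁n' := mul_le_mul_of_nonneg_right hθ₁c hn0.le
  obtain ⟨R, hRcard, hRZ, hRd, hhits⟩ := hres (by rw [hc₂]; linarith)
  set RR := R.biUnion fun τ => Finset.univ.image τ with hRR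
  have hRRcard : (RR.card : ℝ) ≤ 3 * R.card := by
    have : RR.card ≤ R.card * 3 := Finset.card_biUnion_le_card_mul _ _ _ fun τ _ =>
      Finset.card_image_le.trans (by simp)
    have : (RR.card : ℝ) ≤ R.card * 3 := by exact_mod_cast this
    linarith
  set U := Finset.univ \ (insert s₀ A ∪ RR) with hU
  have hh₁n : h₁ * n ≤ θ₁ / 16 * n := mul_le_mul_of_nonneg_right hh₁θ hn0.le
  have hUcard : (1 - ρ) * n ≤ U.card := by
    have h1 : (Fintype.card V : ℝ) ≤ U.card + (insert s₀ A ∪ RR).card := by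
      have := Finset.card_sdiff_add_card_eq_card (Finset.subset_univ (insert s₀ A ∪ RR))
      rw [Finset.card_univ] at this
      exact_mod_cast this.ge
    have h2 : ((insert s₀ A ∪ RR).card : ℝ) ≤ (insert s₀ A).card + RR.card := by
      exact_mod_cast Finset.card_union_le _ _
    rw [hθ₂] at hRcard
    linarith
  obtain ⟨κ, J, φ, hφ, hφd, hcov⟩ := htile U hUcard
  have hpath : ∀ p : κ, ∃ B : Finset V, p ∈ J → HP H (φ p 0 0) (φ p 0 (Fin.last s)) B ∧
      φ p 0 0 ∉ B ∧ B.card = 4 * s ∧ ∀ x ∈ B, ∃ i j, x = φ p i j := fun p => by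
    by_cases hp : p ∈ J
    · obtain ⟨B, hB⟩ := (hφ p hp).1.exists_path h3
      exact ⟨B, fun _ => hB⟩
    · exact ⟨∅, fun h => absurd h hp⟩
  choose B hB using hpath
  set E : κ → Finset V := fun p => insert (φ p 0 0) (B p) with hE
  have hEφ : ∀ p ∈ J, ∀ x ∈ E p, ∃ i j, x = φ p i j := by
    intro p hp x hx
    rcases Finset.mem_insert.1 hx with rfl | hx
    · exact ⟨_, _, rfl⟩
    · exact (hB p hp).2.2.2 x hx
  have hEcard : ∀ p ∈ J, (E p).card = 4 * s + 1 := fun p hp => by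
    rw [hE, Finset.card_insert_of_notMem (hB p hp).2.1, (hB p hp).2.2.1]
  have hEd : ∀ p ∈ J, ∀ q ∈ J, p ≠ q → Disjoint (E p) (E q) := by
    intro p hp q hq hpq
    rw [Finset.disjoint_left]
    intro x hx hx'
    obtain ⟨i, j, rfl⟩ := hEφ p hp x hx
    obtain ⟨i', j', e⟩ := hEφ q hq _ hx'
    exact hφd p hp q hq hpq _ _ _ _ e
  have hEU : ∀ p ∈ J, ∀ x ∈ E p, x ∉ insert s₀ A ∪ RR := by
    intro p hp x hx
    obtain ⟨i, j, rfl⟩ := hEφ p hp x hx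
    exact (Finset.mem_sdiff.1 ((hφ p hp).2 i j)).2
  have hJcard : (J.card : ℝ) * (4 * s + 1) ≤ n := by
    have : J.card * (4 * s + 1) ≤ Fintype.card V := by
      rw [← Finset.sum_const_nat hEcard, ← Finset.card_biUnion hEd]
      exact Finset.card_le_univ _
    have : ((J.card * (4 * s + 1) : ℕ) : ℝ) ≤ n := Nat.cast_le.2 this
    exact_mod_cast this
  have hJh₂ : (J.card : ℝ) ≤ h₂ * n / 4 := by
    have h1 := mul_le_mul_of_nonneg_left hJcard hh₂0.le
    have h2 := mul_le_mul_of_nonneg_left hs (show (0 : ℝ) ≤ J.card by positivity)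
    have h3 : 0 ≤ h₂ * J.card := by positivity
    linarith
  have huncov : ((Finset.univ \ (insert s₀ A ∪ RR ∪ J.biUnion E)).card : ℝ) ≤
      h₁ / 4 * n + 3 * J.card := by
    have h1 : Finset.univ \ (insert s₀ A ∪ RR ∪ J.biUnion E) ⊆
        (U.filter fun v => ∀ p ∈ J, ∀ i j, φ p i j ≠ v) ∪
          J.biUnion fun p => (Finset.univ.image fun x : Fin 4 × Fin (s + 1) => φ p x.1 x.2) \ E p := by
      intro v hv
      have hv := (Finset.mem_sdiff.1 hv).2
      rw [Finset.mem_union, not_or] at hv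
      rw [Finset.mem_union, Finset.mem_filter, Finset.mem_biUnion]
      by_cases h : ∀ p ∈ J, ∀ i j, φ p i j ≠ v
      · exact Or.inl ⟨Finset.mem_sdiff.2 ⟨Finset.mem_univ _, hv.1⟩, h⟩
      · push Not at h
        obtain ⟨p, hp, i, j, e⟩ := h
        refine Or.inr ⟨p, hp, Finset.mem_sdiff.2
          ⟨Finset.mem_image.2 ⟨(i, j), Finset.mem_univ _, e⟩, fun hvE => ?_⟩⟩
        exact hv.2 (Finset.mem_biUnion.2 ⟨p, hp, hvE⟩)
    have h2 : (J.biUnion fun p =>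
        (Finset.univ.image fun x : Fin 4 × Fin (s + 1) => φ p x.1 x.2) \ E p).card ≤ J.card * 3 := by
      refine Finset.card_biUnion_le_card_mul _ _ _ fun p hp => ?_
      rw [Finset.card_sdiff_of_subset, hEcard p hp]
      · have := Finset.card_image_le (s := Finset.univ)
          (f := fun x : Fin 4 × Fin (s + 1) => φ p x.1 x.2)
        rw [Finset.card_univ, Fintype.card_prod, Fintype.card_fin, Fintype.card_fin] at this
        omega
      · intro x hx
        obtain ⟨i, j, rfl⟩ := hEφ p hp x hx
        exact Finset.mem_image.2 ⟨(i, j), Finset.mem_univ _, rfl⟩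
    have h3 : ((Finset.univ \ (insert s₀ A ∪ RR ∪ J.biUnion E)).card : ℝ) ≤
        (U.filter fun v => ∀ p ∈ J, ∀ i j, φ p i j ≠ v).card + (J.card * 3 : ℕ) := by
      rw [← Nat.cast_add, Nat.cast_le]
      exact (Finset.card_le_card h1).trans ((Finset.card_union_le _ _).trans
        (Nat.add_le_add_left h2 _))
    push_cast at h3
    linarith
  refine ⟨s₀, Flex.hp_univ h3 heven hA hsA hRd hRZ J (fun p => φ p 0 0)
    (fun p => φ p 0 (Fin.last s)) B (fun p hp => (hB p hp).1) (fun p hp => (hB p hp).2.1) hEd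
    ?_ ?_ ?_ ?_⟩
  · intro p hp
    exact Finset.disjoint_left.2 fun x hx hx' => hEU p hp x hx (Finset.mem_union_left _ hx')
  · intro p hp τ hτ i hi
    exact hEU p hp _ hi (Finset.mem_union_right _ (Finset.mem_biUnion.2
      ⟨τ, hτ, Finset.mem_image_of_mem _ (Finset.mem_univ i)⟩))
  · intro a b
    rw [← Nat.cast_le (α := ℝ)]
    refine le_trans ?_ (hhits a b)
    push_cast
    linarith
  · intro a b hab
    have h1 := hcap a b hab
    rw [← Nat.cast_le (α := ℝ)]
    push_cast
    have h2 := mul_le_mul_of_nonneg_right hh₂h₁ hn0.le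
    rw [hθ₂] at hRcard
    have h3 : 0 ≤ h₁ * n := by positivity
    have h4 : 3 * (R.card : ℝ) + (Finset.univ \ (insert s₀ A ∪ RR ∪ J.biUnion E)).card ≤
        2 * (h₁ * n) := by linarith
    exact h4.trans (mul_le_mul_of_nonneg_left h1 zero_le_two)

/-- The nonextremal case: a non-`β`-extremal 3-graph with minimum vertex degree at least
`(7/16 - γ) C(n,2)` contains a loose Hamilton cycle. -/
theorem stmt_4 (β : ℝ) (hβ : 0 < β) :
    ∃ γ : ℝ, 0 < γ ∧ ∃ n₀ : ℕ, ∀ n : ℕ, n > n₀ → Even n →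
      ∀ H : Finset (Finset (Fin n)), (∀ e ∈ H, e.card = 3) →
      (∀ v : Fin n, (7 / 16 - γ) * (n.choose 2 : ℝ) ≤ (hdeg H v : ℝ)) →
      ¬ BetaExtremal β n H →
      HasLooseHamCycle n H := by
  obtain ⟨ρ, hρ, n₀, hmain⟩ := exists_hp_univ hβ
  obtain ⟨γ, hγ, hγρ, hγ1⟩ : ∃ γ : ℝ, 0 < γ ∧ γ ≤ ρ / 2 ∧ γ ≤ 1 / 1000 :=
    ⟨min (ρ / 2) (1 / 1000), lt_min (by positivity) (by norm_num), min_le_left _ _,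
      min_le_right _ _⟩
  refine ⟨γ, hγ, max n₀ ⌈1 / γ⌉₊, fun n hn heven H h3 hdeg hext => ?_⟩
  have hn₀ : n₀ ≤ n := (le_max_left _ _).trans hn.le
  have hnγ : 1 / γ ≤ n := (Nat.le_ceil _).trans (Nat.cast_le.2 ((le_max_right _ _).trans hn.le))
  rw [div_le_iff₀ hγ] at hnγ
  have hlink : ∀ v, (7 / 16 - 2 * γ) * (n : ℝ) ^ 2 ≤
      cnt (fun p : Fin n × Fin n => Tri H v p.1 p.2) := by
    intro v
    refine le_trans ?_ (two_mul_hdeg_le h3 v)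
    have h1 := hdeg v
    rw [Nat.cast_choose_two] at h1
    have h2 := mul_le_mul_of_nonneg_left hnγ (show (0 : ℝ) ≤ n by positivity)
    have h3 : 0 ≤ γ * n := by positivity
    linarith
  have hsq : (0 : ℝ) ≤ (n : ℝ) ^ 2 := sq_nonneg _
  obtain ⟨s, hs⟩ := hmain (Fin n) H (by rwa [Fintype.card_fin]) (by rwa [Fintype.card_fin]) h3
    (fun v => by
      rw [Fintype.card_fin]
      refine le_trans (mul_le_mul_of_nonneg_right ?_ hsq) (hlink v)
      linarith)
    (fun v => by
      rw [Fintype.card_fin]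
      refine le_trans (mul_le_mul_of_nonneg_right ?_ hsq) (hlink v)
      linarith)
    (fun B hB => by
      rw [Fintype.card_fin] at hB ⊢
      by_contra! hle
      exact hext ⟨B, hB, (eIn_le_ordEdges h3 B).trans hle⟩)
  exact hs.hasLooseHamCycle
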